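/- Let M ⊨ ZFC and suppose C ⊆ Ord^M is a Cohen-generic class (generic for the class forcing adding a subclass of Ord with set-sized conditions, meeting every dense class definable over M). Then Def(M; C) is not a minimal GBC-realization for M: there is a GBC-realization for M strictly contained in Def(M; C). Indeed, the class C' = {α : α·2 + 1 ∈ C} is Cohen-generic with C ∉ Def(M; C'), so Def(M; C') ⊊ Def(M; C) is a GBC-realization. -/

import Mathlib

/- A self-contained formalization framework for two-sorted second-order set theories
(Gödel–Bernays `GB`, Kelley–Morse `KM`, Elementary Transfinite Recursion `ETR`, ...).

A model of second-order set theory is given by a carrier type `α`, a domain `D : Set α`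
of its sets, a membership relation `E : α → α → Prop`, and a collection
`𝒳 : Set (Set α)` of classes (extensional classes are identified with subsets of the
first-order part). Schemas are formalized via a deep embedding `Fml` of the two-sorted
language: lower-case (set) variables and upper-case (class) variables, both indexed by ℕ. -/

namespace SOST

/-- Formulas of the two-sorted language of second-order set theory.
`memSS i j` is `xᵢ ∈ xⱼ`, `memSC i j` is `xᵢ ∈ Xⱼ`, `eqS i j` is `xᵢ = xⱼ`,
`allS` quantifies a set variable, `allC` a class variable. -/
inductive Fml : Type
  | memSS : ℕ → ℕ → Fml
  | memSC : ℕ → ℕ → Fml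
  | eqS : ℕ → ℕ → Fml
  | fal : Fml
  | imp : Fml → Fml → Fml
  | allS : ℕ → Fml → Fml
  | allC : ℕ → Fml → Fml
deriving DecidableEq

/-- Negation, defined from implication and falsity. -/
def Fml.neg (φ : Fml) : Fml := φ.imp .fal

variable {α : Type*}

/-- Tarskian satisfaction for the two-sorted language, over the structure with
first-order domain `D`, membership `E` and collection of classes `𝒳`.
Set quantifiers range over `D`; class quantifiers range over `𝒳`.
`s` assigns set variables, `c` assigns class variables. -/
def Sat (D : Set α) (E : α → α → Prop) (𝒳 : Set (Set α)) :
    Fml → (ℕ → α) → (ℕ → Set α) → Prop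
  | .memSS i j, s, _ => E (s i) (s j)
  | .memSC i j, s, c => s i ∈ c j
  | .eqS i j, s, _ => s i = s j
  | .fal, _, _ => False
  | .imp φ ψ, s, c => Sat D E 𝒳 φ s c → Sat D E 𝒳 ψ s c
  | .allS i φ, s, c => ∀ x ∈ D, Sat D E 𝒳 φ (Function.update s i x) c
  | .allC i φ, s, c => ∀ X ∈ 𝒳, Sat D E 𝒳 φ s (Function.update c i X)

/-- A formula is *elementary* (first-order) if it has no class quantifiers
(class variables may still occur freely, as parameters). -/
def Fml.IsElementary : Fml → Prop
  | .memSS _ _ => True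
  | .memSC _ _ => True
  | .eqS _ _ => True
  | .fal => True
  | .imp φ ψ => φ.IsElementary ∧ ψ.IsElementary
  | .allS _ φ => φ.IsElementary
  | .allC _ _ => False

/-- A formula is *pure* if it mentions no class variables at all
(it is a formula of the first-order language of set theory). -/
def Fml.IsPure : Fml → Prop
  | .memSS _ _ => True
  | .memSC _ _ => False
  | .eqS _ _ => True
  | .fal => True
  | .imp φ ψ => φ.IsPure ∧ ψ.IsPure
  | .allS _ φ => φ.IsPure
  | .allC _ _ => False

/-- Π¹₁ formulas: a single universal class quantifier followed by an elementary formula. -/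
def Fml.IsPi11 (φ : Fml) : Prop :=
  ∃ (i : ℕ) (ψ : Fml), ψ.IsElementary ∧ φ = Fml.allC i ψ

/-- Σ¹₁ formulas: an existential class quantifier (coded as `¬∀X¬`) followed by an
elementary formula. -/
def Fml.IsSigma11 (φ : Fml) : Prop :=
  ∃ (i : ℕ) (ψ : Fml), ψ.IsElementary ∧ φ = (Fml.allC i ψ.neg).neg

/-- `x` is internally transitive: members of members (within `D`) are members. -/
def IsTransIn (D : Set α) (E : α → α → Prop) (x : α) : Prop :=
  ∀ y ∈ D, E y x → ∀ z ∈ D, E z y → E z x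

/-- `x` is internally a (von Neumann) ordinal: a transitive set of transitive sets. -/
def IsOrdIn (D : Set α) (E : α → α → Prop) (x : α) : Prop :=
  x ∈ D ∧ IsTransIn D E x ∧ ∀ y ∈ D, E y x → IsTransIn D E y

/-- `p` is internally the Kuratowski ordered pair `⟨a, b⟩ = {{a}, {a, b}}`. -/
def IsKPair (D : Set α) (E : α → α → Prop) (p a b : α) : Prop :=
  p ∈ D ∧ a ∈ D ∧ b ∈ D ∧
    ∀ z ∈ D, (E z p ↔
      ((∀ w ∈ D, E w z ↔ w = a) ∨ (∀ w ∈ D, E w z ↔ (w = a ∨ w = b))))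

/-- For a class `R` of (internal) ordered pairs, `PairIn D E R a b` says
that the pair `⟨a, b⟩` belongs to `R`, i.e. `a R b`. -/
def PairIn (D : Set α) (E : α → α → Prop) (R : Set α) (a b : α) : Prop :=
  ∃ p ∈ R, IsKPair D E p a b

/-- `R` is a class of (internal) ordered pairs, i.e. a class binary relation. -/
def IsClassRel (D : Set α) (E : α → α → Prop) (R : Set α) : Prop :=
  ∀ z ∈ R, ∃ a b, a ∈ D ∧ b ∈ D ∧ IsKPair D E z a b

/-- The field of a class relation `R`. -/
def relFld (D : Set α) (E : α → α → Prop) (R : Set α) : Set α :=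
  {a | a ∈ D ∧ ∃ b, PairIn D E R a b ∨ PairIn D E R b a}

/-- The internal (first-order) characterization of well-foundedness for a class
relation `R` over a model of `GB`: every nonempty *set* all of whose members lie
in the field of `R` has an `R`-minimal element. -/
def IntWF (D : Set α) (E : α → α → Prop) (R : Set α) : Prop :=
  ∀ d ∈ D, (∃ z ∈ D, E z d) → (∀ z ∈ D, E z d → z ∈ relFld D E R) →
    ∃ m ∈ D, E m d ∧ ∀ z ∈ D, E z d → ¬ PairIn D E R z m

/-- The first-order `ZF` axioms, with the Separation and Replacement schemas ranging over
pure formulas of the language of set theory (with set parameters). -/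
structure ZFModel (D : Set α) (E : α → α → Prop) : Prop where
  nonempty : ∃ x, x ∈ D
  exten : ∀ x ∈ D, ∀ y ∈ D, (∀ z ∈ D, E z x ↔ E z y) → x = y
  pairing : ∀ x ∈ D, ∀ y ∈ D, ∃ p ∈ D, ∀ z ∈ D, E z p ↔ (z = x ∨ z = y)
  union : ∀ x ∈ D, ∃ u ∈ D, ∀ z ∈ D, E z u ↔ ∃ w ∈ D, E w x ∧ E z w
  power : ∀ x ∈ D, ∃ p ∈ D, ∀ z ∈ D, E z p ↔ ∀ w ∈ D, E w z → E w x
  infinity : ∃ I ∈ D, (∃ e ∈ D, E e I ∧ ∀ z ∈ D, ¬ E z e) ∧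
    ∀ x ∈ D, E x I → ∃ s ∈ D, E s I ∧ ∀ z ∈ D, (E z s ↔ (E z x ∨ z = x))
  foundation : ∀ x ∈ D, (∃ z ∈ D, E z x) → ∃ m ∈ D, E m x ∧ ∀ z ∈ D, E z m → ¬ E z x
  separation : ∀ φ : Fml, φ.IsPure → ∀ s : ℕ → α, (∀ n, s n ∈ D) → ∀ a ∈ D,
    ∃ b ∈ D, ∀ z ∈ D, E z b ↔
      (E z a ∧ Sat D E ∅ φ (Function.update s 0 z) (fun _ => (∅ : Set α)))
  replacement : ∀ φ : Fml, φ.IsPure → ∀ s : ℕ → α, (∀ n, s n ∈ D) →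
    (∀ x ∈ D, ∀ y ∈ D, ∀ y' ∈ D,
      Sat D E ∅ φ (Function.update (Function.update s 0 x) 1 y) (fun _ => (∅ : Set α)) →
      Sat D E ∅ φ (Function.update (Function.update s 0 x) 1 y') (fun _ => (∅ : Set α)) →
      y = y') →
    ∀ a ∈ D, ∃ b ∈ D, ∀ y ∈ D, E y b ↔ ∃ x ∈ D, E x a ∧
      Sat D E ∅ φ (Function.update (Function.update s 0 x) 1 y) (fun _ => (∅ : Set α))

/-- The Axiom of Choice for sets (choice sets for disjoint families of nonempty sets). -/
def SatAC (D : Set α) (E : α → α → Prop) : Prop :=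
  ∀ x ∈ D, (∀ y ∈ D, E y x → ∃ z ∈ D, E z y) →
    (∀ y ∈ D, ∀ y' ∈ D, E y x → E y' x → (∃ z ∈ D, E z y ∧ E z y') → y = y') →
    ∃ c ∈ D, ∀ y ∈ D, E y x →
      ∃ z ∈ D, E z y ∧ E z c ∧ ∀ w ∈ D, E w y → E w c → w = z

/-- Gödel–Bernays set theory `GB`: ZF for the sets, extensionality for classes
(automatic here since classes are subsets of the first-order part), Class Replacement,
and Elementary Comprehension (for formulas without class quantifiers, allowing
set and class parameters). -/
structure GBModel (D : Set α) (E : α → α → Prop) (𝒳 : Set (Set α)) : Prop where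
  classes_sub : ∀ X ∈ 𝒳, X ⊆ D
  zf : ZFModel D E
  classRepl : ∀ F ∈ 𝒳,
    (∀ x y y', PairIn D E F x y → PairIn D E F x y' → y = y') →
    ∀ a ∈ D, ∃ b ∈ D, ∀ y ∈ D, E y b ↔ ∃ x ∈ D, E x a ∧ PairIn D E F x y
  elemComp : ∀ φ : Fml, φ.IsElementary → ∀ s : ℕ → α, (∀ n, s n ∈ D) →
    ∀ c : ℕ → Set α, (∀ n, c n ∈ 𝒳) →
    ∃ X ∈ 𝒳, ∀ x ∈ D, (x ∈ X ↔ Sat D E 𝒳 φ (Function.update s 0 x) c)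

/-- The Comprehension schema restricted to formulas satisfying `P`
(with set parameters and class parameters from `𝒳`). -/
def Comp (D : Set α) (E : α → α → Prop) (𝒳 : Set (Set α)) (P : Fml → Prop) : Prop :=
  ∀ φ : Fml, P φ → ∀ s : ℕ → α, (∀ n, s n ∈ D) →
    ∀ c : ℕ → Set α, (∀ n, c n ∈ 𝒳) →
    ∃ X ∈ 𝒳, ∀ x ∈ D, (x ∈ X ↔ Sat D E 𝒳 φ (Function.update s 0 x) c)

/-- Kelley–Morse set theory `KM`: `GB` together with full Comprehension for all
second-order formulas. -/
def KMModel (D : Set α) (E : α → α → Prop) (𝒳 : Set (Set α)) : Prop :=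
  GBModel D E 𝒳 ∧ Comp D E 𝒳 (fun _ => True)

/-- Π¹₁-Comprehension. -/
def Pi11CA (D : Set α) (E : α → α → Prop) (𝒳 : Set (Set α)) : Prop :=
  Comp D E 𝒳 Fml.IsPi11

/-- Δ¹₁-Comprehension: if a property of sets is equivalently defined by a Π¹₁ and a
Σ¹₁ formula (with parameters), then the corresponding class exists. -/
def Delta11CA (D : Set α) (E : α → α → Prop) (𝒳 : Set (Set α)) : Prop :=
  ∀ φ ψ : Fml, φ.IsPi11 → ψ.IsSigma11 →
    ∀ s : ℕ → α, (∀ n, s n ∈ D) → ∀ c : ℕ → Set α, (∀ n, c n ∈ 𝒳) →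
    (∀ x ∈ D, Sat D E 𝒳 φ (Function.update s 0 x) c ↔
      Sat D E 𝒳 ψ (Function.update s 0 x) c) →
    ∃ X ∈ 𝒳, ∀ x ∈ D, (x ∈ X ↔ Sat D E 𝒳 φ (Function.update s 0 x) c)

/-- Global Choice: there is a class bijection between the universe `V` and the
class `Ord` of all ordinals. -/
def GlobalChoice (D : Set α) (E : α → α → Prop) (𝒳 : Set (Set α)) : Prop :=
  ∃ F ∈ 𝒳, IsClassRel D E F ∧
    (∀ x y y', PairIn D E F x y → PairIn D E F x y' → y = y') ∧
    (∀ x x' y, PairIn D E F x y → PairIn D E F x' y → x = x') ∧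
    (∀ x ∈ D, ∃ y, PairIn D E F x y ∧ IsOrdIn D E y) ∧
    (∀ y, IsOrdIn D E y → ∃ x ∈ D, PairIn D E F x y)

/-- The `i`-th slice `(C)_i = {y : ⟨i, y⟩ ∈ C}` of a class `C`. -/
def slice (D : Set α) (E : α → α → Prop) (C : Set α) (i : α) : Set α :=
  {y | y ∈ D ∧ PairIn D E C i y}

/-- The restriction `S ↾ r` of a solution class `S` (a class of pairs) to indices
strictly `lt`-below `r`. -/
def sliceRestrict (D : Set α) (E : α → α → Prop) (S : Set α)
    (lt : α → α → Prop) (r : α) : Set α :=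
  {z | z ∈ S ∧ ∃ r' x, lt r' r ∧ IsKPair D E z r' x}

/-- Elementary transfinite recursion along the (external presentation of a) class
relation with field `F` and (transitive) order relation `lt`: for every elementary
formula `φ(x, Y, A)` with class parameter `A ∈ 𝒳` (and set parameters) there is a
solution class `S ∈ 𝒳`, i.e. a class of pairs concentrated on `F` such that for each
`r ∈ F` the slice `S_r` is `{x : φ(x, S ↾ r, A)}`. Class variable `0` is interpreted
by the partial solution `S ↾ r` and the remaining class variables by the parameter. -/
def ETRFor (D : Set α) (E : α → α → Prop) (𝒳 : Set (Set α))
    (F : Set α) (lt : α → α → Prop) : Prop :=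
  ∀ φ : Fml, φ.IsElementary → ∀ A ∈ 𝒳, ∀ s : ℕ → α, (∀ n, s n ∈ D) →
    ∃ S ∈ 𝒳, (∀ z ∈ S, ∃ r x, r ∈ F ∧ x ∈ D ∧ IsKPair D E z r x) ∧
      ∀ r ∈ F, ∀ x ∈ D,
        (PairIn D E S r x ↔
          Sat D E 𝒳 φ (Function.update s 0 x)
            (fun n => if n = 0 then sliceRestrict D E S lt r else A))

/-- The principle `ETR` of Elementary Transfinite Recursion: every elementary recursion
along a class relation in `𝒳` which the model believes to be well-founded has a
solution in `𝒳`. -/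
def ETR (D : Set α) (E : α → α → Prop) (𝒳 : Set (Set α)) : Prop :=
  ∀ R ∈ 𝒳, IsClassRel D E R → IntWF D E R →
    ETRFor D E 𝒳 (relFld D E R) (Relation.TransGen (PairIn D E R))

/-- `x` is internally a natural number: an ordinal all of whose `≤`-elements are zero
or a successor. -/
def IsNatIn (D : Set α) (E : α → α → Prop) (x : α) : Prop :=
  IsOrdIn D E x ∧ ∀ y ∈ D, (E y x ∨ y = x) →
    ((∀ z ∈ D, ¬ E z y) ∨ ∃ z ∈ D, E z y ∧ ∀ w ∈ D, (E w y ↔ (E w z ∨ w = z)))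

/-- The class `Ord` of internal ordinals. -/
def ordsOf (D : Set α) (E : α → α → Prop) : Set α := {x | IsOrdIn D E x}

/-- The class `ω` of internal natural numbers. -/
def natsOf (D : Set α) (E : α → α → Prop) : Set α := {x | IsNatIn D E x}

/-- `ETR_ω`: elementary transfinite recursion along the well-order `ω`. -/
def ETRomega (D : Set α) (E : α → α → Prop) (𝒳 : Set (Set α)) : Prop :=
  ETRFor D E 𝒳 (natsOf D E) E

/-- `ETR_Ord`: elementary transfinite recursion along the well-order `Ord`. -/
def ETROrd (D : Set α) (E : α → α → Prop) (𝒳 : Set (Set α)) : Prop :=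
  ETRFor D E 𝒳 (ordsOf D E) E

/-- `lt` is internally a well-order of the class `F`: irreflexive, transitive, total,
and every nonempty set of elements of `F` has an `lt`-minimal element. -/
def IntWORel (D : Set α) (E : α → α → Prop) (F : Set α) (lt : α → α → Prop) : Prop :=
  (∀ a ∈ F, ¬ lt a a) ∧
  (∀ a ∈ F, ∀ b ∈ F, ∀ c ∈ F, lt a b → lt b c → lt a c) ∧
  (∀ a ∈ F, ∀ b ∈ F, a = b ∨ lt a b ∨ lt b a) ∧
  (∀ d ∈ D, (∃ z ∈ D, E z d) → (∀ z ∈ D, E z d → z ∈ F) →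
    ∃ m ∈ D, E m d ∧ ∀ z ∈ D, E z d → ¬ lt z m)

/-- `W ∈ 𝒳`-style class well-order: a class relation which is internally a well-order
of its field. -/
def IsClassWO (D : Set α) (E : α → α → Prop) (W : Set α) : Prop :=
  IsClassRel D E W ∧ IntWORel D E (relFld D E W) (PairIn D E W)

/-- Strict lexicographic order on `Fin n → ℕ`, most significant coordinate first;
the order type of `(Fin n → ℕ, lex)` is `ω^n`. -/
def FinLexLt {n : ℕ} (v w : Fin n → ℕ) : Prop :=
  ∃ i : Fin n, (∀ j : Fin n, j < i → v j = w j) ∧ v i < w i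

/-- The well-order `(F, lt)` has order type at least `ω^ω`: for each `n` there is an
order embedding of `ω^n` into it. -/
def GeOmegaPowOmega (F : Set α) (lt : α → α → Prop) : Prop :=
  ∀ n : ℕ, ∃ f : (Fin n → ℕ) → α, (∀ v, f v ∈ F) ∧
    ∀ v w, FinLexLt v w → lt (f v) (f w)

/-- The field of the well-order `Γ · ω` (`ω` copies of `Γ`, for `Γ` with field `F`):
internal pairs `⟨n, g⟩` with `n` an internal natural number and `g ∈ F`. -/
def timesOmegaFld (D : Set α) (E : α → α → Prop) (F : Set α) : Set α :=
  {p | ∃ n g, IsNatIn D E n ∧ g ∈ F ∧ IsKPair D E p n g}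

/-- The ordering of `Γ · ω`: pairs `⟨n, g⟩` ordered lexicographically with the
natural-number coordinate most significant. -/
def timesOmegaLt (D : Set α) (E : α → α → Prop) (F : Set α)
    (lt : α → α → Prop) : α → α → Prop :=
  fun p q => ∃ n g m h, IsKPair D E p n g ∧ IsKPair D E q m h ∧
    IsNatIn D E n ∧ IsNatIn D E m ∧ g ∈ F ∧ h ∈ F ∧
    (E n m ∨ (n = m ∧ lt g h))

/-- The classes of `(D, E)` definable by pure first-order formulas with set parameters:
`Def(M)`. -/
def Def0 (D : Set α) (E : α → α → Prop) : Set (Set α) :=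
  {X | ∃ φ : Fml, φ.IsPure ∧ ∃ s : ℕ → α, (∀ n, s n ∈ D) ∧
    X = {x | x ∈ D ∧ Sat D E ∅ φ (Function.update s 0 x) (fun _ => (∅ : Set α))}}

/-- The classes of `(D, E)` definable by elementary formulas with set parameters and the
class parameter `A`: `Def(M; A)`. -/
def DefFrom (D : Set α) (E : α → α → Prop) (A : Set α) : Set (Set α) :=
  {X | ∃ φ : Fml, φ.IsElementary ∧ ∃ s : ℕ → α, (∀ n, s n ∈ D) ∧
    X = {x | x ∈ D ∧ Sat D E {A} φ (Function.update s 0 x) (fun _ => A)}}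

/-- `W` is a global well-order of the model: a class strict linear order of `D` which is
set-like and under which every nonempty set has a least element. -/
def IsGWO (D : Set α) (E : α → α → Prop) (W : Set α) : Prop :=
  IsClassRel D E W ∧
  (∀ a ∈ D, ¬ PairIn D E W a a) ∧
  (∀ a ∈ D, ∀ b ∈ D, ∀ c ∈ D, PairIn D E W a b → PairIn D E W b c → PairIn D E W a c) ∧
  (∀ a ∈ D, ∀ b ∈ D, a = b ∨ PairIn D E W a b ∨ PairIn D E W b a) ∧
  (∀ d ∈ D, (∃ z ∈ D, E z d) →
    ∃ m ∈ D, E m d ∧ ∀ z ∈ D, E z d → ¬ PairIn D E W z m) ∧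
  (∀ a ∈ D, ∃ d ∈ D, ∀ b ∈ D, PairIn D E W b a → E b d)

/-- `(M, 𝒳)` is a transitive model of `GB`: `M` is a transitive set, the membership
relation is the true `∈`, and the classes `𝒳` are subsets of `M`. -/
def TransGB (M : ZFSet) (𝒳 : Set (Set ZFSet)) : Prop :=
  M.IsTransitive ∧ GBModel M.toSet (· ∈ ·) 𝒳

/-- A class relation `R` on a transitive model is *truly* well-founded when the
corresponding external relation is well-founded. -/
def TrulyWF (M : ZFSet) (R : Set ZFSet) : Prop :=
  WellFounded (fun a b : ZFSet => PairIn M.toSet (· ∈ ·) R a b)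

/-- `(M, 𝒳)` is a β-model: every class relation in `𝒳` which the model believes to be
well-founded is truly well-founded. -/
def IsBeta (M : ZFSet) (𝒳 : Set (Set ZFSet)) : Prop :=
  ∀ R ∈ 𝒳, IsClassRel M.toSet (· ∈ ·) R → IntWF M.toSet (· ∈ ·) R → TrulyWF M R

end SOST

namespace SOST

/-- A Gödel code for formulas. -/
def Fml.code : Fml → ℕ
  | .memSS i j => Nat.pair 0 (Nat.pair i j)
  | .memSC i j => Nat.pair 1 (Nat.pair i j)
  | .eqS i j => Nat.pair 2 (Nat.pair i j)
  | .fal => Nat.pair 3 0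
  | .imp φ ψ => Nat.pair 4 (Nat.pair φ.code ψ.code)
  | .allS i φ => Nat.pair 5 (Nat.pair i φ.code)
  | .allC i φ => Nat.pair 6 (Nat.pair i φ.code)

/-- Satisfaction for a second-order theory given as a set `T ⊆ ω` of codes of
(two-sorted) formulas: every coded formula holds under all assignments into the model. -/
def SatSOTheory (D : Set α) (E : α → α → Prop) (𝒳 : Set (Set α)) (T : Set ℕ) : Prop :=
  ∀ φ : Fml, φ.code ∈ T → ∀ s : ℕ → α, (∀ n, s n ∈ D) →
    ∀ c : ℕ → Set α, (∀ n, c n ∈ 𝒳) → Sat D E 𝒳 φ s c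

/-- Satisfaction for a first-order theory given as a set of pure formulas. -/
def SatTheory (D : Set α) (E : α → α → Prop) (T : Set Fml) : Prop :=
  ∀ φ ∈ T, ∀ s : ℕ → α, (∀ n, s n ∈ D) →
    Sat D E ∅ φ s (fun _ => (∅ : Set α))

/-- The internal von Neumann numeral for `k`. -/
def Numeral (D : Set α) (E : α → α → Prop) : ℕ → α → Prop
  | 0, x => x ∈ D ∧ ∀ z ∈ D, ¬ E z x
  | (n + 1), x => x ∈ D ∧ ∃ y ∈ D, Numeral D E n y ∧ ∀ z ∈ D, (E z x ↔ (E z y ∨ z = y))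

/-- The external von Neumann numeral, as a `ZFSet`. -/
def zfNumeral : ℕ → ZFSet
  | 0 => ∅
  | (n + 1) => insert (zfNumeral n) (zfNumeral n)

/-- The real coded by a set `T ⊆ ω` of natural numbers, as a `ZFSet`. -/
def zfCode (T : Set ℕ) : ZFSet :=
  ZFSet.sep (fun z => ∃ k ∈ T, z = zfNumeral k) ZFSet.omega

instance : WellFoundedRelation ZFSet := ⟨_, ZFSet.mem_wf⟩

/-- The subsets of the transitive set `P` (given as a `Set ZFSet`) which are definable
over the structure `(P, ∈)` by a pure first-order formula with parameters from `P`. -/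
def DefSetsOver (P : Set ZFSet) : Set ZFSet :=
  {X | ∃ φ : Fml, φ.IsPure ∧ ∃ s : ℕ → ZFSet, (∀ n, s n ∈ P) ∧
    ∀ z : ZFSet, z ∈ X ↔
      (z ∈ P ∧ Sat P (· ∈ ·) ∅ φ (Function.update s 0 z) (fun _ => (∅ : Set ZFSet)))}

/-- `a` is a genuine von Neumann ordinal (a transitive set of transitive sets). -/
def IsVonNeumann (a : ZFSet) : Prop :=
  a.IsTransitive ∧ ∀ b ∈ a.toSet, b.IsTransitive

/-- The stage `L_a` of the constructible hierarchy, indexed by von Neumann ordinals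
(each stage consists of the subsets definable over the union of the earlier stages). -/
noncomputable def LStage (a : ZFSet) : Set ZFSet :=
  DefSetsOver (⋃ b : {b : ZFSet // b ∈ a}, LStage b.1)
termination_by a
decreasing_by exact b.2

/-- The constructible universe computed inside the transitive set `M`:
the union of the stages `L_α` for `α` an ordinal of `M`. -/
def ConstructibleOf (M : ZFSet) : Set ZFSet :=
  ⋃ a ∈ {a : ZFSet | a ∈ M ∧ IsVonNeumann a}, LStage a

/-- `L^M`, as a transitive subset of `M` (a `ZFSet`). -/
noncomputable def LM (M : ZFSet) : ZFSet :=
  ZFSet.sep (fun x => x ∈ ConstructibleOf M) M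

/-- The collection of all subclasses of (the transitive set) `N` which are amenable
to `N`: `X ∩ a ∈ N` for every `a ∈ N`. -/
def AmenablesOf (N : ZFSet) : Set (Set ZFSet) :=
  {X | X ⊆ N.toSet ∧ ∀ a ∈ N.toSet, ZFSet.sep (fun z => z ∈ X) a ∈ N.toSet}

/-- The binary class relation named by the parameter-free pure formula `θ` (with free
set variables `0` and `1`), evaluated in the model `(D, E)`. -/
def NameRel (θ : Fml) (D : Set α) (E : α → α → Prop) (x y : α) : Prop :=
  x ∈ D ∧ y ∈ D ∧ ∀ s : ℕ → α, (∀ n, s n ∈ D) →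
    Sat D E ∅ θ (Function.update (Function.update s 0 x) 1 y) (fun _ => (∅ : Set α))

/-- The field of the class relation named by `θ` in the model `(D, E)`. -/
def NameFld (θ : Fml) (D : Set α) (E : α → α → Prop) : Set α :=
  {x | ∃ y, NameRel θ D E x y ∨ NameRel θ D E y x}

/-- The set named by the parameter-free pure formula `θ` (with free set variable `0`),
evaluated in the model `(D, E)`. -/
def NameSet (θ : Fml) (D : Set α) (E : α → α → Prop) (x : α) : Prop :=
  x ∈ D ∧ ∀ s : ℕ → α, (∀ n, s n ∈ D) →
    Sat D E ∅ θ (Function.update s 0 x) (fun _ => (∅ : Set α))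

/-- `𝒴` is coded in the model by the single class `C`: the members of `𝒴` are exactly
the classes definable (by elementary formulas, with set parameters) from finitely many
slices of `C`. -/
def CodedBy (D : Set α) (E : α → α → Prop) (C : Set α) (𝒴 : Set (Set α)) : Prop :=
  ∀ X : Set α, X ∈ 𝒴 ↔
    ∃ φ : Fml, φ.IsElementary ∧ ∃ s : ℕ → α, (∀ n, s n ∈ D) ∧
      ∃ g : ℕ → α, (∀ n, g n ∈ D) ∧
      X = {x | x ∈ D ∧ Sat D E 𝒴 φ (Function.update s 0 x)
        (fun n => slice D E C (g n))}

end SOST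

namespace SOST

/-- Δ₀ (bounded) formulas of the first-order language of set theory: all quantifiers
appear in the bounded pattern `∀ xᵢ (xᵢ ∈ xⱼ → …)`. -/
def Fml.IsDelta0 : Fml → Prop
  | .memSS _ _ => True
  | .memSC _ _ => False
  | .eqS _ _ => True
  | .fal => True
  | .imp φ ψ => φ.IsDelta0 ∧ ψ.IsDelta0
  | .allS i (.imp (.memSS i' j) φ) => i = i' ∧ i ≠ j ∧ φ.IsDelta0
  | .allS _ _ => False
  | .allC _ _ => False

/-- Π₁ formulas: a block of universal set quantifiers followed by a Δ₀ formula. -/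
def Fml.IsPi1 : Fml → Prop
  | .allS _ φ => φ.IsPi1
  | φ => φ.IsDelta0

/-- Kripke–Platek set theory `KP` over the structure with domain `D` and membership `E`:
Extensionality, Pairing, Union, Δ₀-Separation, Δ₀-Collection, and Π₁-Foundation. -/
structure KPModel (D : Set α) (E : α → α → Prop) : Prop where
  exten : ∀ x ∈ D, ∀ y ∈ D, (∀ z ∈ D, E z x ↔ E z y) → x = y
  pairing : ∀ x ∈ D, ∀ y ∈ D, ∃ p ∈ D, ∀ z ∈ D, E z p ↔ (z = x ∨ z = y)
  union : ∀ x ∈ D, ∃ u ∈ D, ∀ z ∈ D, E z u ↔ ∃ w ∈ D, E w x ∧ E z w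
  delta0Sep : ∀ φ : Fml, φ.IsDelta0 → ∀ s : ℕ → α, (∀ n, s n ∈ D) → ∀ a ∈ D,
    ∃ b ∈ D, ∀ z ∈ D, E z b ↔
      (E z a ∧ Sat D E ∅ φ (Function.update s 0 z) (fun _ => (∅ : Set α)))
  delta0Coll : ∀ φ : Fml, φ.IsDelta0 → ∀ s : ℕ → α, (∀ n, s n ∈ D) → ∀ a ∈ D,
    (∀ x ∈ D, E x a → ∃ y ∈ D,
      Sat D E ∅ φ (Function.update (Function.update s 0 x) 1 y) (fun _ => (∅ : Set α))) →
    ∃ b ∈ D, ∀ x ∈ D, E x a → ∃ y ∈ D, E y b ∧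
      Sat D E ∅ φ (Function.update (Function.update s 0 x) 1 y) (fun _ => (∅ : Set α))
  pi1Foundation : ∀ φ : Fml, φ.IsPi1 → ∀ s : ℕ → α, (∀ n, s n ∈ D) →
    (∃ x ∈ D, Sat D E ∅ φ (Function.update s 0 x) (fun _ => (∅ : Set α))) →
    ∃ x ∈ D, Sat D E ∅ φ (Function.update s 0 x) (fun _ => (∅ : Set α)) ∧
      ∀ y ∈ D, E y x → ¬ Sat D E ∅ φ (Function.update s 0 y) (fun _ => (∅ : Set α))

/-- `m` is the maximum element of the class relation `N`: every other element of the
field lies below `m` in the transitive closure of `N`. -/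
def IsMaxOf (D : Set α) (E : α → α → Prop) (N : Set α) (m : α) : Prop :=
  m ∈ relFld D E N ∧
    ∀ a ∈ relFld D E N, a ≠ m → Relation.TransGen (PairIn D E N) a m

/-- A *membership code*: a well-founded (in the sense of the model), extensional class
binary relation with a maximum element. -/
def IsMemCode (D : Set α) (E : α → α → Prop) (N : Set α) : Prop :=
  IsClassRel D E N ∧ IntWF D E N ∧
    (∀ a ∈ relFld D E N, ∀ b ∈ relFld D E N,
      (∀ c, PairIn D E N c a ↔ PairIn D E N c b) → a = b) ∧
    ∃ m, IsMaxOf D E N m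

/-- The membership code `(N, m)` codes a transitive set: predecessors of predecessors
of the maximum element are predecessors of the maximum element. -/
def CodesTransitiveSet (D : Set α) (E : α → α → Prop) (N : Set α) (m : α) : Prop :=
  ∀ a b, PairIn D E N a b → PairIn D E N b m → PairIn D E N a m

/-- The set coded by `(N, m)` contains (an isomorphic copy of) the class `V` of all
sets as an element: there are `v` below `m` and a class isomorphism `I ∈ 𝒳` between
`(D, E)` and the predecessors of `v` in `N`. -/
def ContainsUniverse (D : Set α) (E : α → α → Prop) (𝒳 : Set (Set α))
    (N : Set α) (m : α) : Prop :=
  ∃ v, PairIn D E N v m ∧ ∃ I ∈ 𝒳,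
    (∀ z ∈ I, ∃ x a, x ∈ D ∧ IsKPair D E z x a) ∧
    (∀ x a a', PairIn D E I x a → PairIn D E I x a' → a = a') ∧
    (∀ x x' a, PairIn D E I x a → PairIn D E I x' a → x = x') ∧
    (∀ x ∈ D, ∃ a, PairIn D E I x a ∧ PairIn D E N a v) ∧
    (∀ a, PairIn D E N a v → ∃ x ∈ D, PairIn D E I x a) ∧
    (∀ x y a b, PairIn D E I x a → PairIn D E I y b → (E x y ↔ PairIn D E N a b))

/-- `N` is a membership code for (a transitive model of) `Hyp(V)`-style structure:
it codes a transitive model of `KP` containing the universe as an element. -/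
def IsHypVCode (D : Set α) (E : α → α → Prop) (𝒳 : Set (Set α)) (N : Set α) : Prop :=
  IsMemCode D E N ∧ ∃ m, IsMaxOf D E N m ∧ CodesTransitiveSet D E N m ∧
    KPModel {a | PairIn D E N a m} (PairIn D E N) ∧
    ContainsUniverse D E 𝒳 N m

/-- `J` is (the graph of) an isomorphism of the membership code `N₀` onto an initial
(downward closed) part of the membership code `N`. -/
def InitEmbed (D : Set α) (E : α → α → Prop) (N₀ N J : Set α) : Prop :=
  (∀ z ∈ J, ∃ a b, IsKPair D E z a b) ∧
  (∀ a b b', PairIn D E J a b → PairIn D E J a b' → b = b') ∧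
  (∀ a a' b, PairIn D E J a b → PairIn D E J a' b → a = a') ∧
  (∀ a b, PairIn D E J a b → a ∈ relFld D E N₀ ∧ b ∈ relFld D E N) ∧
  (∀ a ∈ relFld D E N₀, ∃ b, PairIn D E J a b) ∧
  (∀ a a' b b', PairIn D E J a b → PairIn D E J a' b' →
    (PairIn D E N₀ a a' ↔ PairIn D E N b b')) ∧
  (∀ a b c, PairIn D E J a b → PairIn D E N c b →
    ∃ a', PairIn D E N₀ a' a ∧ PairIn D E J a' c)

/-! ### Kripke–Platek set theory with urelements, and `Hyp(M)` -/

/-- Formulas of the language of `KPU` over a structure `M`: membership `mem`, equality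
`eq`, the urelement predicate `urel`, and the membership relation `memU` of `M` on the
urelements. -/
inductive UFml : Type
  | mem : ℕ → ℕ → UFml
  | eq : ℕ → ℕ → UFml
  | urel : ℕ → UFml
  | memU : ℕ → ℕ → UFml
  | fal : UFml
  | imp : UFml → UFml → UFml
  | all : ℕ → UFml → UFml

variable {β : Type*}

/-- Satisfaction for `UFml` in a structure `(β, u, Eb, EU)`: `u` is the urelement
predicate, `Eb` the set membership and `EU` the membership relation of `M` on the
urelements. -/
def USat (u : β → Prop) (Eb EU : β → β → Prop) : UFml → (ℕ → β) → Prop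
  | .mem i j, s => Eb (s i) (s j)
  | .eq i j, s => s i = s j
  | .urel i, s => u (s i)
  | .memU i j, s => EU (s i) (s j)
  | .fal, _ => False
  | .imp φ ψ, s => USat u Eb EU φ s → USat u Eb EU ψ s
  | .all i φ, s => ∀ x : β, USat u Eb EU φ (Function.update s i x)

/-- Δ₀ formulas of the language of `KPU`. -/
def UFml.IsDelta0 : UFml → Prop
  | .mem _ _ => True
  | .eq _ _ => True
  | .urel _ => True
  | .memU _ _ => True
  | .fal => True
  | .imp φ ψ => φ.IsDelta0 ∧ ψ.IsDelta0
  | .all i (.imp (.mem i' j) φ) => i = i' ∧ i ≠ j ∧ φ.IsDelta0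
  | .all _ _ => False

/-- Kripke–Platek set theory with urelements, `KPU`: extensionality for sets, urelements
have no members, Pairing, Union, Δ₀-Separation, Δ₀-Collection, and the Foundation
schema. -/
structure KPUModel (u : β → Prop) (Eb EU : β → β → Prop) : Prop where
  urelNoMem : ∀ x, u x → ∀ z, ¬ Eb z x
  euUrel : ∀ x y, EU x y → u x ∧ u y
  exten : ∀ x y, ¬ u x → ¬ u y → (∀ z, Eb z x ↔ Eb z y) → x = y
  pairing : ∀ x y, ∃ p, ¬ u p ∧ ∀ z, Eb z p ↔ (z = x ∨ z = y)
  union : ∀ x, ∃ w, ¬ u w ∧ ∀ z, Eb z w ↔ ∃ y, Eb y x ∧ Eb z y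
  delta0Sep : ∀ φ : UFml, φ.IsDelta0 → ∀ s : ℕ → β, ∀ a,
    ∃ b, ¬ u b ∧ ∀ z, Eb z b ↔ (Eb z a ∧ USat u Eb EU φ (Function.update s 0 z))
  delta0Coll : ∀ φ : UFml, φ.IsDelta0 → ∀ s : ℕ → β, ∀ a,
    (∀ x, Eb x a → ∃ y, USat u Eb EU φ (Function.update (Function.update s 0 x) 1 y)) →
    ∃ b, ∀ x, Eb x a → ∃ y, Eb y b ∧
      USat u Eb EU φ (Function.update (Function.update s 0 x) 1 y)
  foundation : ∀ φ : UFml, ∀ s : ℕ → β,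
    (∃ x, USat u Eb EU φ (Function.update s 0 x)) →
    ∃ x, USat u Eb EU φ (Function.update s 0 x) ∧
      ∀ y, Eb y x → ¬ USat u Eb EU φ (Function.update s 0 y)

/-- The structure `(β, u, Eb, EU)` is a model of `KPU` over the first-order model of set
theory `(α, E)`, with the urelements forming an isomorphic copy of `(α, E)` (via `ι`)
and with the set of all urelements (i.e., `M` itself) existing as an element. -/
def IsKPUOver (E : α → α → Prop) (u : β → Prop) (Eb EU : β → β → Prop)
    (ι : α → β) : Prop :=
  KPUModel u Eb EU ∧
  Function.Injective ι ∧
  (∀ x, u (ι x)) ∧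
  (∀ b, u b → ∃ x, b = ι x) ∧
  (∀ x y, EU (ι x) (ι y) ↔ E x y) ∧
  (∃ m, ¬ u m ∧ ∀ z, Eb z m ↔ u z)

/-- `S ⊆ M` is internal to the `KPU` structure: some element `b` has exactly the
urelements corresponding to `S` as its members. -/
def InternalIn (u : β → Prop) (Eb : β → β → Prop) (ι : α → β) (S : Set α) : Prop :=
  ∃ b, ¬ u b ∧ (∀ z, Eb z b → u z) ∧ ∀ x, (Eb (ι x) b ↔ x ∈ S)

/-- `Hyp(M) ∩ 𝒫(M)`: the collection of all `S ⊆ M` which are internal to every model of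
`KPU` over `M` containing `M` as an element. (For countable `M` this is exactly the
collection of subsets of `M` lying in the least admissible set `Hyp(M)` above `M`.) -/
def HypClasses {α : Type} (E : α → α → Prop) : Set (Set α) :=
  {S | ∀ (β : Type) (u : β → Prop) (Eb EU : β → β → Prop) (ι : α → β),
    IsKPUOver E u Eb EU ι → InternalIn u Eb ι S}

end SOST

namespace SOST

variable {α : Type*}

/-- `GBC`: Gödel–Bernays set theory with Global Choice. -/
def GBC (D : Set α) (E : α → α → Prop) (𝒳 : Set (Set α)) : Prop :=
  GBModel D E 𝒳 ∧ GlobalChoice D E 𝒳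

/-- The Class Collection schema: if for every set `x` there is a class `Y` with
`φ(x, Y, P̄)`, then there is a single class `C` such that for every `x` some slice
`(C)_i` witnesses `φ`. -/
def ClassCollection (D : Set α) (E : α → α → Prop) (𝒳 : Set (Set α)) : Prop :=
  ∀ φ : Fml, ∀ s : ℕ → α, (∀ n, s n ∈ D) → ∀ c : ℕ → Set α, (∀ n, c n ∈ 𝒳) →
    (∀ x ∈ D, ∃ Y ∈ 𝒳,
      Sat D E 𝒳 φ (Function.update s 0 x) (Function.update c 0 Y)) →
    ∃ C ∈ 𝒳, ∀ x ∈ D, ∃ i ∈ D,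
      Sat D E 𝒳 φ (Function.update s 0 x) (Function.update c 0 (slice D E C i))

/-- The Class Choice schema: as Class Collection, but the witnessing slice for `x`
is `(C)_x` itself. -/
def ClassChoice (D : Set α) (E : α → α → Prop) (𝒳 : Set (Set α)) : Prop :=
  ∀ φ : Fml, ∀ s : ℕ → α, (∀ n, s n ∈ D) → ∀ c : ℕ → Set α, (∀ n, c n ∈ 𝒳) →
    (∀ x ∈ D, ∃ Y ∈ 𝒳,
      Sat D E 𝒳 φ (Function.update s 0 x) (Function.update c 0 Y)) →
    ∃ C ∈ 𝒳, ∀ x ∈ D,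
      Sat D E 𝒳 φ (Function.update s 0 x) (Function.update c 0 (slice D E C x))

/-- `x` is internally the empty set (the numeral `0`). -/
def IsZeroIn (D : Set α) (E : α → α → Prop) (x : α) : Prop :=
  x ∈ D ∧ ∀ z ∈ D, ¬ E z x

/-- `x` is internally the numeral `1 = {0}`. -/
def IsOneIn (D : Set α) (E : α → α → Prop) (x : α) : Prop :=
  x ∈ D ∧ ∀ z ∈ D, (E z x ↔ IsZeroIn D E z)

/-- The pair `⟨a, b⟩` is an element of the *set* `p`. -/
def pairInSet (D : Set α) (E : α → α → Prop) (p a b : α) : Prop :=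
  ∃ z ∈ D, E z p ∧ IsKPair D E z a b

/-- `p` is a condition of the class forcing to add a Cohen subclass of `Ord`:
a set-sized binary sequence, i.e. an internal function from some ordinal to `2`. -/
def IsCond (D : Set α) (E : α → α → Prop) (p : α) : Prop :=
  p ∈ D ∧ ∃ γ, IsOrdIn D E γ ∧
    (∀ z ∈ D, E z p → ∃ ξ v, E ξ γ ∧ (IsZeroIn D E v ∨ IsOneIn D E v) ∧
      IsKPair D E z ξ v) ∧
    (∀ ξ ∈ D, E ξ γ → ∃ v, pairInSet D E p ξ v) ∧
    (∀ ξ v v', pairInSet D E p ξ v → pairInSet D E p ξ v' → v = v')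

/-- `q` extends the condition `p` (is a stronger condition). -/
def CondExtends (D : Set α) (E : α → α → Prop) (q p : α) : Prop :=
  ∀ ξ v, pairInSet D E p ξ v → pairInSet D E q ξ v

/-- The condition `p` agrees with the class `C ⊆ Ord` (is an initial segment of its
characteristic function). -/
def AgreesWith (D : Set α) (E : α → α → Prop) (C : Set α) (p : α) : Prop :=
  ∀ ξ v, pairInSet D E p ξ v → ((ξ ∈ C) ↔ IsOneIn D E v)

/-- `C ⊆ Ord` is a Cohen-generic class over the model: it is a class of ordinals
decided below every ordinal by a condition, and it meets every dense class of
conditions definable over the model from set parameters. -/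
def CohenGeneric (D : Set α) (E : α → α → Prop) (C : Set α) : Prop :=
  (∀ x ∈ C, IsOrdIn D E x) ∧
  (∀ γ, IsOrdIn D E γ → ∃ p, IsCond D E p ∧ AgreesWith D E C p ∧
    ∀ ξ ∈ D, E ξ γ → ∃ v, pairInSet D E p ξ v) ∧
  (∀ Δ ∈ Def0 D E, (∀ z ∈ Δ, IsCond D E z) →
    (∀ p, IsCond D E p → ∃ q ∈ Δ, CondExtends D E q p) →
    ∃ p ∈ Δ, AgreesWith D E C p)

/-- `𝒳` is a β-`(GB + ETR)`-realization for the transitive set `M`. -/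
def BetaETRReal (M : ZFSet) (𝒳 : Set (Set ZFSet)) : Prop :=
  GBModel M.toSet (· ∈ ·) 𝒳 ∧ ETR M.toSet (· ∈ ·) 𝒳 ∧ IsBeta M 𝒳

/-- `(D, E, 𝒳)` is (isomorphic to) a β-model: the membership relation is well-founded
and extensional (so the model is isomorphic to a transitive one), and every class
relation in `𝒳` believed to be well-founded is truly well-founded. -/
def BetaReal (D : Set α) (E : α → α → Prop) (𝒳 : Set (Set α)) : Prop :=
  WellFounded (fun x y => x ∈ D ∧ y ∈ D ∧ E x y) ∧
  (∀ x ∈ D, ∀ y ∈ D, (∀ z ∈ D, E z x ↔ E z y) → x = y) ∧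
  ∀ R ∈ 𝒳, IsClassRel D E R → IntWF D E R →
    WellFounded (fun a b => PairIn D E R a b)

end SOST

namespace SOST

/-! ### Semantic first-order definability -/

/-- A structure for the language of set theory. -/
class SM (α : Type) where
  /-- The membership relation. -/
  E : α → α → Prop
  /-- A default object. -/
  dflt : α

open SM (E)

section Definability

variable {α : Type} [SM α]

set_option linter.unusedSectionVars false

/-- Prepend a value to an assignment. -/
def push (x : α) (s : ℕ → α) : ℕ → α
  | 0 => x
  | n + 1 => s n

@[simp] theorem push_zero (x : α) (s : ℕ → α) : push x s 0 = x := rfl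

@[simp] theorem push_succ (x : α) (s : ℕ → α) (n : ℕ) : push x s (n + 1) = s n := rfl

/-- The relations on assignments which are first-order definable over `(α, E)` from set
parameters and unary predicates in `𝓑`. -/
inductive DefRel (𝓑 : Set (Set α)) : ((ℕ → α) → Prop) → Prop
  | mem (i j : ℕ) : DefRel 𝓑 fun s => E (s i) (s j)
  | eq (i j : ℕ) : DefRel 𝓑 fun s => s i = s j
  | cls (X : Set α) (hX : X ∈ 𝓑) (i : ℕ) : DefRel 𝓑 fun s => s i ∈ X
  | fal : DefRel 𝓑 fun _ => False
  | imp {P Q : (ℕ → α) → Prop} (hP : DefRel 𝓑 P) (hQ : DefRel 𝓑 Q) :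
      DefRel 𝓑 fun s => P s → Q s
  | all {P : (ℕ → α) → Prop} (hP : DefRel 𝓑 P) : DefRel 𝓑 fun s => ∀ x, P (push x s)
  | par {P : (ℕ → α) → Prop} (hP : DefRel 𝓑 P) (a : α) : DefRel 𝓑 fun s => P (push a s)

/-- Extend a renaming of variables by a fixed variable `0`. -/
def liftVar (f : ℕ → ℕ) : ℕ → ℕ
  | 0 => 0
  | n + 1 => f n + 1

theorem push_comp_liftVar (x : α) (s : ℕ → α) (f : ℕ → ℕ) :
    push x s ∘ liftVar f = push x (s ∘ f) := by
  funext n; cases n <;> rfl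

theorem DefRel.comp {𝓑 : Set (Set α)} {P : (ℕ → α) → Prop}
    (h : DefRel 𝓑 P) : ∀ f : ℕ → ℕ, DefRel 𝓑 fun s => P (s ∘ f) := by
  induction h with
  | mem i j => exact fun f => .mem _ _
  | eq i j => exact fun f => .eq _ _
  | cls X hX i => exact fun f => .cls X hX _
  | fal => exact fun f => .fal
  | imp _ _ h1 h2 => exact fun f => .imp (h1 f) (h2 f)
  | all _ h =>
    intro f
    have := DefRel.all (h (liftVar f))
    simpa only [push_comp_liftVar] using this
  | par _ a h =>
    intro f
    have := DefRel.par (h (liftVar f)) a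
    simpa only [push_comp_liftVar] using this

theorem DefRel.trans {𝓑 𝓑' : Set (Set α)} {P : (ℕ → α) → Prop}
    (h : DefRel 𝓑 P) (hB : ∀ X ∈ 𝓑, DefRel 𝓑' fun s => s 0 ∈ X) : DefRel 𝓑' P := by
  induction h with
  | mem i j => exact .mem _ _
  | eq i j => exact .eq _ _
  | cls X hX i => exact (hB X hX).comp fun _ => i
  | fal => exact .fal
  | imp _ _ h1 h2 => exact .imp h1 h2
  | all _ h => exact .all h
  | par _ a h => exact .par h a

/-- A relation on assignments is definable. -/
class Dfb (𝓑 : Set (Set α)) (P : (ℕ → α) → Prop) : Prop where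
  out : DefRel 𝓑 P

/-- A function on assignments is definable. -/
class Tm (𝓑 : Set (Set α)) (t : (ℕ → α) → α) : Prop where
  out : DefRel 𝓑 fun s => s 0 = t fun n => s (n + 1)

variable {𝓑 : Set (Set α)}

instance Dfb.fal : Dfb 𝓑 fun _ => False := ⟨.fal⟩

instance Dfb.imp {P Q : (ℕ → α) → Prop} [hP : Dfb 𝓑 P] [hQ : Dfb 𝓑 Q] :
    Dfb 𝓑 fun s => P s → Q s := ⟨.imp hP.1 hQ.1⟩

instance Dfb.not {P : (ℕ → α) → Prop} [hP : Dfb 𝓑 P] : Dfb 𝓑 fun s => ¬ P s :=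
  ⟨.imp hP.1 .fal⟩

instance Dfb.tru : Dfb 𝓑 fun _ => True :=
  ⟨by simpa using DefRel.imp (𝓑 := 𝓑) .fal .fal⟩

instance Dfb.and {P Q : (ℕ → α) → Prop} [hP : Dfb 𝓑 P] [hQ : Dfb 𝓑 Q] :
    Dfb 𝓑 fun s => P s ∧ Q s :=
  ⟨by
    have := DefRel.imp (DefRel.imp hP.1 (DefRel.imp hQ.1 .fal)) .fal
    convert this using 2
    tauto⟩

instance Dfb.or {P Q : (ℕ → α) → Prop} [hP : Dfb 𝓑 P] [hQ : Dfb 𝓑 Q] :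
    Dfb 𝓑 fun s => P s ∨ Q s :=
  ⟨by
    have := DefRel.imp (DefRel.imp hP.1 .fal) hQ.1
    convert this using 2
    tauto⟩

instance Dfb.iff {P Q : (ℕ → α) → Prop} [hP : Dfb 𝓑 P] [hQ : Dfb 𝓑 Q] :
    Dfb 𝓑 fun s => P s ↔ Q s :=
  ⟨by
    have := (inferInstance : Dfb 𝓑 fun s => (P s → Q s) ∧ (Q s → P s)).1
    convert this using 2
    tauto⟩

instance Dfb.all {R : α → (ℕ → α) → Prop} [h : Dfb 𝓑 fun s => R (s 0) fun n => s (n + 1)] :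
    Dfb 𝓑 fun s => ∀ x, R x s := ⟨by simpa using DefRel.all h.1⟩

instance Dfb.ex {R : α → (ℕ → α) → Prop} [h : Dfb 𝓑 fun s => R (s 0) fun n => s (n + 1)] :
    Dfb 𝓑 fun s => ∃ x, R x s :=
  ⟨by
    have := DefRel.imp (DefRel.all (DefRel.imp h.1 .fal)) .fal
    convert this using 2
    simp⟩

/-- Substitute a definable function for a variable. -/
theorem Dfb.sub {R : α → (ℕ → α) → Prop} (h : Dfb 𝓑 fun s => R (s 0) fun n => s (n + 1))
    {t : (ℕ → α) → α} (ht : Tm 𝓑 t) : Dfb 𝓑 fun s => R (t s) s :=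
  ⟨by
    have := (inferInstance : Dfb 𝓑 fun s => ¬ ¬ R (s 0) fun n => s (n + 1)).1
    have := DefRel.imp (DefRel.all (DefRel.imp ht.1 (DefRel.imp h.1 .fal))) .fal
    convert this using 2
    simp⟩

theorem Dfb.comp {P : (ℕ → α) → Prop} (h : Dfb 𝓑 P) (f : ℕ → ℕ) :
    Dfb 𝓑 fun s => P fun n => s (f n) := ⟨h.1.comp f⟩

theorem Tm.of_graph {t : (ℕ → α) → α}
    (h : Dfb 𝓑 fun s => s 0 = t fun n => s (n + 1)) : Tm 𝓑 t := ⟨h.1⟩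

theorem Tm.graph {t : (ℕ → α) → α} (h : Tm 𝓑 t) :
    Dfb 𝓑 fun s => s 0 = t fun n => s (n + 1) := ⟨h.1⟩

instance Tm.var (i : ℕ) : Tm 𝓑 fun s => s i := ⟨.eq _ _⟩

instance Tm.const (a : α) : Tm 𝓑 fun _ => a :=
  ⟨by
    have := DefRel.par (DefRel.eq (𝓑 := 𝓑) 1 0) a
    exact this⟩

theorem Dfb.sub1 {R : α → Prop} (h : Dfb 𝓑 fun s => R (s 0))
    {t : (ℕ → α) → α} (ht : Tm 𝓑 t) : Dfb 𝓑 fun s => R (t s) :=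
  Dfb.sub (R := fun x _ => R x) h ht

theorem Dfb.sub2 {R : α → α → Prop} (h : Dfb 𝓑 fun s => R (s 0) (s 1))
    {t u : (ℕ → α) → α} (ht : Tm 𝓑 t) (hu : Tm 𝓑 u) : Dfb 𝓑 fun s => R (t s) (u s) := by
  refine Dfb.sub (R := fun x s => R x (u s)) ?_ ht
  have h1 : Dfb 𝓑 fun s => ∀ x, x = u (fun n => s (n + 1)) → R (s 0) x := by
    have a := (Tm.graph hu).comp (fun n => if n = 0 then 0 else n + 1)
    have b := h.comp (fun n => if n = 0 then 1 else 0)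
    simp only [Nat.add_one_ne_zero, if_true, if_false, one_ne_zero] at a b
    infer_instance
  simpa using h1

theorem Dfb.sub3 {R : α → α → α → Prop} (h : Dfb 𝓑 fun s => R (s 0) (s 1) (s 2))
    {t u v : (ℕ → α) → α} (ht : Tm 𝓑 t) (hu : Tm 𝓑 u) (hv : Tm 𝓑 v) :
    Dfb 𝓑 fun s => R (t s) (u s) (v s) := by
  have a := (Tm.graph ht).comp (fun n => if n = 0 then 0 else n + 2)
  have b := (Tm.graph hu).comp (fun n => if n = 0 then 1 else n + 2)
  have c := (Tm.graph hv).comp (fun n => if n = 0 then 2 else n + 2)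
  simp only [Nat.add_one_ne_zero, if_true, if_false] at a b c
  have c' : Dfb 𝓑 fun s => ∀ z y x, x = t s → y = u s → z = v s → R x y z := by
    infer_instance
  simpa using c'

instance Dfb.mem {t u : (ℕ → α) → α} [ht : Tm 𝓑 t] [hu : Tm 𝓑 u] :
    Dfb 𝓑 fun s => E (t s) (u s) :=
  .sub2 ⟨.mem 0 1⟩ ht hu

instance Dfb.eq {t u : (ℕ → α) → α} [ht : Tm 𝓑 t] [hu : Tm 𝓑 u] :
    Dfb 𝓑 fun s => t s = u s :=
  .sub2 (R := fun x y => x = y) ⟨.eq 0 1⟩ ht hu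

theorem Dfb.cls {X : Set α} (hX : X ∈ 𝓑) (t : (ℕ → α) → α) [ht : Tm 𝓑 t] :
    Dfb 𝓑 fun s => t s ∈ X :=
  .sub1 (R := fun x => x ∈ X) ⟨.cls X hX 0⟩ ht

theorem Dfb.trans {𝓑' : Set (Set α)} {P : (ℕ → α) → Prop} (h : Dfb 𝓑 P)
    (hB : ∀ X ∈ 𝓑, Dfb 𝓑' fun s => s 0 ∈ X) : Dfb 𝓑' P :=
  ⟨h.1.trans fun X hX => (hB X hX).1⟩

theorem Dfb.congr {P Q : (ℕ → α) → Prop} (h : Dfb 𝓑 P) (e : ∀ s, Q s ↔ P s) :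
    Dfb 𝓑 Q := by
  have : Q = P := funext fun s => propext (e s)
  rwa [this]

/-! ### Translation to and from formulas -/

/-- A strict bound for the set variables occurring in a formula. -/
def Fml.bound : Fml → ℕ
  | .memSS i j => max i j + 1
  | .memSC i _ => i + 1
  | .eqS i j => max i j + 1
  | .fal => 0
  | .imp φ ψ => max φ.bound ψ.bound
  | .allS i φ => max (i + 1) φ.bound
  | .allC _ φ => φ.bound

theorem sat_congr {𝒳 : Set (Set α)} {φ : Fml} {s t : ℕ → α} {c : ℕ → Set α}
    (h : ∀ n < φ.bound, s n = t n) : Sat Set.univ E 𝒳 φ s c ↔ Sat Set.univ E 𝒳 φ t c := by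
  induction φ generalizing s t c with
  | memSS i j => simp only [Sat]; rw [h i, h j] <;> simp [Fml.bound]
  | memSC i j => simp only [Sat]; rw [h i]; simp [Fml.bound]
  | eqS i j => simp only [Sat]; rw [h i, h j] <;> simp [Fml.bound]
  | fal => rfl
  | imp φ ψ h1 h2 =>
    simp only [Sat]
    rw [h1 fun n hn => h n (lt_of_lt_of_le hn (le_max_left _ _)),
      h2 fun n hn => h n (lt_of_lt_of_le hn (le_max_right _ _))]
  | allS i φ ih =>
    simp only [Sat]
    refine forall₂_congr fun x _ => ih fun n hn => ?_
    by_cases hi : n = i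
    · simp [hi]
    · simp only [Function.update_of_ne hi]
      exact h n (lt_of_lt_of_le hn (le_max_right _ _))
  | allC i φ ih =>
    simp only [Sat]
    exact forall₂_congr fun x _ => ih h

/-- Rename the set variables of a formula. -/
def Fml.rename : Fml → (ℕ → ℕ) → Fml
  | .memSS i j, f => .memSS (f i) (f j)
  | .memSC i j, f => .memSC (f i) j
  | .eqS i j, f => .eqS (f i) (f j)
  | .fal, _ => .fal
  | .imp φ ψ, f => .imp (φ.rename f) (ψ.rename f)
  | .allS i φ, f =>
    .allS ((Finset.range φ.bound).sup f + 1)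
      (φ.rename (Function.update f i ((Finset.range φ.bound).sup f + 1)))
  | .allC i φ, f => .allC i (φ.rename f)

theorem Fml.IsElementary.rename {φ : Fml} (h : φ.IsElementary) (f : ℕ → ℕ) :
    (φ.rename f).IsElementary := by
  induction φ generalizing f with
  | imp φ ψ h1 h2 => exact ⟨h1 h.1 f, h2 h.2 f⟩
  | allS i φ ih => exact ih h _
  | allC i φ ih => exact h.elim
  | _ => trivial

theorem Fml.IsPure.rename {φ : Fml} (h : φ.IsPure) (f : ℕ → ℕ) : (φ.rename f).IsPure := by
  induction φ generalizing f with
  | imp φ ψ h1 h2 => exact ⟨h1 h.1 f, h2 h.2 f⟩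
  | allS i φ ih => exact ih h _
  | allC i φ ih => exact h.elim
  | memSC i j => exact h.elim
  | _ => trivial

theorem sat_rename {𝒳 : Set (Set α)} (φ : Fml) (f : ℕ → ℕ) (s : ℕ → α) (c : ℕ → Set α) :
    Sat Set.univ E 𝒳 (φ.rename f) s c ↔ Sat Set.univ E 𝒳 φ (s ∘ f) c := by
  induction φ generalizing f s c with
  | imp φ ψ h1 h2 => simp only [Fml.rename, Sat, h1, h2]
  | allS i φ ih =>
    simp only [Fml.rename, Sat, ih]
    refine forall₂_congr fun x _ => sat_congr fun n hn => ?_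
    by_cases hi : n = i
    · simp [hi]
    · have : f n ≤ (Finset.range φ.bound).sup f := Finset.le_sup (by simpa using hn)
      simp only [Function.comp, Function.update_of_ne hi]
      rw [Function.update_of_ne (by omega)]
  | allC i φ ih => simp only [Fml.rename, Sat, ih]
  | _ => rfl

theorem Dfb.sat {𝒳 : Set (Set α)} {φ : Fml} {c : ℕ → Set α}
    (h : φ.IsPure ∨ φ.IsElementary ∧ ∀ n, c n ∈ 𝓑) :
    Dfb 𝓑 fun s => Sat Set.univ E 𝒳 φ s c := by
  induction φ with
  | memSS i j => exact ⟨.mem i j⟩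
  | memSC i j =>
    rcases h with h | h
    · exact h.elim
    · exact ⟨.cls _ (h.2 j) i⟩
  | eqS i j => exact ⟨.eq i j⟩
  | fal => exact ⟨.fal⟩
  | imp φ ψ h1 h2 =>
    have a := h1 (h.imp And.left fun h => ⟨h.1.1, h.2⟩)
    have b := h2 (h.imp And.right fun h => ⟨h.1.2, h.2⟩)
    exact Dfb.imp
  | allS i φ ih =>
    have a := (ih h).comp fun n => if n = i then 0 else n + 1
    have b : Dfb 𝓑 fun s => ∀ x, Sat Set.univ E 𝒳 φ (fun n => if n = i then x else s n) c := by
      refine Dfb.all (h := ?_)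
      convert a using 4
      split_ifs <;> rfl
    refine b.congr fun s => ?_
    · simp only [Sat, Set.mem_univ, true_imp_iff]
      refine forall_congr' fun x => ?_
      have : Function.update s i x = fun n => if n = i then x else s n := by
        funext n; simp [Function.update_apply]
      rw [this]
  | allC i φ ih => rcases h with h | h; exacts [h.elim, h.1.elim]

theorem DefRel.exists_sat {A : Set α} (hA : 𝓑 ⊆ {A}) {P : (ℕ → α) → Prop}
    (h : DefRel 𝓑 P) (𝒳 : Set (Set α)) :
    ∃ φ : Fml, φ.IsElementary ∧ (𝓑 = ∅ → φ.IsPure) ∧ ∃ g : ℕ → ℕ ⊕ α, ∀ s,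
      P s ↔ Sat Set.univ E 𝒳 φ (fun n => Sum.elim s id (g n)) fun _ => A := by
  induction h with
  | mem i j => exact ⟨.memSS i j, trivial, fun _ => trivial, .inl, fun s => .rfl⟩
  | eq i j => exact ⟨.eqS i j, trivial, fun _ => trivial, .inl, fun s => .rfl⟩
  | cls X hX i =>
    refine ⟨.memSC i 0, trivial, fun h => ?_, .inl, fun s => ?_⟩
    · simp [h] at hX
    · obtain rfl : X = A := hA hX
      rfl
  | fal => exact ⟨.fal, trivial, fun _ => trivial, .inl, fun s => .rfl⟩
  | imp _ _ h1 h2 =>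
    obtain ⟨φ, e1, p1, g1, h1⟩ := h1
    obtain ⟨ψ, e2, p2, g2, h2⟩ := h2
    refine ⟨(φ.rename fun n => 2 * n).imp (ψ.rename fun n => 2 * n + 1),
      ⟨e1.rename _, e2.rename _⟩, fun h => ⟨(p1 h).rename _, (p2 h).rename _⟩,
      fun n => if n % 2 = 0 then g1 (n / 2) else g2 (n / 2), fun s => ?_⟩
    simp only [Sat, sat_rename, h1, h2, Function.comp_def]
    have a1 : ∀ n : ℕ, (2 * n + 1) / 2 = n := fun n => by omega
    have a2 : ∀ n : ℕ, (2 * n + 1) % 2 = 1 := fun n => by omega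
    simp [a1, a2]
  | all _ ih =>
    obtain ⟨φ, e, p, g, h⟩ := ih
    refine ⟨.allS φ.bound (φ.rename fun n =>
      Sum.elim (fun k => if k = 0 then φ.bound else n) (fun _ => n) (g n)),
      e.rename _, fun h => (p h).rename _,
      fun n => Sum.elim (fun k => .inl (k - 1)) .inr (g n), fun s => ?_⟩
    simp only [Sat, sat_rename, h, Set.mem_univ, true_imp_iff]
    refine forall_congr' fun x => sat_congr fun n hn => ?_
    rcases hg : g n with k | a
    · cases k with
      | zero => simp [hg]
      | succ k => simp [hg, Function.update_of_ne hn.ne]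
    · have e : Sum.elim (fun k => if k = 0 then φ.bound else n) (fun _ => n) (g n) = n := by
        rw [hg]; rfl
      simp only [Function.comp]
      rw [e, Function.update_of_ne hn.ne]
      simp [hg]
  | par _ a ih =>
    obtain ⟨φ, e, p, g, h⟩ := ih
    refine ⟨φ, e, p, fun n => Sum.elim (fun k => if k = 0 then .inr a else .inl (k - 1)) .inr (g n),
      fun s => ?_⟩
    refine (h _).trans (sat_congr fun n hn => ?_)
    rcases hg : g n with k | a
    · cases k <;> simp [hg]
    · simp [hg]

theorem Dfb.exists_sat₂ {A : Set α} (hA : 𝓑 ⊆ {A}) {R : α → α → Prop}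
    (h : Dfb 𝓑 fun s => R (s 0) (s 1)) (𝒳 : Set (Set α)) :
    ∃ φ : Fml, φ.IsElementary ∧ (𝓑 = ∅ → φ.IsPure) ∧ ∃ s : ℕ → α, ∀ x y,
      R x y ↔ Sat Set.univ E 𝒳 φ (Function.update (Function.update s 0 x) 1 y) fun _ => A := by
  obtain ⟨φ, e, p, g, h⟩ := h.1.exists_sat hA 𝒳
  refine ⟨φ.rename fun n => Sum.elim (fun k => if k = 0 then 0 else 1) (fun _ => n + 2) (g n),
    e.rename _, fun h => (p h).rename _,
    fun n => Sum.elim (fun _ => SM.dflt) id (g (n - 2)), fun x y => ?_⟩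
  have := h (push x fun _ => y)
  simp only [push_zero] at this
  rw [show push x (fun _ => y) 1 = y from rfl] at this
  rw [this, sat_rename]
  refine sat_congr fun n hn => ?_
  rcases hg : g n with k | a
  · cases k <;> simp [hg]
  · simp [hg]

end Definability

end SOST

namespace SOST

set_option linter.unusedSectionVars false

open SM (E)

/-! ### Definite descriptions and set abstraction -/

section Abstraction

variable {α : Type} [SM α] {𝓑 : Set (Set α)}

theorem Tm.sub1 {f : α → α} (h : Tm 𝓑 fun s => f (s 0))
    {t : (ℕ → α) → α} (ht : Tm 𝓑 t) : Tm 𝓑 fun s => f (t s) := by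
  have a := (Tm.graph ht).comp (fun n => if n = 0 then 0 else n + 1)
  have b := (Tm.graph h).comp (fun n => if n = 0 then 1 else 0)
  simp only [Nat.add_one_ne_zero, if_true, if_false] at a b
  have c : Dfb 𝓑 fun s => ∀ x, x = t (fun n => s (n + 1)) → s 0 = f x := by infer_instance
  refine .of_graph (c.congr fun s => ?_)
  simp

theorem Tm.sub2 {f : α → α → α} (h : Tm 𝓑 fun s => f (s 0) (s 1))
    {t u : (ℕ → α) → α} (ht : Tm 𝓑 t) (hu : Tm 𝓑 u) : Tm 𝓑 fun s => f (t s) (u s) := by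
  have a := (Tm.graph ht).comp (fun n => if n = 0 then 0 else n + 2)
  have b := (Tm.graph hu).comp (fun n => if n = 0 then 1 else n + 2)
  have c := (Tm.graph h).comp (fun n => if n = 0 then 2 else n - 1)
  simp only [Nat.add_one_ne_zero, if_true, if_false, Nat.add_sub_cancel] at a b c
  have d : Dfb 𝓑 fun s => ∀ y x, x = t (fun n => s (n + 1)) → y = u (fun n => s (n + 1)) →
    s 0 = f x y := by infer_instance
  refine .of_graph (d.congr fun s => ?_)
  simp

theorem Tm.sub3 {f : α → α → α → α} (h : Tm 𝓑 fun s => f (s 0) (s 1) (s 2))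
    {t u v : (ℕ → α) → α} (ht : Tm 𝓑 t) (hu : Tm 𝓑 u) (hv : Tm 𝓑 v) :
    Tm 𝓑 fun s => f (t s) (u s) (v s) := by
  have a := (Tm.graph ht).comp (fun n => if n = 0 then 0 else n + 3)
  have b := (Tm.graph hu).comp (fun n => if n = 0 then 1 else n + 3)
  have b' := (Tm.graph hv).comp (fun n => if n = 0 then 2 else n + 3)
  have c := (Tm.graph h).comp (fun n => if n = 0 then 3 else n - 1)
  simp only [Nat.add_one_ne_zero, if_true, if_false, Nat.add_sub_cancel] at a b b' c
  have d : Dfb 𝓑 fun s => ∀ z y x, x = t (fun n => s (n + 1)) → y = u (fun n => s (n + 1)) →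
    z = v (fun n => s (n + 1)) → s 0 = f x y z := by infer_instance
  refine .of_graph (d.congr fun s => ?_)
  simp


open Classical in
/-- The unique object satisfying `P`, and a fixed junk value if there is none. -/
noncomputable def the (P : α → Prop) : α := if h : ∃! x, P x then h.choose else SM.dflt

theorem the_eq {P : α → Prop} {a : α} (h : P a) (hu : ∀ b, P b → b = a) : the P = a := by
  have h' : ∃! x, P x := ⟨a, h, hu⟩
  rw [the, dif_pos h']
  exact hu _ h'.choose_spec.1

theorem eq_the_iff {P : α → Prop} {a : α} : a = the P ↔ (P a ∧ ∀ b, P b → b = a) ∨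
    (¬ ∃ x, P x ∧ ∀ b, P b → b = x) ∧ a = SM.dflt := by
  by_cases h : ∃ x, P x ∧ ∀ b, P b → b = x
  · obtain ⟨x, h1, h2⟩ := h
    rw [the_eq h1 h2]
    refine ⟨?_, ?_⟩
    · rintro rfl
      exact .inl ⟨h1, h2⟩
    · rintro (h | h)
      · exact h2 _ h.1
      · exact (h.1 ⟨x, h1, h2⟩).elim
  · have : ¬ ∃! x, P x := h
    rw [the, dif_neg this]
    refine ⟨fun e => .inr ⟨h, e⟩, ?_⟩
    rintro (h' | h')
    · exact (h ⟨_, h'⟩).elim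
    · exact h'.2

instance Tm.the {R : α → (ℕ → α) → Prop} [h : Dfb 𝓑 fun s => R (s 0) fun n => s (n + 1)] :
    Tm 𝓑 fun s => the fun z => R z s := by
  have h2 := h.comp fun n => if n = 0 then 0 else n + 1
  have h3 := h.comp fun n => if n = 0 then 0 else n + 2
  simp only [Nat.add_one_ne_zero, if_true, if_false] at h2 h3
  refine .of_graph (Dfb.congr (P := fun s => (R (s 0) (fun n => s (n + 1)) ∧
    ∀ b, R b (fun n => s (n + 1)) → b = s 0) ∨ (¬ ∃ x, R x (fun n => s (n + 1)) ∧
    ∀ b, R b (fun n => s (n + 1)) → b = x) ∧ s 0 = SM.dflt) inferInstance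
    fun s => eq_the_iff)

/-- The set of all `z` with `P z`. -/
noncomputable def coll (P : α → Prop) : α := the fun b => ∀ z, E z b ↔ P z

instance Tm.coll {R : α → (ℕ → α) → Prop} [h : Dfb 𝓑 fun s => R (s 0) fun n => s (n + 1)] :
    Tm 𝓑 fun s => coll fun z => R z s := by
  have h2 := h.comp fun n => if n = 0 then 0 else n + 1
  simp only [Nat.add_one_ne_zero, if_true, if_false] at h2
  unfold SOST.coll
  infer_instance

/-- The class `P` is a set. -/
def IsSet (P : α → Prop) : Prop := ∃ b, ∀ z, E z b ↔ P z

end Abstraction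

/-! ### Zermelo–Fraenkel set theory, relativized to classes -/

section SetTheory

variable {α : Type} [SM α]

/-- The axioms of `ZF` other than the schemas. -/
class ZF0 (α : Type) [SM α] : Prop where
  ext : ∀ x y : α, (∀ z, E z x ↔ E z y) → x = y
  pairing : ∀ x y : α, IsSet fun z => z = x ∨ z = y
  union : ∀ x : α, IsSet fun z => ∃ w, E w x ∧ E z w
  power : ∀ x : α, IsSet fun z => ∀ w, E w z → E w x
  inf : ∃ I : α, (∃ e, E e I ∧ ∀ z, ¬ E z e) ∧ ∀ x, E x I → ∃ s, E s I ∧ ∀ z, E z s ↔ E z x ∨ z = x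
  found : ∀ x : α, (∃ z, E z x) → ∃ m, E m x ∧ ∀ z, E z m → ¬ E z x

/-- The schemas of Separation and Replacement for relations definable from `𝓑`. -/
class ZB (α : Type) [SM α] (𝓑 : Set (Set α)) : Prop where
  sep : ∀ P : α → Prop, Dfb 𝓑 (fun s => P (s 0)) → ∀ a, IsSet fun z => E z a ∧ P z
  repl : ∀ R : α → α → Prop, Dfb 𝓑 (fun s => R (s 0) (s 1)) →
    (∀ x y y', R x y → R x y' → y = y') → ∀ a, IsSet fun y => ∃ x, E x a ∧ R x y

variable {𝓑 : Set (Set α)} [ZF0 α]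

theorem mem_coll {P : α → Prop} (h : IsSet P) {z : α} : E z (coll P) ↔ P z := by
  obtain ⟨b, hb⟩ := h
  have : coll P = b := the_eq hb fun c hc => ZF0.ext _ _ fun z => by rw [hc, hb]
  rw [this, hb]

theorem coll_eq {P : α → Prop} {b : α} (h : ∀ z, E z b ↔ P z) : coll P = b :=
  ZF0.ext _ _ fun z => by rw [mem_coll ⟨b, h⟩, h]

theorem sext {x y : α} (h : ∀ z, E z x ↔ E z y) : x = y := ZF0.ext x y h

theorem IsSet.sub [ZB α 𝓑] {P Q : α → Prop} (hQ : IsSet Q) (hP : Dfb 𝓑 fun s => P (s 0))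
    (h : ∀ z, P z → Q z) : IsSet P := by
  obtain ⟨a, ha⟩ := hQ
  obtain ⟨b, hb⟩ := ZB.sep P hP a
  exact ⟨b, fun z => by simp only [hb, ha]; exact ⟨And.right, fun hz => ⟨h z hz, hz⟩⟩⟩

theorem isSet_mem (a : α) : IsSet fun z => E z a := ⟨a, fun _ => .rfl⟩

theorem isSet_repl [ZB α 𝓑] {R : α → α → Prop} (hR : Dfb 𝓑 fun s => R (s 0) (s 1)) {a : α}
    (h : ∀ x y y', E x a → R x y → R x y' → y = y') : IsSet fun y => ∃ x, E x a ∧ R x y := by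
  have e : Dfb 𝓑 fun s => E (s 0) a ∧ R (s 0) (s 1) := inferInstance
  obtain ⟨b, hb⟩ := ZB.repl (fun x y => E x a ∧ R x y) e
    (fun x y y' h1 h2 => h x y y' h1.1 h1.2 h2.2) a
  exact ⟨b, fun y => by simp only [hb]; exact exists_congr fun x => by tauto⟩

theorem isSet_image [ZB α 𝓑] {f : α → α} (hf : Tm 𝓑 fun s => f (s 0)) (a : α) :
    IsSet fun y => ∃ x, E x a ∧ y = f x := by
  have := hf.graph.comp fun n => 1 - n
  exact isSet_repl (𝓑 := 𝓑) (R := fun x y => y = f x) this fun x y y' _ h1 h2 => h1.trans h2.symm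

/-! ### Basic set operations -/

/-- The empty set. -/
noncomputable def emp : α := coll fun _ => False

/-- The unordered pair. -/
noncomputable def up (a b : α) : α := coll fun z => z = a ∨ z = b

/-- The union of a set. -/
noncomputable def un (a : α) : α := coll fun z => ∃ w, E w a ∧ E z w

/-- The power set. -/
noncomputable def pow (a : α) : α := coll fun z => ∀ w, E w z → E w a

/-- The union of two sets. -/
noncomputable def cup (a b : α) : α := coll fun z => E z a ∨ E z b

/-- The successor `a ∪ {a}`. -/
noncomputable def suc (a : α) : α := coll fun z => E z a ∨ z = a

/-- The Kuratowski pair. -/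
noncomputable def kp (a b : α) : α := up (up a a) (up a b)

/-- The subset relation. -/
def Sub (a b : α) : Prop := ∀ z, E z a → E z b

theorem mem_emp {z : α} : ¬ E z (emp) := by
  obtain ⟨I, ⟨e, -, he⟩, -⟩ := ZF0.inf (α := α)
  rw [emp, mem_coll ⟨e, fun z => by simpa using he z⟩]
  exact id

theorem mem_up {z a b : α} : E z (up a b) ↔ z = a ∨ z = b := mem_coll (ZF0.pairing a b)

theorem mem_un {z a : α} : E z (un a) ↔ ∃ w, E w a ∧ E z w := mem_coll (ZF0.union a)

theorem mem_pow {z a : α} : E z (pow a) ↔ ∀ w, E w z → E w a := mem_coll (ZF0.power a)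

theorem mem_cup {z a b : α} : E z (cup a b) ↔ E z a ∨ E z b :=
  mem_coll ⟨un (up a b), fun z => by simp [mem_un, mem_up]⟩

theorem mem_suc {z a : α} : E z (suc a) ↔ E z a ∨ z = a :=
  mem_coll ⟨cup a (up a a), fun z => by simp [mem_cup, mem_up]⟩

theorem up_inj {a b c d : α} (h : up a b = up c d) :
    a = c ∧ b = d ∨ a = d ∧ b = c := by
  have h1 : ∀ z, (z = a ∨ z = b) ↔ (z = c ∨ z = d) := fun z => by
    rw [← mem_up, h, mem_up]
  have ha := h1 a
  have hb := h1 b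
  have hc := h1 c
  have hd := h1 d
  grind

theorem kp_inj {a b c d : α} : kp a b = kp c d ↔ a = c ∧ b = d := by
  refine ⟨fun h => ?_, fun h => by rw [h.1, h.2]⟩
  rcases up_inj h with ⟨h1, h2⟩ | ⟨h1, h2⟩ <;> have h1 := up_inj h1 <;> have h2 := up_inj h2 <;>
    grind

instance Tm.emp : Tm 𝓑 fun _ => emp := Tm.const _

variable {t u v : (ℕ → α) → α}

instance Tm.up [ht : Tm 𝓑 t] [hu : Tm 𝓑 u] : Tm 𝓑 fun s => up (t s) (u s) :=
  .sub2 (by unfold SOST.up; infer_instance) ht hu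

instance Tm.un [ht : Tm 𝓑 t] : Tm 𝓑 fun s => un (t s) :=
  .sub1 (by unfold SOST.un; infer_instance) ht

instance Tm.cup [ht : Tm 𝓑 t] [hu : Tm 𝓑 u] : Tm 𝓑 fun s => cup (t s) (u s) :=
  .sub2 (by unfold SOST.cup; infer_instance) ht hu

instance Tm.suc [ht : Tm 𝓑 t] : Tm 𝓑 fun s => suc (t s) :=
  .sub1 (by unfold SOST.suc; infer_instance) ht

instance Tm.kp [ht : Tm 𝓑 t] [hu : Tm 𝓑 u] : Tm 𝓑 fun s => kp (t s) (u s) :=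
  .sub2 (by unfold SOST.kp; infer_instance) ht hu

instance Dfb.subset [ht : Tm 𝓑 t] [hu : Tm 𝓑 u] : Dfb 𝓑 fun s => Sub (t s) (u s) :=
  .sub2 (by unfold Sub; infer_instance) ht hu

theorem mem_irrefl {x : α} : ¬ E x x := fun h => by
  obtain ⟨m, hm, h'⟩ := ZF0.found (up x x) ⟨x, mem_up.2 (.inl rfl)⟩
  obtain rfl : m = x := by simpa using mem_up.1 hm
  exact h' m h hm

theorem mem_asymm {x y : α} (h : E x y) (h2 : E y x) : False := by
  obtain ⟨m, hm, h'⟩ := ZF0.found (up x y) ⟨x, mem_up.2 (.inl rfl)⟩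
  rcases mem_up.1 hm with rfl | rfl
  · exact h' y h2 (mem_up.2 (.inr rfl))
  · exact h' x h (mem_up.2 (.inl rfl))

/-! ### Ordinals -/

/-- `x` is an ordinal. -/
def Od (x : α) : Prop :=
  (∀ y, E y x → ∀ z, E z y → E z x) ∧ ∀ y, E y x → ∀ z, E z y → ∀ w, E w z → E w y

instance Dfb.od [ht : Tm 𝓑 t] : Dfb 𝓑 fun s => Od (t s) :=
  .sub1 (by unfold Od; infer_instance) ht

theorem Od.trans {x y z : α} (h : Od x) (hy : E y x) (hz : E z y) : E z x := h.1 y hy z hz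

theorem Od.mem {x y : α} (h : Od x) (hy : E y x) : Od y :=
  ⟨h.2 y hy, fun z hz => h.2 z (h.1 y hy z hz)⟩

theorem Od.suc {x : α} (h : Od x) : Od (suc x) := by
  refine ⟨fun y hy z hz => ?_, fun y hy => ?_⟩
  · rw [mem_suc] at *
    rcases hy with hy | rfl
    · exact .inl (h.1 y hy z hz)
    · exact .inl hz
  · rcases mem_suc.1 hy with hy | rfl
    · exact h.2 y hy
    · exact h.1

theorem Od.emp : Od (SOST.emp : α) := ⟨fun _ h => (mem_emp h).elim, fun _ h => (mem_emp h).elim⟩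

theorem Od.un {a : α} (h : ∀ x, E x a → Od x) : Od (un a) := by
  refine ⟨fun y hy z hz => ?_, fun y hy => ?_⟩
  · rw [mem_un] at *
    obtain ⟨w, hw, hy⟩ := hy
    exact ⟨w, hw, (h w hw).1 y hy z hz⟩
  · obtain ⟨w, hw, hy⟩ := mem_un.1 hy
    exact (h w hw).2 y hy

theorem Od.cup {a b : α} (ha : Od a) (hb : Od b) : Od (cup a b) := by
  have : SOST.cup a b = SOST.un (up a b) := sext fun z => by simp [mem_cup, mem_un, mem_up]
  rw [this]
  refine Od.un fun x hx => ?_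
  rcases mem_up.1 hx with rfl | rfl <;> assumption

theorem od_min [ZB α 𝓑] {P : α → Prop} (hP : Dfb 𝓑 fun s => P (s 0)) {x : α} (hx : Od x)
    (h : P x) : ∃ m, Od m ∧ P m ∧ ∀ y, E y m → ¬ P y := by
  have d : Dfb 𝓑 fun s => E (s 0) (SOST.suc x) ∧ P (s 0) := inferInstance
  obtain ⟨b, hb⟩ := (isSet_mem (SOST.suc x)).sub (P := fun z => E z (SOST.suc x) ∧ P z) d
    fun z hz => hz.1
  obtain ⟨m, hm, h'⟩ := ZF0.found b ⟨x, (hb x).2 ⟨mem_suc.2 (.inr rfl), h⟩⟩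
  obtain ⟨h1, h2⟩ := (hb m).1 hm
  exact ⟨m, hx.suc.mem h1, h2, fun y hy hP => h' y hy ((hb y).2 ⟨hx.suc.trans h1 hy, hP⟩)⟩

theorem od_ind (𝓑 : Set (Set α)) [ZB α 𝓑] {P : α → Prop} (hP : Dfb 𝓑 fun s => P (s 0))
    (h : ∀ x, Od x → (∀ y, E y x → P y) → P x) (x : α) (hx : Od x) : P x := by
  by_contra hn
  obtain ⟨m, hm, h1, h2⟩ := od_min (𝓑 := 𝓑) (P := fun x => ¬ P x) inferInstance hx hn
  exact h1 (h m hm fun y hy => not_not.1 (h2 y hy))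

section Pure

variable [ZB α ∅]

theorem Od.trich {x y : α} (hx : Od x) (hy : Od y) : E x y ∨ x = y ∨ E y x := by
  suffices ∀ y, Od y → E x y ∨ x = y ∨ E y x from this y hy
  refine od_ind ∅ (P := fun x => ∀ y, Od y → E x y ∨ x = y ∨ E y x) inferInstance ?_ x hx
  intro x hx ihx
  refine od_ind ∅ (P := fun y => E x y ∨ x = y ∨ E y x) inferInstance ?_
  intro y hy ihy
  by_contra! hn
  refine hn.2.1 (sext fun z => ⟨fun hz => ?_, fun hz => ?_⟩)
  · rcases ihx z hz y hy with h | rfl | h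
    · exact h
    · exact (hn.2.2 hz).elim
    · exact (hn.2.2 (hx.trans hz h)).elim
  · rcases ihy z hz with h | rfl | h
    · exact (hn.1 (hy.trans hz h)).elim
    · exact (hn.1 hz).elim
    · exact h

theorem Od.sub_iff {x y : α} (hx : Od x) (hy : Od y) : Sub x y ↔ E x y ∨ x = y := by
  refine ⟨fun h => ?_, ?_⟩
  · rcases hx.trich hy with h' | h' | h'
    · exact .inl h'
    · exact .inr h'
    · exact (mem_irrefl (h y h')).elim
  · rintro (h | rfl)
    · exact fun z hz => hy.trans h hz
    · exact fun z hz => hz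

theorem Od.not_mem_iff {x y : α} (hx : Od x) (hy : Od y) : ¬ E x y ↔ Sub y x := by
  rw [hy.sub_iff hx]
  rcases hx.trich hy with h | h | h
  · have := mem_asymm h
    have h3 : y ≠ x := by rintro rfl; exact mem_irrefl h
    tauto
  · subst h; simp [mem_irrefl]
  · have := mem_asymm h
    tauto

theorem Od.sub_total {x y : α} (hx : Od x) (hy : Od y) : Sub x y ∨ Sub y x := by
  rw [hx.sub_iff hy, hy.sub_iff hx]
  rcases hx.trich hy with h | h | h <;> simp [h]

theorem Od.suc_sub {x y : α} (hy : Od y) (h : E x y) : Sub (SOST.suc x) y := fun z hz => by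
  rcases mem_suc.1 hz with hz | rfl
  · exact hy.trans h hz
  · exact h

theorem suc_inj {x y : α} (h : suc x = suc y) : x = y := by
  have h1 : E x (suc y) := h ▸ mem_suc.2 (.inr rfl)
  have h2 : E y (suc x) := h ▸ mem_suc.2 (.inr rfl)
  rcases mem_suc.1 h1 with h1 | h1
  · rcases mem_suc.1 h2 with h2 | h2
    · exact (mem_asymm h1 h2).elim
    · exact h2.symm
  · exact h1

theorem not_all_od (a : α) : ¬ ∀ x, Od x → E x a := fun h => by
  obtain ⟨b, hb⟩ := (isSet_mem a).sub (𝓑 := ∅) (P := fun x => E x a ∧ Od x) inferInstance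
    fun z hz => hz.1
  have o : Od (un b) := Od.un fun x hx => ((hb x).1 hx).2
  have : E (suc (un b)) b := (hb _).2 ⟨h _ o.suc, o.suc⟩
  exact mem_irrefl (mem_un.2 ⟨_, this, mem_suc.2 (.inr rfl)⟩ : E (un b) (un b))

end Pure

/-- The least ordinal with property `P`. -/
noncomputable def lst (P : α → Prop) : α := the fun x => Od x ∧ P x ∧ ∀ y, E y x → ¬ P y

instance Tm.lst {R : α → (ℕ → α) → Prop} [h : Dfb 𝓑 fun s => R (s 0) fun n => s (n + 1)] :
    Tm 𝓑 fun s => lst fun z => R z s := by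
  have h2 := h.comp fun n => if n = 0 then 0 else n + 1
  simp only [Nat.add_one_ne_zero, if_true, if_false] at h2
  unfold SOST.lst
  infer_instance

theorem lst_spec [ZB α ∅] [ZB α 𝓑] {P : α → Prop} (hP : Dfb 𝓑 fun s => P (s 0)) {x : α}
    (hx : Od x) (h : P x) :
    Od (lst P) ∧ P (lst P) ∧ ∀ y, Od y → P y → Sub (lst P) y := by
  obtain ⟨m, hm, h1, h2⟩ := od_min hP hx h
  have : lst P = m := by
    refine the_eq ⟨hm, h1, h2⟩ fun b hb => ?_
    rcases hb.1.trich hm with h | h | h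
    · exact (h2 b h hb.2.1).elim
    · exact h
    · exact (hb.2.2 m h h1).elim
  rw [this]
  refine ⟨hm, h1, fun y hy hPy => ?_⟩
  rw [← hy.not_mem_iff hm]
  exact fun h => h2 y h hPy

end SetTheory

end SOST

namespace SOST

set_option linter.unusedSectionVars false

open SM (E)

/-! ### Recursion -/

section Recursion

variable {α : Type} [SM α] {𝓑 : Set (Set α)} [ZF0 α]

/-- `h` is an attempt at the recursion given by `G` with parameter `p`. -/
def Att (G : α → α → α → α) (p h : α) : Prop :=
  ∀ m d, E (kp m d) h → ∃ A, (∀ z, E z A ↔ ∃ y, E y m ∧ E (kp y z) h) ∧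
    (∀ y, E y m → ∃ z, E (kp y z) h) ∧ d = G p m A

/-- Some attempt takes the value `d` at `m`. -/
def RecRel (G : α → α → α → α) (p m d : α) : Prop := ∃ h, Att G p h ∧ E (kp m d) h

/-- The function defined by recursion from `G` with parameter `p`: its value at `m` is
`G p m A`, where `A` is the set of values at the members of `m`. -/
noncomputable def recf (G : α → α → α → α) (p m : α) : α := the fun d => RecRel G p m d

instance Dfb.att {G : α → α → α → α} [hG : Tm 𝓑 fun s => G (s 0) (s 1) (s 2)]
    {t u : (ℕ → α) → α} [ht : Tm 𝓑 t] [hu : Tm 𝓑 u] : Dfb 𝓑 fun s => Att G (t s) (u s) := by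
  have : ∀ i j k, Tm 𝓑 fun s => G (s i) (s j) (s k) := fun i j k =>
    .sub3 hG (.var i) (.var j) (.var k)
  exact .sub2 (by unfold Att; infer_instance) ht hu

instance Dfb.recRel {G : α → α → α → α} [hG : Tm 𝓑 fun s => G (s 0) (s 1) (s 2)]
    {t u v : (ℕ → α) → α} [ht : Tm 𝓑 t] [hu : Tm 𝓑 u] [hv : Tm 𝓑 v] :
    Dfb 𝓑 fun s => RecRel G (t s) (u s) (v s) :=
  .sub3 (by unfold RecRel; infer_instance) ht hu hv

instance Tm.recf {G : α → α → α → α} [hG : Tm 𝓑 fun s => G (s 0) (s 1) (s 2)]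
    {t u : (ℕ → α) → α} [ht : Tm 𝓑 t] [hu : Tm 𝓑 u] : Tm 𝓑 fun s => recf G (t s) (u s) :=
  .sub2 (by unfold SOST.recf; infer_instance) ht hu

variable [ZB α 𝓑] {T : α → Prop}

theorem tind
    (hT : ∀ m, T m → ∃ t, E m t ∧ ∀ y, E y t → T y ∧ ∀ z, E z y → E z t)
    {P : α → Prop} (hP : Dfb 𝓑 fun s => P (s 0))
    (h : ∀ m, T m → (∀ y, E y m → T y) → (∀ y, E y m → P y) → P m) (m : α) (hm : T m) : P m := by
  by_contra hn
  obtain ⟨t, h1, h2⟩ := hT m hm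
  obtain ⟨b, hb⟩ := (isSet_mem t).sub (𝓑 := 𝓑) (P := fun z => E z t ∧ ¬ P z) inferInstance
    fun z hz => hz.1
  obtain ⟨m', h3, h4⟩ := ZF0.found b ⟨m, (hb m).2 ⟨h1, hn⟩⟩
  obtain ⟨h5, h6⟩ := (hb m').1 h3
  have h7 := h2 m' h5
  exact h6 (h m' h7.1 (fun y hy => (h2 y (h7.2 y hy)).1) fun y hy => by_contra fun hP =>
    h4 y hy ((hb y).2 ⟨h7.2 y hy, hP⟩))

variable {G : α → α → α → α}

theorem recRel_unique
    (hT : ∀ m, T m → ∃ t, E m t ∧ ∀ y, E y t → T y ∧ ∀ z, E z y → E z t)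
    (hG : Tm 𝓑 fun s => G (s 0) (s 1) (s 2)) (p m : α) (hm : T m) :
    ∀ d d', RecRel G p m d → RecRel G p m d' → d = d' := by
  refine tind (𝓑 := 𝓑) hT
    (P := fun m => ∀ d d', RecRel G p m d → RecRel G p m d' → d = d') inferInstance ?_ m hm
  rintro m - - ih d d' ⟨h, a, e⟩ ⟨h', a', e'⟩
  obtain ⟨A, b1, b2, rfl⟩ := a m d e
  obtain ⟨A', b1', b2', rfl⟩ := a' m d' e'
  congr 1
  refine sext fun z => ?_
  rw [b1, b1']
  refine exists_congr fun y => and_congr_right fun hy => ?_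
  obtain ⟨z1, hz1⟩ := b2 y hy
  obtain ⟨z2, hz2⟩ := b2' y hy
  refine ⟨fun hz => ?_, fun hz => ?_⟩
  · rwa [ih y hy z z2 ⟨h, a, hz⟩ ⟨h', a', hz2⟩]
  · rwa [ih y hy z z1 ⟨h', a', hz⟩ ⟨h, a, hz1⟩]

theorem exists_recRel
    (hT : ∀ m, T m → ∃ t, E m t ∧ ∀ y, E y t → T y ∧ ∀ z, E z y → E z t)
    (hG : Tm 𝓑 fun s => G (s 0) (s 1) (s 2)) (p m : α) (hm : T m) :
    ∃ d, RecRel G p m d := by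
  refine tind (𝓑 := 𝓑) hT (P := fun m => ∃ d, RecRel G p m d) inferInstance ?_ m hm
  intro m hm hTm ih
  by_contra hn
  have uq := recRel_unique hT hG p
  obtain ⟨t, h1, h2⟩ := hT m hm
  obtain ⟨h0, hh0⟩ := isSet_repl (𝓑 := 𝓑) (a := t)
    (R := fun y w => ∃ z, w = kp y z ∧ RecRel G p y z) inferInstance (by
      rintro y w w' hy ⟨z, rfl, h⟩ ⟨z', rfl, h'⟩
      rw [uq y (h2 y hy).1 z z' h h'])
  have hh0' : ∀ y z, E (kp y z) h0 ↔ E y t ∧ RecRel G p y z := fun y z => by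
    rw [hh0]
    refine ⟨?_, fun h => ⟨y, h.1, z, rfl, h.2⟩⟩
    rintro ⟨y', h, z', e, h'⟩
    obtain ⟨rfl, rfl⟩ := kp_inj.1 e
    exact ⟨h, h'⟩
  obtain ⟨A, hA⟩ := isSet_repl (𝓑 := 𝓑) (a := m) (R := fun y z => RecRel G p y z) inferInstance
    fun y z z' hy h h' => uq y (hTm y hy) z z' h h'
  have hm2 := (h2 m h1).2
  set h := cup h0 (up (kp m (G p m A)) (kp m (G p m A))) with hh
  have mem_h : ∀ y z, E (kp y z) h ↔ (E y t ∧ RecRel G p y z) ∨ y = m ∧ z = G p m A :=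
    fun y z => by rw [hh, mem_cup, mem_up, or_self_iff, kp_inj, hh0']
  refine hn ⟨G p m A, h, ?_, (mem_h _ _).2 (.inr ⟨rfl, rfl⟩)⟩
  intro y z hyz
  rcases (mem_h y z).1 hyz with ⟨hy, h', a, e⟩ | ⟨rfl, rfl⟩
  · obtain ⟨A', b1, b2, rfl⟩ := a _ _ e
    have hym := (h2 y hy).2
    have hne : ∀ x, E x y → x ≠ m := by
      rintro _ hx rfl
      obtain ⟨z, hz⟩ := b2 _ hx
      exact hn ⟨z, h', a, hz⟩
    refine ⟨A', fun z => ?_, fun x hx => ?_, rfl⟩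
    · rw [b1]
      refine exists_congr fun x => and_congr_right fun hx => ?_
      rw [mem_h]
      simp only [hne x hx, false_and, or_false, hym x hx, true_and]
      refine ⟨fun h => ⟨h', a, h⟩, fun h => ?_⟩
      obtain ⟨z', hz'⟩ := b2 x hx
      rwa [uq x (h2 x (hym x hx)).1 z z' h ⟨h', a, hz'⟩]
    · obtain ⟨z', hz'⟩ := b2 x hx
      exact ⟨z', (mem_h _ _).2 (.inl ⟨hym x hx, h', a, hz'⟩)⟩
  · have hne : ∀ x, E x y → x ≠ y := by
      rintro _ hx rfl
      exact mem_irrefl hx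
    refine ⟨A, fun z => ?_, fun x hx => ?_, rfl⟩
    · rw [hA]
      refine exists_congr fun x => and_congr_right fun hx => ?_
      rw [mem_h]
      simp [hne x hx, hm2 x hx]
    · obtain ⟨z', hz'⟩ := ih x hx
      exact ⟨z', (mem_h _ _).2 (.inl ⟨hm2 x hx, hz'⟩)⟩

theorem recf_spec
    (hT : ∀ m, T m → ∃ t, E m t ∧ ∀ y, E y t → T y ∧ ∀ z, E z y → E z t)
    (hG : Tm 𝓑 fun s => G (s 0) (s 1) (s 2)) (p m : α) (hm : T m) :
    recf G p m = G p m (coll fun z => ∃ y, E y m ∧ z = recf G p y) ∧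
      IsSet fun z => ∃ y, E y m ∧ z = recf G p y := by
  have key : ∀ m, T m → ∀ d, RecRel G p m d ↔ d = recf G p m := by
    intro m hm d
    obtain ⟨d', hd'⟩ := exists_recRel hT hG p m hm
    have : recf G p m = d' := the_eq hd' fun b hb => recRel_unique hT hG p m hm b d' hb hd'
    rw [this]
    exact ⟨fun h => recRel_unique hT hG p m hm d d' h hd', fun h => h ▸ hd'⟩
  obtain ⟨t, h1, h2⟩ := hT m hm
  obtain ⟨h, a, e⟩ := (key m hm _).2 rfl
  obtain ⟨A, b1, b2, b3⟩ := a _ _ e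
  have hA : ∀ z, E z A ↔ ∃ y, E y m ∧ z = recf G p y := fun z => by
    rw [b1]
    refine exists_congr fun y => and_congr_right fun hy => ?_
    have hTy := (h2 y ((h2 m h1).2 y hy)).1
    refine ⟨fun hz => (key y hTy z).1 ⟨h, a, hz⟩, fun hz => ?_⟩
    obtain ⟨z', hz'⟩ := b2 y hy
    rwa [hz, ← (key y hTy z').1 ⟨h, a, hz'⟩]
  refine ⟨?_, A, hA⟩
  rw [coll_eq hA]
  exact b3

end Recursion

end SOST

namespace SOST

set_option linter.unusedSectionVars false

open SM (E)

section Ordinals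

variable {α : Type} [SM α] {𝓑 : Set (Set α)} [ZF0 α] [ZB α ∅]

theorem od_closure (m : α) (hm : Od m) :
    ∃ t, E m t ∧ ∀ y, E y t → Od y ∧ ∀ z, E z y → E z t :=
  ⟨suc m, mem_suc.2 (.inr rfl), fun _ hy => ⟨hm.suc.mem hy, fun _ hz => hm.suc.trans hy hz⟩⟩

theorem Od.of_mem {x : α} (h : ∀ y, E y x → ∀ z, E z y → E z x) (h' : ∀ y, E y x → Od y) : Od x :=
  ⟨h, fun y hy => (h' y hy).1⟩

theorem exists_limit : ∃ w : α, Od w ∧ E emp w ∧ ∀ y, E y w → E (suc y) w := by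
  obtain ⟨I, ⟨e, he, he'⟩, hI⟩ := ZF0.inf (α := α)
  obtain rfl : e = emp := sext fun z => by simp [he', mem_emp]
  have hI' : ∀ x, E x I → E (suc x) I := fun x hx => by
    obtain ⟨s, h1, h2⟩ := hI x hx
    rwa [show suc x = s from sext fun z => by rw [h2, mem_suc]]
  obtain ⟨x, hx, hxI⟩ : ∃ x, Od x ∧ ¬ E x I := by
    by_contra! h
    exact not_all_od I h
  obtain ⟨w, hw, h1, h2⟩ := od_min (𝓑 := ∅) (P := fun x => ¬ E x I) inferInstance hx hxI
  simp only [not_not] at h2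
  refine ⟨w, hw, ?_, fun y hy => ?_⟩
  · rcases Od.emp.trich hw with h | rfl | h
    · exact h
    · exact (h1 he).elim
    · exact (mem_emp h).elim
  · have := hI' y (h2 y hy)
    rcases (hw.mem hy).suc.trich hw with h | rfl | h
    · exact h
    · exact (h1 this).elim
    · exact (mem_irrefl (hw.suc_sub hy w h)).elim

theorem set_closure (x : α) (_ : True) :
    ∃ t, E x t ∧ ∀ y, E y t → True ∧ ∀ z, E z y → E z t := by
  obtain ⟨w, hw, h0, hs⟩ := exists_limit (α := α)
  set F : α → α := recf (fun x _ A => cup (up x x) (un (un A))) x with hF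
  have spec : ∀ m, Od m → ∀ z, E z (F m) ↔ z = x ∨ ∃ k, E k m ∧ E z (un (F k)) := by
    intro m hm z
    obtain ⟨e, h⟩ := recf_spec (𝓑 := ∅) od_closure
      (G := fun x _ A => cup (up x x) (un (un A))) inferInstance x m hm
    rw [← hF] at *
    rw [e, mem_cup, mem_up, or_self_iff]
    simp only [mem_un, mem_coll h]
    grind
  refine ⟨F w, (spec w hw x).2 (.inl rfl), fun y hy => ⟨trivial, fun z hz => ?_⟩⟩
  rcases (spec w hw y).1 hy with rfl | ⟨k, hk, hy⟩
  · exact (spec w hw z).2 (.inr ⟨emp, h0, mem_un.2 ⟨y, (spec emp Od.emp y).2 (.inl rfl), hz⟩⟩)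
  · exact (spec w hw z).2 (.inr ⟨suc k, hs k hk, mem_un.2 ⟨y, (spec _ (hw.mem hk).suc y).2
      (.inr ⟨k, mem_suc.2 (.inr rfl), hy⟩), hz⟩⟩)

/-! ### Ordinal addition -/

/-- The ordinal sum. -/
noncomputable def add (g m : α) : α := recf (fun g _ A => cup g A) g m

instance Tm.add {t u : (ℕ → α) → α} [ht : Tm 𝓑 t] [hu : Tm 𝓑 u] :
    Tm 𝓑 fun s => add (t s) (u s) := by
  unfold SOST.add
  infer_instance

theorem mem_add {g m z : α} (hm : Od m) : E z (add g m) ↔ E z g ∨ ∃ y, E y m ∧ z = add g y := by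
  obtain ⟨e, h⟩ := recf_spec (𝓑 := ∅) od_closure (G := fun g _ A => cup g A) inferInstance g m hm
  conv_lhs => rw [add, e, mem_cup, mem_coll h]
  rfl

theorem add_lt_add {g m y : α} (hm : Od m) (hy : E y m) : E (add g y) (add g m) :=
  (mem_add hm).2 (.inr ⟨y, hy, rfl⟩)

theorem sub_add {g m : α} (hm : Od m) : Sub g (add g m) := fun _ hz => (mem_add hm).2 (.inl hz)

theorem Od.add {g m : α} (hg : Od g) (hm : Od m) : Od (add g m) := by
  refine od_ind ∅ (P := fun m => Od (SOST.add g m)) inferInstance ?_ m hm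
  intro m hm ih
  refine .of_mem (fun y hy z hz => ?_) fun y hy => ?_
  · rw [mem_add hm] at *
    rcases hy with hy | ⟨x, hx, rfl⟩
    · exact .inl (hg.trans hy hz)
    · rcases (mem_add (hm.mem hx)).1 hz with hz | ⟨x', hx', rfl⟩
      · exact .inl hz
      · exact .inr ⟨x', hm.trans hx hx', rfl⟩
  · rcases (mem_add hm).1 hy with hy | ⟨x, hx, rfl⟩
    · exact hg.mem hy
    · exact ih x hx

theorem add_inj {g m n : α} (hm : Od m) (hn : Od n) (h : add g m = add g n) : m = n := by
  rcases hm.trich hn with h' | h' | h'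
  · have := add_lt_add (g := g) hn h'
    exact (mem_irrefl (h ▸ this)).elim
  · exact h'
  · have := add_lt_add (g := g) hm h'
    exact (mem_irrefl (h ▸ this)).elim

theorem add_emp {g : α} : add g emp = g :=
  sext fun z => by simp [mem_add Od.emp, mem_emp]

theorem exists_nonsucc_ge {g : α} (hg : Od g) : ∃ l, Od l ∧ Sub g l ∧ ∀ z, l ≠ suc z := by
  obtain ⟨w, hw, h0, hs⟩ := exists_limit (α := α)
  refine ⟨add g w, hg.add hw, sub_add hw, fun z e => ?_⟩
  have hz : E z (add g w) := e ▸ mem_suc.2 (.inr rfl)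
  rcases (mem_add hw).1 hz with hz | ⟨y, hy, rfl⟩
  · have h1 : E g (add g w) := by simpa only [add_emp] using add_lt_add (g := g) hw h0
    rcases mem_suc.1 (e ▸ h1) with h | rfl
    · exact mem_asymm h hz
    · exact mem_irrefl hz
  · have h1 : E (add g (suc y)) (add g w) := add_lt_add hw (hs y hy)
    have h2 : E (add g y) (add g (suc y)) :=
      add_lt_add (hw.mem hy).suc (mem_suc.2 (.inr rfl))
    rcases mem_suc.1 (e ▸ h1) with h | h
    · exact mem_asymm h h2
    · exact mem_irrefl (h ▸ h2)

end Ordinals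

end SOST

namespace SOST

set_option linter.unusedSectionVars false

open SM (E)

/-! ### Conditions -/

section Conditions

variable {α : Type} [SM α] {𝓑 : Set (Set α)} [ZF0 α]

/-- The numeral one. -/
noncomputable def one : α := suc emp

instance Tm.one : Tm 𝓑 fun _ => (one : α) := Tm.const _

theorem emp_ne_one : (emp : α) ≠ one := fun h => by
  have : E (emp : α) one := mem_suc.2 (.inr rfl)
  rw [← h] at this
  exact mem_emp this

/-- `p` is a binary sequence of ordinal length. -/
def Cd (p : α) : Prop :=
  ∃ g, Od g ∧ (∀ z, E z p → ∃ x v, E x g ∧ (v = emp ∨ v = one) ∧ z = kp x v) ∧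
    (∀ x, E x g → ∃ v, E (kp x v) p) ∧ ∀ x v v', E (kp x v) p → E (kp x v') p → v = v'

/-- The length of a binary sequence. -/
noncomputable def len (p : α) : α := coll fun x => ∃ v, E (kp x v) p

/-- The binary sequence `p` takes the value one at `x`. -/
def on (p x : α) : Prop := E (kp x one) p

/-- The binary sequence of length `g` with value one where `P` holds. -/
noncomputable def cond (g : α) (P : α → Prop) : α :=
  coll fun z => ∃ x, E x g ∧ (P x ∧ z = kp x one ∨ ¬ P x ∧ z = kp x emp)

variable {t u : (ℕ → α) → α}

instance Dfb.cd [ht : Tm 𝓑 t] : Dfb 𝓑 fun s => Cd (t s) :=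
  .sub1 (by unfold Cd; infer_instance) ht

instance Tm.len [ht : Tm 𝓑 t] : Tm 𝓑 fun s => len (t s) :=
  .sub1 (by unfold SOST.len; infer_instance) ht

instance Dfb.on [ht : Tm 𝓑 t] [hu : Tm 𝓑 u] : Dfb 𝓑 fun s => on (t s) (u s) :=
  .sub2 (by unfold SOST.on; infer_instance) ht hu

theorem Cd.spec {p : α} (h : Cd p) : Od (len p) ∧ ∀ z, E z p ↔
    ∃ x, E x (len p) ∧ (on p x ∧ z = kp x one ∨ ¬ on p x ∧ z = kp x emp) := by
  obtain ⟨g, hg, h1, h2, h3⟩ := h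
  have hl : len p = g := coll_eq fun x => by
    refine ⟨h2 x, ?_⟩
    rintro ⟨v, hv⟩
    obtain ⟨x', v', hx', -, e⟩ := h1 _ hv
    rwa [(kp_inj.1 e).1]
  rw [hl]
  refine ⟨hg, fun z => ⟨fun hz => ?_, ?_⟩⟩
  · obtain ⟨x, v, hx, rfl | rfl, rfl⟩ := h1 z hz
    · exact ⟨x, hx, .inr ⟨fun h => emp_ne_one (h3 x _ _ hz h), rfl⟩⟩
    · exact ⟨x, hx, .inl ⟨hz, rfl⟩⟩
  · rintro ⟨x, hx, ⟨h, rfl⟩ | ⟨h, rfl⟩⟩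
    · exact h
    · obtain ⟨v, hv⟩ := h2 x hx
      obtain ⟨x', v', hx', rfl | rfl, e⟩ := h1 _ hv <;> obtain ⟨rfl, rfl⟩ := kp_inj.1 e
      · exact hv
      · exact (h hv).elim

theorem Cd.od {p : α} (h : Cd p) : Od (SOST.len p) := h.spec.1

theorem Cd.mem_pair {p x v : α} (h : Cd p) :
    E (kp x v) p ↔ E x (SOST.len p) ∧ (on p x ∧ v = one ∨ ¬ on p x ∧ v = emp) := by
  rw [h.spec.2]
  simp only [kp_inj]
  grind

theorem Cd.on_lt {p x : α} (h : Cd p) (hx : SOST.on p x) : E x (SOST.len p) :=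
  ((h.mem_pair (v := one)).1 hx).1

theorem Cd.sub_iff {p q : α} (hp : Cd p) (hq : Cd q) : Sub p q ↔
    Sub (SOST.len p) (SOST.len q) ∧ ∀ x, E x (SOST.len p) → (SOST.on p x ↔ SOST.on q x) := by
  refine ⟨fun h => ?_, fun h z hz => ?_⟩
  · have key : ∀ x, E x (SOST.len p) → E x (SOST.len q) ∧ (SOST.on p x ↔ SOST.on q x) := by
      intro x hx
      by_cases ho : SOST.on p x
      · exact ⟨hq.on_lt (h _ ho), by simp only [ho, true_iff]; exact h _ ho⟩
      · have : E (kp x emp) p := hp.mem_pair.2 ⟨hx, .inr ⟨ho, rfl⟩⟩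
        have := hq.mem_pair.1 (h _ this)
        exact ⟨this.1, by simpa [ho, emp_ne_one] using this.2⟩
    exact ⟨fun x hx => (key x hx).1, fun x hx => (key x hx).2⟩
  · obtain ⟨x, hx, hz⟩ := (hp.spec.2 z).1 hz
    rw [hq.spec.2]
    exact ⟨x, h.1 x hx, by rwa [← h.2 x hx]⟩

theorem Sub.refl (x : α) : Sub x x := fun _ h => h

theorem Sub.trans {x y z : α} (h : Sub x y) (h' : Sub y z) : Sub x z := fun w hw => h' w (h w hw)

theorem Cd.sub_len {p q : α} (hp : Cd p) (hq : Cd q) (h : Sub p q) :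
    Sub (SOST.len p) (SOST.len q) := ((hp.sub_iff hq).1 h).1

theorem Cd.sub_on {p q x : α} (hp : Cd p) (hq : Cd q) (h : Sub p q) (hx : E x (SOST.len p)) :
    SOST.on p x ↔ SOST.on q x := ((hp.sub_iff hq).1 h).2 x hx

theorem cond_spec (𝓑 : Set (Set α)) [ZB α 𝓑] {g : α} (hg : Od g) {P : α → Prop}
    (hP : Dfb 𝓑 fun s => P (s 0)) :
    Cd (cond g P) ∧ len (cond g P) = g ∧ ∀ x, E x g → (on (cond g P) x ↔ P x) := by
  have d : Dfb 𝓑 fun s => P (s 0) ∧ s 1 = kp (s 0) one ∨ ¬ P (s 0) ∧ s 1 = kp (s 0) emp :=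
    inferInstance
  have hs := isSet_repl (𝓑 := 𝓑) (a := g)
    (R := fun x z => P x ∧ z = kp x one ∨ ¬ P x ∧ z = kp x emp) d (by grind)
  have hm : ∀ x v, E (kp x v) (cond g P) ↔ E x g ∧ (P x ∧ v = one ∨ ¬ P x ∧ v = emp) :=
    fun x v => by
      rw [cond, mem_coll hs]
      simp only [kp_inj]
      grind
  refine ⟨⟨g, hg, fun z hz => ?_, fun x hx => ?_, fun x v v' h h' => ?_⟩, ?_, fun x hx => ?_⟩
  · obtain ⟨x, hx, hz⟩ := (mem_coll hs).1 hz
    grind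
  · simp only [hm]
    by_cases h : P x <;> simp [h, hx]
  · rw [hm] at h h'
    grind
  · refine coll_eq fun x => ?_
    simp only [hm]
    by_cases h : P x <;> simp [h]
  · rw [on, hm]
    simp [hx, emp_ne_one.symm]

/-- Suprema of sets of ordinals. -/
theorem exists_sup (𝓑 : Set (Set α)) [ZB α 𝓑] {f : α → α} (hf : Tm 𝓑 fun s => f (s 0)) {A : α}
    (h : ∀ x, E x A → Od (f x)) : ∃ g, Od g ∧ ∀ x, E x g ↔ ∃ y, E y A ∧ E x (f y) := by
  have hi := isSet_image hf A
  refine ⟨un (coll fun z => ∃ y, E y A ∧ z = f y), Od.un fun x hx => ?_, fun x => ?_⟩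
  · obtain ⟨y, hy, rfl⟩ := (mem_coll hi).1 hx
    exact h y hy
  · simp only [mem_un, mem_coll hi]
    grind

/-- The union of a set of pairwise comparable conditions. -/
theorem cd_un [ZB α ∅] {A : α} (h1 : ∀ p, E p A → Cd p)
    (h2 : ∀ p q, E p A → E q A → Sub p q ∨ Sub q p) :
    Cd (un A) ∧ ∀ x, E x (len (un A)) ↔ ∃ p, E p A ∧ E x (len p) := by
  obtain ⟨g, hg, hg'⟩ := exists_sup ∅ (f := len) inferInstance fun p hp => (h1 p hp).od
  have hl : ∀ x, (∃ v, E (kp x v) (un A)) ↔ E x g := fun x => by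
    rw [hg']
    constructor
    · rintro ⟨v, hv⟩
      obtain ⟨p, hp, hv⟩ := mem_un.1 hv
      exact ⟨p, hp, ((h1 p hp).mem_pair.1 hv).1⟩
    · rintro ⟨p, hp, hx⟩
      by_cases ho : on p x
      · exact ⟨_, mem_un.2 ⟨p, hp, (h1 p hp).mem_pair.2 ⟨hx, .inl ⟨ho, rfl⟩⟩⟩⟩
      · exact ⟨_, mem_un.2 ⟨p, hp, (h1 p hp).mem_pair.2 ⟨hx, .inr ⟨ho, rfl⟩⟩⟩⟩
  refine ⟨⟨g, hg, fun z hz => ?_, fun x hx => (hl x).2 hx, fun x v v' h h' => ?_⟩, fun x => ?_⟩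
  · obtain ⟨p, hp, hz⟩ := mem_un.1 hz
    obtain ⟨x, hx, hz⟩ := ((h1 p hp).spec.2 z).1 hz
    refine ⟨x, ?_⟩
    have : E x g := (hg' x).2 ⟨p, hp, hx⟩
    grind
  · obtain ⟨p, hp, hz⟩ := mem_un.1 h
    obtain ⟨p', hp', hz'⟩ := mem_un.1 h'
    have key : ∀ q, Cd q → E (kp x v) q → E (kp x v') q → v = v' := fun q hq a b => by
      rw [hq.mem_pair] at a b
      grind
    rcases h2 p p' hp hp' with h | h
    · exact key _ (h1 p' hp') (h _ hz) hz'
    · exact key _ (h1 p hp) hz (h _ hz')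
  · rw [← hg', len, coll_eq fun x => (hl x).symm]

theorem isSet_cd [ZB α ∅] (l : α) : IsSet fun p => Cd p ∧ Sub (len p) l := by
  have d1 : Tm ∅ fun s => kp (s 0) (one : α) := inferInstance
  have d2 : Tm ∅ fun s => kp (s 0) (emp : α) := inferInstance
  have h1 := isSet_image (f := fun x => kp x one) d1 l
  have h2 := isSet_image (f := fun x => kp x emp) d2 l
  let a := cup (coll fun y => ∃ x, E x l ∧ y = kp x one) (coll fun y => ∃ x, E x l ∧ y = kp x emp)
  refine IsSet.sub (𝓑 := ∅) (isSet_mem (pow a)) (P := fun p => Cd p ∧ Sub (len p) l) inferInstance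
    fun p hp => mem_pow.2 fun z hz => ?_
  obtain ⟨x, hx, hz⟩ := (hp.1.spec.2 z).1 hz
  have := hp.2 x hx
  simp only [a, mem_cup, mem_coll h1, mem_coll h2]
  grind

end Conditions

end SOST

namespace SOST

set_option linter.unusedSectionVars false

open SM (E)

/-! ### Choice -/

/-- The Axiom of Choice. -/
class AC (α : Type) [SM α] : Prop where
  ac : ∀ x : α, (∀ y, E y x → ∃ z, E z y) →
    (∀ y y', E y x → E y' x → (∃ z, E z y ∧ E z y') → y = y') →
    ∃ c, ∀ y, E y x → ∃ z, E z y ∧ E z c ∧ ∀ w, E w y → E w c → w = z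

section Choice

variable {α : Type} [SM α] [ZF0 α] [ZB α ∅] [AC α]

theorem exists_choice (S : α) : ∃ ch : α → α, Tm ∅ (fun s => ch (s 0)) ∧
    ∀ y, Sub y S → (∃ z, E z y) → E (ch y) y := by
  let pr : α → α := fun y => coll fun z => ∃ v, E v y ∧ z = kp y v
  have hpr : ∀ {t : (ℕ → α) → α} [Tm ∅ t], Tm ∅ fun s => pr (t s) := fun {t} ht =>
    .sub1 (f := pr) inferInstance ht
  have mpr : ∀ y z, E z (pr y) ↔ ∃ v, E v y ∧ z = kp y v := fun y z =>
    mem_coll (isSet_image (𝓑 := ∅) (f := fun v => kp y v) inferInstance y)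
  obtain ⟨N, hN⟩ := IsSet.sub (𝓑 := ∅) (isSet_mem (pow S))
    (P := fun y => Sub y S ∧ ∃ z, E z y) inferInstance fun y hy => mem_pow.2 hy.1
  have hF := isSet_image (𝓑 := ∅) (f := pr) hpr N
  obtain ⟨c, hc⟩ := AC.ac (coll fun z => ∃ y, E y N ∧ z = pr y)
    (fun z hz => by
      obtain ⟨y, hy, rfl⟩ := (mem_coll hF).1 hz
      obtain ⟨v, hv⟩ := ((hN y).1 hy).2
      exact ⟨_, (mpr _ _).2 ⟨v, hv, rfl⟩⟩)
    (fun z z' hz hz' h => by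
      obtain ⟨y, hy, rfl⟩ := (mem_coll hF).1 hz
      obtain ⟨y', hy', rfl⟩ := (mem_coll hF).1 hz'
      obtain ⟨w, hw, hw'⟩ := h
      obtain ⟨v, -, rfl⟩ := (mpr _ _).1 hw
      obtain ⟨v', -, h⟩ := (mpr _ _).1 hw'
      rw [(kp_inj.1 h).1])
  refine ⟨fun y => the fun v => E v y ∧ E (kp y v) c, inferInstance, fun y hy hne => ?_⟩
  obtain ⟨z, hz, hzc, hu⟩ := hc (pr y) ((mem_coll hF).2 ⟨y, (hN y).2 ⟨hy, hne⟩, rfl⟩)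
  obtain ⟨v, hv, rfl⟩ := (mpr _ _).1 hz
  change E (the fun v => E v y ∧ E (kp y v) c) y
  rwa [the_eq (P := fun v => E v y ∧ E (kp y v) c) ⟨hv, hzc⟩ fun b hb =>
    (kp_inj.1 (hu _ ((mpr _ _).2 ⟨b, hb.1, rfl⟩) hb.2)).2]

theorem exists_rec {G : α → α → α} (hG : Tm ∅ fun s => G (s 0) (s 1)) :
    ∃ F : α → α, Tm ∅ (fun s => F (s 0)) ∧
      ∀ i, Od i → ∃ A, (∀ z, E z A ↔ ∃ j, E j i ∧ z = F j) ∧ F i = G i A := by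
  have hG' : Tm ∅ fun s => G (s 1) (s 2) := .sub2 hG (.var 1) (.var 2)
  refine ⟨recf (fun _ i A => G i A) emp, inferInstance, fun i hi => ?_⟩
  obtain ⟨e, hs⟩ := recf_spec (𝓑 := ∅) od_closure (G := fun _ i A => G i A) hG' emp i hi
  exact ⟨_, fun z => mem_coll hs, e⟩

/-- Every set is well-orderable. -/
theorem exists_idx (S : α) : ∃ idx : α → α, Tm ∅ (fun s => idx (s 0)) ∧
    (∀ x, E x S → Od (idx x)) ∧ ∀ x y, E x S → E y S → idx x = idx y → x = y := by
  obtain ⟨ch, hch, h1⟩ := exists_choice S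
  have : ∀ {t : (ℕ → α) → α} [Tm ∅ t], Tm ∅ fun s => ch (t s) := fun {t} ht => .sub1 hch ht
  obtain ⟨F, hF, hFe⟩ := exists_rec (G := fun _ A => ch (coll fun z => E z S ∧ ¬ E z A))
    inferInstance
  have hF' : ∀ {t : (ℕ → α) → α} [Tm ∅ t], Tm ∅ fun s => F (t s) := fun {t} ht => .sub1 hF ht
  have h2 : ∀ i, Od i → (∃ z, E z S ∧ ∀ j, E j i → z ≠ F j) →
      E (F i) S ∧ ∀ j, E j i → F i ≠ F j := fun i hi ⟨z, hz, hz'⟩ => by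
    obtain ⟨A, hA, e⟩ := hFe i hi
    have hm := IsSet.sub (𝓑 := ∅) (isSet_mem S) (P := fun z => E z S ∧ ¬ E z A) inferInstance
      fun _ h => h.1
    have := h1 (coll fun z => E z S ∧ ¬ E z A) (fun z h => ((mem_coll hm).1 h).1)
      ⟨z, (mem_coll hm).2 ⟨hz, fun h => by
        obtain ⟨y, hy, e⟩ := (hA z).1 h
        exact hz' y hy e⟩⟩
    rw [mem_coll hm, ← e] at this
    exact ⟨this.1, fun j hj h => this.2 ((hA _).2 ⟨j, hj, h⟩)⟩
  have h3 : ∀ x, E x S → ∃ i, Od i ∧ x = F i := fun x hx => by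
    by_contra! hn
    have h4 := fun i hi => h2 i hi ⟨x, hx, fun j hj => hn j (hi.mem hj)⟩
    obtain ⟨b, hb⟩ := isSet_repl (𝓑 := ∅) (R := fun z i => Od i ∧ z = F i) inferInstance (a := S)
      fun z i j _ hi hj => by
        obtain ⟨hi, rfl⟩ := hi
        obtain ⟨hj, h⟩ := hj
        rcases hi.trich hj with h' | h' | h'
        · exact ((h4 j hj).2 i h' h.symm).elim
        · exact h'
        · exact ((h4 i hi).2 j h' h).elim
    exact not_all_od b fun i hi => (hb i).2 ⟨F i, (h4 i hi).1, hi, rfl⟩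
  have h4 : ∀ x, E x S → Od (lst fun i => x = F i) ∧ x = F (lst fun i => x = F i) := fun x hx => by
    obtain ⟨i, hi, h⟩ := h3 x hx
    have := lst_spec (𝓑 := ∅) (P := fun i => x = F i) inferInstance hi h
    exact ⟨this.1, this.2.1⟩
  exact ⟨fun x => lst fun i => x = F i, inferInstance, fun x hx => (h4 x hx).1,
    fun x y hx hy h => (h4 x hx).2.trans ((congrArg F h).trans (h4 y hy).2.symm)⟩

theorem exists_od_fun {R : α → α → Prop} (hR : Dfb ∅ fun s => R (s 0) (s 1)) :
    ∃ f : α → α, Tm ∅ (fun s => f (s 0)) ∧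
      ∀ x, (∃ e, Od e ∧ R x e) → Od (f x) ∧ R x (f x) := by
  have : ∀ i j, Dfb ∅ fun s => R (s i) (s j) := fun i j => .sub2 hR (.var i) (.var j)
  refine ⟨fun x => lst fun e => R x e, inferInstance, fun x ⟨e, he, h⟩ => ?_⟩
  have := lst_spec (𝓑 := ∅) (P := fun e => R x e) (.sub2 hR (.const x) (.var 0)) he h
  exact ⟨this.1, this.2.1⟩

variable (a : α) {D : α → α → Prop}

/-- Bounds for the lengths of the extensions of conditions of bounded length. -/
theorem exists_len_bound
    (hD : Dfb ∅ fun s => D (s 0) (s 1))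
    (dense : ∀ x, E x a → ∀ p, Cd p → ∃ q, Cd q ∧ Sub p q ∧ D x q) :
    ∃ g : α → α, Tm ∅ (fun s => g (s 0)) ∧ ∀ d, Od d →
    Od (g d) ∧ Sub d (g d) ∧ ∀ q, Cd q → Sub (len q) d → ∀ x, E x a →
      ∃ r, Cd r ∧ Sub q r ∧ D x r ∧ Sub (len r) (g d) := by
  have h0 : ∀ {t u : (ℕ → α) → α} [Tm ∅ t] [Tm ∅ u], Dfb ∅ fun s => D (t s) (u s) :=
    fun {t u} ht hu => .sub2 hD ht hu
  obtain ⟨L, hL, L_spec⟩ := exists_od_fun (R := fun q e => ∀ x, E x a →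
    ∃ r, Cd r ∧ Sub q r ∧ D x r ∧ Sub (len r) e) inferInstance
  have L_spec : ∀ q, Cd q → _ := fun q hq => L_spec q (by
    obtain ⟨l, hl, l_spec⟩ := exists_od_fun (R := fun x e => ∃ r, Cd r ∧ Sub q r ∧ D x r ∧ len r = e)
      inferInstance
    have l_spec : ∀ x, E x a → _ := fun x hx => l_spec x (by
      obtain ⟨r, hr, h1, h2⟩ := dense x hx q hq
      exact ⟨_, hr.od, r, hr, h1, h2, rfl⟩)
    obtain ⟨g, hg, h⟩ := exists_sup ∅ hl fun x hx => (l_spec x hx).1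
    refine ⟨g, hg, fun x hx => ?_⟩
    obtain ⟨-, r, h1, h2, h3, h4⟩ := l_spec x hx
    exact ⟨r, h1, h2, h3, fun z hz => (h z).2 ⟨x, hx, h4 ▸ hz⟩⟩)
  obtain ⟨g, hg, g_spec⟩ := exists_od_fun (R := fun d e => Sub d e ∧ ∀ q, Cd q → Sub (len q) d →
    ∀ x, E x a → ∃ r, Cd r ∧ Sub q r ∧ D x r ∧ Sub (len r) e) inferInstance
  refine ⟨g, hg, fun d hd => g_spec d ?_⟩
  have hs := isSet_cd d
  obtain ⟨g, hg, h⟩ := exists_sup ∅ hL (A := coll fun p => Cd p ∧ Sub (len p) d)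
    fun q hq => (L_spec q ((mem_coll hs).1 hq).1).1
  refine ⟨cup d g, hd.cup hg, fun z hz => mem_cup.2 (.inl hz), fun q hq hqd x hx => ?_⟩
  obtain ⟨r, h1, h2, h3, h4⟩ := (L_spec q hq).2 x hx
  exact ⟨r, h1, h2, h3, fun z hz => mem_cup.2 (.inr ((h z).2
    ⟨q, (mem_coll hs).2 ⟨hq, hqd⟩, h4 z hz⟩))⟩

/-- The forcing is distributive: set-many open dense classes meet below any condition. -/
theorem distrib
    (hD : Dfb ∅ fun s => D (s 0) (s 1))
    (dense : ∀ x, E x a → ∀ p, Cd p → ∃ q, Cd q ∧ Sub p q ∧ D x q)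
    (open_ : ∀ x, E x a → ∀ p q, Cd p → Cd q → Sub p q → D x p → D x q)
    {p : α} (hp : Cd p) : ∃ q, Cd q ∧ Sub p q ∧ ∀ x, E x a → D x q := by
  have h0 : ∀ {t u : (ℕ → α) → α} [Tm ∅ t] [Tm ∅ u], Dfb ∅ fun s => D (t s) (u s) :=
    fun {t u} ht hu => .sub2 hD ht hu
  obtain ⟨g, hg, g_spec⟩ := exists_len_bound a hD dense
  have hg' : ∀ {t : (ℕ → α) → α} [Tm ∅ t], Tm ∅ fun s => g (t s) := fun {t} ht => .sub1 hg ht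
  obtain ⟨Γ, hΓ, hΓe⟩ := exists_rec (G := fun _ A => g (cup (len p) (un A))) inferInstance
  have hΓ' : ∀ {t : (ℕ → α) → α} [Tm ∅ t], Tm ∅ fun s => Γ (t s) := fun {t} ht => .sub1 hΓ ht
  have Γ_spec : ∀ i, Od i → Od (Γ i) ∧ ∃ d, Od d ∧ (∀ z, E z d ↔ E z (len p) ∨
      ∃ j, E j i ∧ E z (Γ j)) ∧ Γ i = g d := by
    refine fun i hi => tind (𝓑 := ∅) od_closure (P := fun i => Od (Γ i) ∧ ∃ d, Od d ∧
      (∀ z, E z d ↔ E z (len p) ∨ ∃ j, E j i ∧ E z (Γ j)) ∧ Γ i = g d) inferInstance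
      (fun i hi _ ih => ?_) i hi
    obtain ⟨A, hA, e⟩ := hΓe i hi
    have hO : Od (cup (len p) (un A)) := hp.od.cup (Od.un fun x hx => by
      obtain ⟨y, hy, rfl⟩ := (hA x).1 hx
      exact (ih y hy).1)
    refine ⟨e ▸ (g_spec _ hO).1, _, hO, fun z => ?_, e⟩
    rw [mem_cup, mem_un]
    refine or_congr .rfl ⟨?_, ?_⟩
    · rintro ⟨_, hw, h⟩
      obtain ⟨j, hj, rfl⟩ := (hA _).1 hw
      exact ⟨j, hj, h⟩
    · rintro ⟨j, hj, h⟩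
      exact ⟨_, (hA _).2 ⟨j, hj, rfl⟩, h⟩
  obtain ⟨idx, hidx, idx_od, idx_inj⟩ := exists_idx a
  have hidx' : ∀ {t : (ℕ → α) → α} [Tm ∅ t], Tm ∅ fun s => idx (t s) := fun {t} ht => .sub1 hidx ht
  obtain ⟨k, hk, hka⟩ : ∃ k, Od k ∧ ∀ x, E x a → E (idx x) k := by
    obtain ⟨k, hk, h⟩ := exists_sup ∅ (f := fun x => suc (idx x)) inferInstance (A := a)
      fun x hx => (idx_od x hx).suc
    exact ⟨k, hk, fun x hx => (h _).2 ⟨x, hx, mem_suc.2 (.inr rfl)⟩⟩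
  obtain ⟨B, hB, B_spec⟩ := exists_sup ∅ hΓ (A := k) fun i hi => (Γ_spec i (hk.mem hi)).1
  have hS := isSet_cd B
  obtain ⟨jdx, hjdx, jdx_od, jdx_inj⟩ := exists_idx (coll fun p => Cd p ∧ Sub (len p) B)
  have hjdx' : ∀ {t : (ℕ → α) → α} [Tm ∅ t], Tm ∅ fun s => jdx (t s) := fun {t} ht => .sub1 hjdx ht
  obtain ⟨Q, hQ, Q_iff⟩ : ∃ Q : α → α → α → Prop, (Dfb ∅ fun s => Q (s 0) (s 1) (s 2)) ∧
      ∀ i A r, Q i A r ↔ Cd r ∧ Sub (cup p (un A)) r ∧ Sub (len r) (Γ i) ∧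
        ∀ x, E x a → idx x = i → D x r :=
    ⟨fun i A r => _, inferInstance, fun i A r => Iff.rfl⟩
  have hQ' : ∀ {t u v : (ℕ → α) → α} [Tm ∅ t] [Tm ∅ u] [Tm ∅ v],
      Dfb ∅ fun s => Q (t s) (u s) (v s) := fun {t u v} ht hu hv => .sub3 hQ ht hu hv
  obtain ⟨H, hH, H_spec⟩ : ∃ H : α → α → α, Tm ∅ (fun s => H (s 0) (s 1)) ∧
      ∀ i A, E i k → (∃ r, Q i A r) → Q i A (H i A) := by
    refine ⟨fun i A => the fun r => Q i A r ∧ jdx r = lst fun n => ∃ r, Q i A r ∧ jdx r = n,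
      inferInstance, fun i A hi ⟨r, hr⟩ => ?_⟩
    have hQS : ∀ r, Q i A r → E r (coll fun p => Cd p ∧ Sub (len p) B) := fun r hr =>
      have hr := (Q_iff i A r).1 hr
      (mem_coll hS).2 ⟨hr.1, fun z hz => (B_spec z).2 ⟨i, hi, hr.2.2.1 z hz⟩⟩
    have := (lst_spec (𝓑 := ∅) (P := fun n => ∃ r, Q i A r ∧ jdx r = n) inferInstance
      (jdx_od r (hQS r hr)) ⟨r, hr, rfl⟩).2.1
    obtain ⟨r', hr', h'⟩ := this
    dsimp only
    rwa [the_eq (P := fun r => Q i A r ∧ jdx r = lst fun n => ∃ r, Q i A r ∧ jdx r = n)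
      ⟨hr', h'⟩ fun b hb => jdx_inj _ _ (hQS _ hb.1) (hQS _ hr') (hb.2.trans h'.symm)]
  obtain ⟨F, hF, hFe⟩ := exists_rec hH
  have hF' : ∀ {t : (ℕ → α) → α} [Tm ∅ t], Tm ∅ fun s => F (t s) := fun {t} ht => .sub1 hF ht
  have F_cup : ∀ i, Od i → (∀ j, E j i → Cd (F j) ∧ Sub p (F j) ∧ Sub (len (F j)) (Γ j) ∧
      ∀ m, E m j → Sub (F m) (F j)) → ∀ A, (∀ z, E z A ↔ ∃ j, E j i ∧ z = F j) →
      Cd (cup p (un A)) ∧ ∀ x, E x (len (cup p (un A))) → E x (len p) ∨ ∃ j, E j i ∧ E x (Γ j) := by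
    intro i hi ih A hmA
    have e : cup p (un A) = un (cup (up p p) A) := sext fun z => by
      simp only [mem_cup, mem_un, mem_up, or_self, or_and_right, exists_or, exists_eq_left]
    have hm : ∀ z, E z (cup (up p p) A) ↔ z = p ∨ ∃ y, E y i ∧ z = F y := fun z => by
      rw [mem_cup, mem_up, hmA, or_self]
    rw [e]
    obtain ⟨h1, h2⟩ := cd_un (A := cup (up p p) A)
      (fun q hq => by
        rcases (hm q).1 hq with rfl | ⟨y, hy, rfl⟩
        · exact hp
        · exact (ih y hy).1)
      (fun q r hq hr => by
        rcases (hm q).1 hq with rfl | ⟨y, hy, rfl⟩ <;> rcases (hm r).1 hr with rfl | ⟨y', hy', rfl⟩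
        · exact .inl (.refl _)
        · exact .inl (ih y' hy').2.1
        · exact .inr (ih y hy).2.1
        · rcases (hi.mem hy).trich (hi.mem hy') with h | rfl | h
          · exact .inl ((ih y' hy').2.2.2 y h)
          · exact .inl (.refl _)
          · exact .inr ((ih y hy).2.2.2 y' h))
    refine ⟨h1, fun x hx => ?_⟩
    obtain ⟨q, hq, hx'⟩ := (h2 x).1 hx
    rcases (hm q).1 hq with rfl | ⟨y, hy, rfl⟩
    · exact .inl hx'
    · exact .inr ⟨y, hy, (ih y hy).2.2.1 x hx'⟩
  have F_spec : ∀ i, Od i → E i k → Cd (F i) ∧ Sub p (F i) ∧ Sub (len (F i)) (Γ i) ∧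
      (∀ m, E m i → Sub (F m) (F i)) ∧ ∀ x, E x a → idx x = i → D x (F i) := by
    intro i hi
    refine tind (𝓑 := ∅) od_closure (P := fun i => E i k → Cd (F i) ∧ Sub p (F i) ∧
      Sub (len (F i)) (Γ i) ∧ (∀ m, E m i → Sub (F m) (F i)) ∧ ∀ x, E x a → idx x = i → D x (F i))
      inferInstance (fun i hi _ ih hik => ?_) i hi
    obtain ⟨A, hmA, e⟩ := hFe i hi
    obtain ⟨h1, h2⟩ := F_cup i hi (fun j hj =>
      have := ih j hj (hk.trans hik hj)
      ⟨this.1, this.2.1, this.2.2.1, this.2.2.2.1⟩) A hmA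
    have hq : ∃ r, Q i A r := by
      obtain ⟨-, d, hd, hdz, hd'⟩ := Γ_spec i hi
      have hgd := (g_spec d hd).2
      have hsub : Sub (len (cup p (un A))) d := fun z hz => (hdz z).2 (h2 z hz)
      simp only [Q_iff]
      by_cases hx : ∃ x, E x a ∧ idx x = i
      · obtain ⟨x, hx, rfl⟩ := hx
        obtain ⟨r, h3, h4, h5, h6⟩ := hgd.2 _ h1 hsub x hx
        exact ⟨r, h3, h4, hd' ▸ h6, fun x' hx' e => by rwa [idx_inj _ _ hx' hx e]⟩
      · push Not at hx
        exact ⟨_, h1, .refl _, hd' ▸ hsub.trans hgd.1, fun x hxa h => (hx x hxa h).elim⟩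
    have := H_spec i A hik hq
    rw [← e, Q_iff] at this
    obtain ⟨h3, h4, h5, h6⟩ := this
    exact ⟨h3, fun z hz => h4 z (mem_cup.2 (.inl hz)), h5, fun m hm z hz =>
      h4 z (mem_cup.2 (.inr (mem_un.2 ⟨_, (hmA _).2 ⟨m, hm, rfl⟩, hz⟩))), h6⟩
  obtain ⟨A, hmA, -⟩ := hFe k hk
  obtain ⟨h1, -⟩ := F_cup k hk (fun j hj =>
      have := F_spec j (hk.mem hj) hj
      ⟨this.1, this.2.1, this.2.2.1, this.2.2.2.1⟩) A hmA
  refine ⟨_, h1, fun z hz => mem_cup.2 (.inl hz), fun x hx => ?_⟩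
  have := F_spec _ (hk.mem (hka x hx)) (hka x hx)
  exact open_ x hx _ _ this.1 h1 (fun z hz => mem_cup.2 (.inr (mem_un.2
    ⟨_, (hmA _).2 ⟨_, hka x hx, rfl⟩, hz⟩))) (this.2.2.2.2 x hx rfl)

end Choice

end SOST

namespace SOST

set_option linter.unusedSectionVars false

open SM (E)

section Finite

variable {α : Type} [SM α] {𝓑 : Set (Set α)} {P : (ℕ → α) → Prop}

theorem DefRel.exists_bound (h : DefRel 𝓑 P) :
    ∃ N, ∀ s t : ℕ → α, (∀ n < N, s n = t n) → (P s ↔ P t) := by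
  have hpush : ∀ {N : ℕ} {s t : ℕ → α} (x : α), (∀ n < N, s n = t n) →
      ∀ n < N, push x s n = push x t n := fun {N s t} x h n hn => by
    cases n with
    | zero => rfl
    | succ n => exact h n (by omega)
  induction h with
  | mem i j => exact ⟨max i j + 1, fun s t h => by
      dsimp only
      rw [h i (by omega), h j (by omega)]⟩
  | eq i j => exact ⟨max i j + 1, fun s t h => by
      dsimp only
      rw [h i (by omega), h j (by omega)]⟩
  | cls X hX i => exact ⟨i + 1, fun s t h => by
      dsimp only
      rw [h i (by omega)]⟩
  | fal => exact ⟨0, fun _ _ _ => .rfl⟩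
  | imp _ _ h1 h2 =>
    obtain ⟨N, hN⟩ := h1
    obtain ⟨K, hK⟩ := h2
    exact ⟨max N K, fun s t h => imp_congr
      (hN s t fun n hn => h n (by omega)) (hK s t fun n hn => h n (by omega))⟩
  | all _ h =>
    obtain ⟨N, hN⟩ := h
    exact ⟨N, fun s t h => forall_congr' fun x => hN _ _ (hpush x h)⟩
  | par _ a h =>
    obtain ⟨N, hN⟩ := h
    exact ⟨N, fun s t h => hN _ _ (hpush a h)⟩

/-- Fix all variables except the variable `0`. -/
theorem Dfb.fix (h : Dfb 𝓑 P) (a : ℕ → α) : Dfb 𝓑 fun s => P (push (s 0) a) := by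
  obtain ⟨N, hN⟩ := h.1.exists_bound
  have key : ∀ m, Dfb 𝓑 fun s => P fun k => if k ≠ 0 ∧ k < m then push (s 0) a k else s k := by
    intro m
    induction m with
    | zero => simpa using h
    | succ m ih =>
      cases m with
      | zero => exact h.congr fun s => by simp
      | succ m =>
        have h1 := ih.comp fun k => if k = m + 1 then 0 else k + 1
        have h2 := Dfb.sub (R := fun x s => P fun k => if k ≠ 0 ∧ k < m + 1 then push (s 0) a k
          else if k = m + 1 then x else s k) (h1.congr fun s => by
            refine iff_of_eq (congrArg P (funext fun k => ?_))
            cases k <;> simp [apply_ite s, push]) (.const (a m))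
        refine h2.congr fun s => iff_of_eq (congrArg P (funext fun k => ?_))
        rcases lt_trichotomy k (m + 1) with hk | rfl | hk
        · have : k < m + 1 + 1 := by omega
          simp only [hk, this, and_true, hk.ne, if_false]
        · simp
        · have h1 : ¬ k < m + 1 + 1 := by omega
          have h2 : ¬ k < m + 1 := by omega
          simp only [h1, h2, and_false, if_false, hk.ne']
  refine (key N).congr fun s => hN _ _ fun n hn => ?_
  cases n <;> simp [hn]

end Finite

/-! ### Forcing -/

section Forcing

variable {α : Type} [SM α] [ZF0 α] [ZB α ∅]

/-- The condition `p` is an initial segment of `C`. -/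
def Agr (C : Set α) (p : α) : Prop := ∀ x, E x (len p) → (x ∈ C ↔ on p x)

/-- `C` is a generic class of ordinals. -/
structure Gen (C : Set α) : Prop where
  od : ∀ x ∈ C, Od x
  ext : ∀ g, Od g → ∃ p, Cd p ∧ Agr C p ∧ Sub g (len p)
  dense : ∀ P : α → Prop, (Dfb ∅ fun s => P (s 0)) →
    (∀ p, Cd p → ∃ q, Cd q ∧ Sub p q ∧ P q) → ∃ p, Cd p ∧ Agr C p ∧ P p

variable {C : Set α}

theorem agr_comparable {p q : α} (hp : Cd p) (hq : Cd q) (h1 : Agr C p) (h2 : Agr C q) :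
    Sub p q ∨ Sub q p := by
  rcases hp.od.sub_total hq.od with h | h
  · exact .inl ((hp.sub_iff hq).2 ⟨h, fun x hx => (h1 x hx).symm.trans (h2 x (h x hx))⟩)
  · exact .inr ((hq.sub_iff hp).2 ⟨h, fun x hx => (h2 x hx).symm.trans (h1 x (h x hx))⟩)

theorem agr_upper {p q : α} (hp : Cd p) (hq : Cd q) (h1 : Agr C p) (h2 : Agr C q) :
    ∃ m, Cd m ∧ Agr C m ∧ Sub p m ∧ Sub q m := by
  rcases agr_comparable hp hq h1 h2 with h | h
  · exact ⟨q, hq, h2, h, .refl _⟩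
  · exact ⟨p, hp, h1, .refl _, h⟩

theorem Gen.decide (hC : Gen C) {P : α → Prop} (hP : Dfb ∅ fun s => P (s 0)) :
    ∃ p, Cd p ∧ Agr C p ∧ (P p ∨ ∀ q, Cd q → Sub p q → ¬ P q) := by
  have : ∀ i, Dfb ∅ fun s => P (s i) := fun i => .sub1 hP (.var i)
  refine hC.dense (fun p => P p ∨ ∀ q, Cd q → Sub p q → ¬ P q) inferInstance fun p hp => ?_
  by_cases h : ∃ q, Cd q ∧ Sub p q ∧ P q
  · obtain ⟨q, h1, h2, h3⟩ := h
    exact ⟨q, h1, h2, .inl h3⟩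
  · exact ⟨p, hp, .refl _, .inr fun q h1 h2 h3 => h ⟨q, h1, h2, h3⟩⟩

theorem Gen.dense_below (hC : Gen C) {P : α → Prop} (hP : Dfb ∅ fun s => P (s 0)) {p : α}
    (hp : Cd p) (ha : Agr C p) (h : ∀ q, Cd q → Sub p q → ∃ r, Cd r ∧ Sub q r ∧ P r) :
    ∃ q, Cd q ∧ Agr C q ∧ Sub p q ∧ P q := by
  obtain ⟨q, hq, hqa, h1 | h1⟩ := hC.decide (P := fun q => Sub p q ∧ P q) inferInstance
  · exact ⟨q, hq, hqa, h1⟩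
  · obtain ⟨m, hm, -, h2, h3⟩ := agr_upper hp hq ha hqa
    obtain ⟨r, hr, h4, h5⟩ := h m hm h2
    exact (h1 r hr (h3.trans h4) ⟨h2.trans h4, h5⟩).elim

/-- `Φ` is a forcing relation for the predicate `P` of the generic extension by `C`. -/
structure Fc (C : Set α) (P : (ℕ → α) → Prop) (Φ : α → (ℕ → α) → Prop) : Prop where
  dfb : Dfb ∅ fun s => Φ (s 0) fun n => s (n + 1)
  mono : ∀ p q s, Sub p q → Φ p s → Φ q s
  stable : ∀ p s, Cd p → (∀ q, Cd q → Sub p q → ∃ r, Cd r ∧ Sub q r ∧ Φ r s) → Φ p s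
  truth : ∀ s, P s ↔ ∃ p, Cd p ∧ Agr C p ∧ Φ p s

theorem Fc.stable' {P : (ℕ → α) → Prop} {Φ : α → (ℕ → α) → Prop} (h : Fc C P Φ) {p : α}
    {s : ℕ → α} (hp : Cd p) (hn : ¬ Φ p s) :
    ∃ q, Cd q ∧ Sub p q ∧ ∀ r, Cd r → Sub q r → ¬ Φ r s := by
  by_contra! h'
  exact hn (h.stable p s hp h')

theorem Fc.abs (hC : Gen C) {P : (ℕ → α) → Prop} (hP : Dfb ∅ P) : Fc C P fun _ s => P s where
  dfb := hP.comp _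
  mono _ _ _ _ h := h
  stable p s hp h := by
    obtain ⟨r, -, -, h⟩ := h p hp (.refl _)
    exact h
  truth s := ⟨fun h => by
    obtain ⟨p, hp, ha, -⟩ := hC.ext emp .emp
    exact ⟨p, hp, ha, h⟩, fun ⟨_, _, _, h⟩ => h⟩

theorem Fc.cls (hC : Gen C) (i : ℕ) : Fc C (fun s => s i ∈ C)
    fun p s => ∀ q, Cd q → Sub p q → ∃ r, Cd r ∧ Sub q r ∧ on r (s i) where
  dfb := inferInstance
  mono p q s h hp r hr h' := hp r hr (h.trans h')
  stable p s hp h q hq hpq := by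
    obtain ⟨r, hr, hqr, h⟩ := h q hq hpq
    obtain ⟨r', hr', h1, h2⟩ := h r hr (.refl _)
    exact ⟨r', hr', hqr.trans h1, h2⟩
  truth s := by
    constructor
    · intro h
      obtain ⟨p, hp, ha, h1⟩ := hC.ext _ (hC.od _ h).suc
      have hl := h1 _ (mem_suc.2 (.inr rfl))
      have := (ha _ hl).1 h
      exact ⟨p, hp, ha, fun q hq hpq => ⟨q, hq, .refl _, (hp.sub_on hq hpq hl).1 this⟩⟩
    · rintro ⟨p, hp, ha, h⟩
      obtain ⟨q, hq, hqa, -, h⟩ := hC.dense_below (P := fun q => on q (s i)) inferInstance hp ha h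
      exact (hqa _ (hq.on_lt h)).2 h

theorem Fc.imp (hC : Gen C) {P Q : (ℕ → α) → Prop} {Φ Ψ : α → (ℕ → α) → Prop} (h1 : Fc C P Φ)
    (h2 : Fc C Q Ψ) : Fc C (fun s => P s → Q s)
      fun p s => ∀ q, Cd q → Sub p q → Φ q s → Ψ q s := by
  have a1 : Dfb ∅ fun s => Φ (s 0) fun n => s (n + 2) := h1.dfb.comp fun n => if n = 0 then 0 else n + 1
  have a2 : Dfb ∅ fun s => Ψ (s 0) fun n => s (n + 2) := h2.dfb.comp fun n => if n = 0 then 0 else n + 1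
  have d : Dfb ∅ fun s => (fun p s => ∀ q, Cd q → Sub p q → Φ q s → Ψ q s) (s 0)
    fun n => s (n + 1) := by infer_instance
  refine ⟨d, fun p q s h hp r hr h' => hp r hr (h.trans h'), fun p s hp h q hq hpq hΦ => ?_,
    fun s => ⟨fun h => ?_, ?_⟩⟩
  · refine h2.stable q s hq fun q' hq' hqq => ?_
    obtain ⟨r, hr, hqr, h⟩ := h q' hq' (hpq.trans hqq)
    exact ⟨r, hr, hqr, h r hr (.refl _) (h1.mono _ _ _ (hqq.trans hqr) hΦ)⟩
  · obtain ⟨p, hp, ha, h3 | h3⟩ := hC.decide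
      (P := fun p => ∀ q, Cd q → Sub p q → Φ q s → Ψ q s) (d.fix s)
    · exact ⟨p, hp, ha, h3⟩
    · have a3 : Dfb ∅ fun s => Φ (s 0) (fun n => s (n + 1)) ∧ ∀ r, Cd r → Sub (s 0) r →
        ¬ Ψ r fun n => s (n + 1) := by have := h1.dfb; infer_instance
      obtain ⟨q, hq, hqa, hpq, h4, h5⟩ := hC.dense_below
        (P := fun p => Φ p s ∧ ∀ r, Cd r → Sub p r → ¬ Ψ r s) (a3.fix s) hp ha fun q hq hpq => by
          have := h3 q hq hpq
          push Not at this
          obtain ⟨r, hr, hqr, h4, h5⟩ := this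
          obtain ⟨r', hr', h6, h7⟩ := h2.stable' hr h5
          exact ⟨r', hr', hqr.trans h6, h1.mono _ _ _ h6 h4, h7⟩
      obtain ⟨r, hr, hra, h6⟩ := (h2.truth s).1 (h ((h1.truth s).2 ⟨q, hq, hqa, h4⟩))
      obtain ⟨m, hm, -, h7, h8⟩ := agr_upper hq hr hqa hra
      exact (h5 m hm h7 (h2.mono _ _ _ h8 h6)).elim
  · rintro ⟨p, hp, ha, h⟩ hPs
    obtain ⟨q, hq, hqa, h3⟩ := (h1.truth s).1 hPs
    obtain ⟨m, hm, hma, h4, h5⟩ := agr_upper hp hq ha hqa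
    exact (h2.truth s).2 ⟨m, hm, hma, h m hm h4 (h1.mono _ _ _ h5 h3)⟩

theorem Fc.all (hC : Gen C) {P : (ℕ → α) → Prop} {Φ : α → (ℕ → α) → Prop} (h1 : Fc C P Φ) :
    Fc C (fun s => ∀ x, P (push x s)) fun p s => ∀ x, Φ p (push x s) := by
  have a : ∀ i j, Dfb ∅ fun s => Φ (s i) (push (s j) fun n => s (n + 2)) := fun i j =>
    (h1.dfb.comp fun n => if n = 0 then i else if n = 1 then j else n).congr fun s => by
      refine iff_of_eq (congrArg _ (funext fun n => ?_))
      cases n <;> simp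
  have a' : ∀ i j, Dfb ∅ fun s => Φ (s i) (push (s j) fun n => s (n + 3)) := fun i j =>
    (h1.dfb.comp fun n => if n = 0 then i else if n = 1 then j else n + 1).congr fun s => by
      refine iff_of_eq (congrArg _ (funext fun n => ?_))
      cases n <;> simp
  have d : Dfb ∅ fun s => (fun p s => ∀ x, Φ p (push x s)) (s 0) fun n => s (n + 1) := by
    infer_instance
  refine ⟨d, fun p q s h hp x => h1.mono _ _ _ h (hp x), fun p s hp h x => ?_,
    fun s => ⟨fun h => ?_, ?_⟩⟩
  · refine h1.stable p _ hp fun q hq hpq => ?_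
    obtain ⟨r, hr, hqr, h⟩ := h q hq hpq
    exact ⟨r, hr, hqr, h x⟩
  · obtain ⟨p, hp, ha, h3 | h3⟩ := hC.decide (P := fun p => ∀ x, Φ p (push x s)) (d.fix s)
    · exact ⟨p, hp, ha, h3⟩
    · have a3 : Dfb ∅ fun s => ∃ x, ∀ r, Cd r → Sub (s 0) r → ¬ Φ r (push x fun n => s (n + 1)) := by
        infer_instance
      obtain ⟨q, hq, hqa, hpq, x, h5⟩ := hC.dense_below
        (P := fun p => ∃ x, ∀ r, Cd r → Sub p r → ¬ Φ r (push x s)) (a3.fix s) hp ha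
        fun q hq hpq => by
          have := h3 q hq hpq
          push Not at this
          obtain ⟨x, h5⟩ := this
          obtain ⟨r', hr', h6, h7⟩ := h1.stable' hq h5
          exact ⟨r', hr', h6, x, h7⟩
      obtain ⟨r, hr, hra, h6⟩ := (h1.truth _).1 (h x)
      obtain ⟨m, hm, -, h7, h8⟩ := agr_upper hq hr hqa hra
      exact (h5 m hm h7 (h1.mono _ _ _ h8 h6)).elim
  · rintro ⟨p, hp, ha, h⟩ x
    exact (h1.truth _).2 ⟨p, hp, ha, h x⟩

theorem Fc.par {P : (ℕ → α) → Prop} {Φ : α → (ℕ → α) → Prop} (h1 : Fc C P Φ) (a : α) :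
    Fc C (fun s => P (push a s)) fun p s => Φ p (push a s) where
  dfb := by
    refine Dfb.sub (R := fun x s => Φ (s 0) (push x fun n => s (n + 1))) ?_ (.const a)
    refine (h1.dfb.comp fun n => if n = 0 then 1 else if n = 1 then 0 else n).congr fun s => ?_
    refine iff_of_eq (congrArg _ (funext fun n => ?_))
    cases n <;> simp
  mono _ _ _ h hp := h1.mono _ _ _ h hp
  stable _ _ hp h := h1.stable _ _ hp h
  truth _ := h1.truth _

theorem Gen.exists_fc (hC : Gen C) {P : (ℕ → α) → Prop} (h : Dfb {C} P) : ∃ Φ, Fc C P Φ := by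
  obtain ⟨h⟩ := h
  induction h with
  | mem i j => exact ⟨_, .abs hC inferInstance⟩
  | eq i j => exact ⟨_, .abs hC inferInstance⟩
  | cls X hX i =>
    obtain rfl := hX
    exact ⟨_, .cls hC i⟩
  | fal => exact ⟨_, .abs hC inferInstance⟩
  | imp _ _ h1 h2 =>
    obtain ⟨Φ, h1⟩ := h1
    obtain ⟨Ψ, h2⟩ := h2
    exact ⟨_, .imp hC h1 h2⟩
  | all _ h =>
    obtain ⟨Φ, h⟩ := h
    exact ⟨_, .all hC h⟩
  | par _ a h =>
    obtain ⟨Φ, h⟩ := h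
    exact ⟨_, .par h a⟩

end Forcing

end SOST

namespace SOST

set_option linter.unusedSectionVars false

open SM (E)

section Extension

variable {α : Type} [SM α] [ZF0 α] [ZB α ∅] [AC α] {C : Set α}

theorem Gen.repl (hC : Gen C) (R : α → α → Prop) (hR : Dfb {C} fun s => R (s 0) (s 1))
    (hf : ∀ x y y', R x y → R x y' → y = y') (a : α) : IsSet fun y => ∃ x, E x a ∧ R x y := by
  obtain ⟨Φ, hΦ⟩ := hC.exists_fc hR
  obtain ⟨Ψ, hd, hm, ht⟩ : ∃ Ψ : α → α → α → Prop, (Dfb ∅ fun s => Ψ (s 0) (s 1) (s 2)) ∧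
      (∀ p q x y, Sub p q → Ψ p x y → Ψ q x y) ∧
      ∀ x y, R x y ↔ ∃ p, Cd p ∧ Agr C p ∧ Ψ p x y := by
    refine ⟨fun p x y => Φ p fun n => if n = 0 then x else y, ?_, fun p q x y => hΦ.mono p q _,
      fun x y => hΦ.truth fun n => if n = 0 then x else y⟩
    refine (hΦ.dfb.comp fun n => min n 2).congr fun s => ?_
    refine iff_of_eq (congrArg _ (funext fun n => ?_))
    rcases n with _ | n <;> simp
  have hd' : ∀ i j k, Dfb ∅ fun s => Ψ (s i) (s j) (s k) := fun i j k =>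
    .sub3 hd (.var i) (.var j) (.var k)
  obtain ⟨D, hD⟩ : ∃ D : α → α → Prop, D = fun x q =>
    (∃ y, Ψ q x y) ∨ ∀ y r, Cd r → Sub q r → ¬ Ψ r x y := ⟨_, rfl⟩
  have hDd : Dfb ∅ fun s => D (s 0) (s 1) := by subst hD; infer_instance
  have hDd' : ∀ i j, Dfb ∅ fun s => D (s i) (s j) := fun i j => .sub2 hDd (.var i) (.var j)
  obtain ⟨p₀, hp₀, hpa₀, -⟩ := hC.ext emp .emp
  obtain ⟨q, hq, hqa, -, h⟩ := hC.dense_below (P := fun q => ∀ x, E x a → D x q)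
    inferInstance hp₀ hpa₀ fun p hp _ => distrib a hDd
      (fun x _ p hp => by
        by_cases h : ∃ y r, Cd r ∧ Sub p r ∧ Ψ r x y
        · obtain ⟨y, r, h1, h2, h3⟩ := h
          exact ⟨r, h1, h2, by subst hD; exact .inl ⟨y, h3⟩⟩
        · push Not at h
          exact ⟨p, hp, .refl _, by subst hD; exact .inr h⟩)
      (fun x _ p q hp hq hpq h => by
        subst hD
        rcases h with ⟨y, h⟩ | h
        · exact .inl ⟨y, hm _ _ _ _ hpq h⟩
        · exact .inr fun y r hr hqr => h y r hr (hpq.trans hqr)) hp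
  have key : ∀ x y, E x a → (R x y ↔ Ψ q x y) := fun x y hx => by
    refine ⟨fun h1 => ?_, fun h1 => (ht x y).2 ⟨q, hq, hqa, h1⟩⟩
    have h2 := h x hx
    subst hD
    rcases h2 with ⟨y', h2⟩ | h2
    · rwa [hf x y y' h1 ((ht x y').2 ⟨q, hq, hqa, h2⟩)]
    · obtain ⟨r, hr, hra, h3⟩ := (ht x y).1 h1
      obtain ⟨m, hm', -, h4, h5⟩ := agr_upper hq hr hqa hra
      exact (h2 y m hm' h4 (hm _ _ _ _ h5 h3)).elim
  have hR' : Dfb ∅ fun s => E (s 0) a ∧ Ψ q (s 0) (s 1) := by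
    have : Dfb ∅ fun s => Ψ q (s 0) (s 1) := .sub3 hd (.const q) (.var 0) (.var 1)
    infer_instance
  obtain ⟨b, hb⟩ := ZB.repl (𝓑 := ∅) (fun x y => E x a ∧ Ψ q x y) hR' (fun x y y' h1 h2 =>
    hf x y y' ((key x y h1.1).2 h1.2) ((key x y' h2.1).2 h2.2)) a
  refine ⟨b, fun z => (hb z).trans (exists_congr fun x => ?_)⟩
  constructor
  · rintro ⟨h1, -, h2⟩
    exact ⟨h1, (key _ _ h1).2 h2⟩
  · rintro ⟨h1, h2⟩
    exact ⟨h1, h1, (key _ _ h1).1 h2⟩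

theorem Gen.zb (hC : Gen C) : ZB α {C} where
  sep P hP a := by
    have : Dfb {C} fun s => P (s 0) ∧ s 1 = s 0 := inferInstance
    obtain ⟨b, hb⟩ := hC.repl (fun x y => P x ∧ y = x) this
      (fun x y y' h h' => h.2.trans h'.2.symm) a
    refine ⟨b, fun z => (hb z).trans ⟨?_, fun h => ⟨z, h.1, h.2, rfl⟩⟩⟩
    rintro ⟨x, h1, h2, rfl⟩
    exact ⟨h1, h2⟩
  repl := hC.repl

end Extension

end SOST

namespace SOST

set_option linter.unusedSectionVars false

open SM (E)

/-! ### The models -/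

section Models

variable {α : Type} [SM α] {𝓑 : Set (Set α)} {A : Set α}

theorem Dfb.exists_sat₁ (hA : 𝓑 ⊆ {A}) {P : α → Prop} (h : Dfb 𝓑 fun s => P (s 0))
    (𝒳 : Set (Set α)) : ∃ φ : Fml, φ.IsElementary ∧ (𝓑 = ∅ → φ.IsPure) ∧ ∃ s : ℕ → α, ∀ x,
      P x ↔ Sat Set.univ E 𝒳 φ (Function.update s 0 x) fun _ => A := by
  obtain ⟨φ, e, p, s, h⟩ := Dfb.exists_sat₂ hA (R := fun x _ => P x) h 𝒳
  refine ⟨φ, e, p, s, fun x => (h x (s 1)).trans (iff_of_eq ?_)⟩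
  rw [Function.update_eq_self_iff.2 (by simp)]

theorem Dfb.sat₁ {φ : Fml} {c : ℕ → Set α} (h : φ.IsPure ∨ φ.IsElementary ∧ ∀ n, c n ∈ 𝓑)
    (𝒳 : Set (Set α)) (s : ℕ → α) :
    Dfb 𝓑 fun t => Sat Set.univ E 𝒳 φ (Function.update s 0 (t 0)) c := by
  refine ((Dfb.sat (𝒳 := 𝒳) h).fix fun n => s (n + 1)).congr fun t => iff_of_eq ?_
  congr 1
  funext n
  cases n <;> simp

theorem mem_defFrom {X : Set α} : X ∈ DefFrom Set.univ E A ↔ Dfb {A} fun s => s 0 ∈ X := by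
  constructor
  · rintro ⟨φ, hφ, s, -, rfl⟩
    exact (Dfb.sat₁ (𝓑 := {A}) (c := fun _ => A) (.inr ⟨hφ, fun _ => rfl⟩) {A} s).congr fun t => by simp
  · intro h
    obtain ⟨φ, e, -, s, h⟩ := Dfb.exists_sat₁ subset_rfl (P := fun x => x ∈ X) h {A}
    exact ⟨φ, e, s, fun _ => trivial, Set.ext fun x => by simpa using h x⟩

theorem mem_def0 {X : Set α} : X ∈ Def0 Set.univ E ↔ Dfb ∅ fun s => s 0 ∈ X := by
  constructor
  · rintro ⟨φ, hφ, s, -, rfl⟩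
    exact (Dfb.sat₁ (c := fun _ => ∅) (.inl hφ) ∅ s).congr fun t => by simp
  · intro h
    obtain ⟨φ, -, e, s, h⟩ :=
      Dfb.exists_sat₁ (Set.empty_subset {∅}) (P := fun x => x ∈ X) h ∅
    exact ⟨φ, e rfl, s, fun _ => trivial, Set.ext fun x => by simpa using h x⟩

theorem zf0_of_zfModel (h : ZFModel (Set.univ : Set α) E) : ZF0 α where
  ext x y := by simpa using h.exten x trivial y trivial
  pairing x y := by simpa [IsSet] using h.pairing x trivial y trivial
  union x := by simpa [IsSet] using h.union x trivial
  power x := by simpa [IsSet] using h.power x trivial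
  inf := by simpa using h.infinity
  found x := by simpa using h.foundation x trivial

theorem zb_of_zfModel (h : ZFModel (Set.univ : Set α) E) : ZB α ∅ where
  sep P hP a := by
    obtain ⟨φ, -, e, s, hs⟩ := hP.exists_sat₁ (Set.empty_subset {∅}) ∅
    simpa [IsSet, hs] using h.separation φ (e rfl) s (fun _ => trivial) a trivial
  repl R hR hf a := by
    obtain ⟨φ, -, e, s, hs⟩ := hR.exists_sat₂ (Set.empty_subset {∅}) ∅
    simpa [IsSet, ← hs] using h.replacement φ (e rfl) s (fun _ => trivial)
      (by simpa [← hs] using hf) a trivial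

theorem ac_of_satAC (h : SatAC (Set.univ : Set α) E) : AC α where
  ac x h1 h2 := by
    simpa using h x trivial (by simpa using h1) fun y _ y' _ h3 h4 h5 => h2 y y' h3 h4 (by simpa using h5)

variable [ZF0 α]

theorem isOrdIn_iff {x : α} : IsOrdIn Set.univ E x ↔ Od x := by
  simp [IsOrdIn, IsTransIn, Od]

theorem isZeroIn_iff {x : α} : IsZeroIn Set.univ E x ↔ x = emp := by
  simp only [IsZeroIn, Set.mem_univ, true_and, forall_const]
  exact ⟨fun h => sext fun z => ⟨fun h' => (h z h').elim, fun h' => (mem_emp h').elim⟩,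
    fun h _ => h ▸ mem_emp⟩

theorem isOneIn_iff {x : α} : IsOneIn Set.univ E x ↔ x = one := by
  have : ∀ z : α, E z one ↔ z = emp := fun z =>
    mem_suc.trans (or_iff_right mem_emp)
  simp only [IsOneIn, Set.mem_univ, true_and, forall_const, isZeroIn_iff]
  exact ⟨fun h => sext fun z => (h z).trans (this z).symm, fun h z => h ▸ this z⟩

theorem eq_up {x a b : α} : x = up a b ↔ ∀ z, E z x ↔ z = a ∨ z = b :=
  ⟨fun h _ => h ▸ mem_up, fun h => sext fun z => (h z).trans mem_up.symm⟩

theorem isKPair_iff {p a b : α} : IsKPair Set.univ E p a b ↔ p = kp a b := by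
  unfold kp
  rw [eq_up]
  simp only [IsKPair, Set.mem_univ, true_and, forall_const, eq_up, or_self]

theorem pairIn_iff {F : Set α} {a b : α} : PairIn Set.univ E F a b ↔ kp a b ∈ F := by
  simp [PairIn, isKPair_iff]

theorem pairInSet_iff {p a b : α} : pairInSet Set.univ E p a b ↔ E (kp a b) p := by
  simp [pairInSet, isKPair_iff]

theorem isCond_iff {p : α} : IsCond Set.univ E p ↔ Cd p := by
  simp [IsCond, Cd, isKPair_iff, pairInSet_iff, isOrdIn_iff, isZeroIn_iff, isOneIn_iff]

theorem condExtends_iff {p q : α} (hp : Cd p) : CondExtends Set.univ E q p ↔ Sub p q := by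
  simp only [CondExtends, pairInSet_iff]
  refine ⟨fun h z hz => ?_, fun h x v => h _⟩
  obtain ⟨g, -, h1, -⟩ := hp
  obtain ⟨x, v, -, -, rfl⟩ := h1 z hz
  exact h x v hz

variable [ZB α ∅]

theorem agreesWith_iff {C : Set α} {p : α} (hp : Cd p) :
    AgreesWith Set.univ E C p ↔ Agr C p := by
  simp only [AgreesWith, pairInSet_iff, isOneIn_iff]
  refine ⟨fun h x hx => ?_, fun h x v hv => ?_⟩
  · by_cases h1 : on p x
    · exact iff_of_true ((h x one h1).2 rfl) h1
    · exact iff_of_false (fun h2 => emp_ne_one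
        ((h x emp (hp.mem_pair.2 ⟨hx, .inr ⟨h1, rfl⟩⟩)).1 h2)) h1
  · obtain ⟨h1, ⟨h2, rfl⟩ | ⟨h2, rfl⟩⟩ := hp.mem_pair.1 hv
    · exact iff_of_true ((h x h1).2 h2) rfl
    · exact iff_of_false (fun h3 => h2 ((h x h1).1 h3)) emp_ne_one

theorem cohenGeneric_iff {C : Set α} : CohenGeneric Set.univ E C ↔ Gen C := by
  have len_iff : ∀ p : α, Cd p → ∀ g,
      (∀ x ∈ Set.univ, E x g → ∃ v, pairInSet Set.univ E p x v) ↔ Sub g (len p) :=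
    fun p hp g => by
      refine ⟨fun h x hx => ?_, fun h x _ hx => ?_⟩
      · obtain ⟨v, hv⟩ := h x trivial hx
        exact (hp.mem_pair.1 (pairInSet_iff.1 hv)).1
      · by_cases h1 : on p x
        · exact ⟨one, pairInSet_iff.2 h1⟩
        · exact ⟨emp, pairInSet_iff.2 (hp.mem_pair.2 ⟨h x hx, .inr ⟨h1, rfl⟩⟩)⟩
  constructor
  · rintro ⟨h1, h2, h3⟩
    refine ⟨fun x hx => isOrdIn_iff.1 (h1 x hx), fun g hg => ?_, fun P hP hd => ?_⟩
    · obtain ⟨p, hp, ha, h⟩ := h2 g (isOrdIn_iff.2 hg)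
      have hp := isCond_iff.1 hp
      exact ⟨p, hp, (agreesWith_iff hp).1 ha, (len_iff p hp g).1 h⟩
    · have : Dfb ∅ fun s : ℕ → α => Cd (s 0) ∧ P (s 0) := inferInstance
      obtain ⟨p, hp, ha⟩ := h3 {p | Cd p ∧ P p} (mem_def0.2 this)
        (fun z hz => isCond_iff.2 hz.1) fun p hp => by
          have hp := isCond_iff.1 hp
          obtain ⟨q, h4, h5, h6⟩ := hd p hp
          exact ⟨q, ⟨h4, h6⟩, (condExtends_iff hp).2 h5⟩
      exact ⟨p, hp.1, (agreesWith_iff hp.1).1 ha, hp.2⟩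
  · rintro ⟨h1, h2, h3⟩
    refine ⟨fun x hx => isOrdIn_iff.2 (h1 x hx), fun g hg => ?_, fun Δ hΔ hs hd => ?_⟩
    · obtain ⟨p, hp, ha, h⟩ := h2 g (isOrdIn_iff.1 hg)
      exact ⟨p, isCond_iff.2 hp, (agreesWith_iff hp).2 ha, (len_iff p hp g).2 h⟩
    · obtain ⟨p, hp, ha, h⟩ := h3 (fun p => p ∈ Δ) (mem_def0.1 hΔ) fun p hp => by
        obtain ⟨q, h4, h5⟩ := hd p (isCond_iff.2 hp)
        exact ⟨q, isCond_iff.1 (hs q h4), (condExtends_iff hp).1 h5, h4⟩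
      exact ⟨p, h, (agreesWith_iff hp).2 ha⟩

theorem gbModel_defFrom (h : ZFModel (Set.univ : Set α) E) [ZB α {A}] :
    GBModel Set.univ E (DefFrom Set.univ E A) where
  classes_sub _ _ := Set.subset_univ _
  zf := h
  classRepl F hF hf a _ := by
    have h1 : Dfb {A} fun s => kp (s 0) (s 1) ∈ F :=
      Dfb.sub1 (R := fun x => x ∈ F) (mem_defFrom.1 hF) inferInstance
    simp only [pairIn_iff] at hf ⊢
    simpa [IsSet] using ZB.repl (fun x y => kp x y ∈ F) h1 hf a
  elemComp φ hφ s _ c hc := by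
    refine ⟨{x | Sat Set.univ E (DefFrom Set.univ E A) φ (Function.update s 0 x) c},
      mem_defFrom.2 ?_, fun _ _ => .rfl⟩
    exact (Dfb.sat₁ (.inr ⟨hφ, hc⟩) _ s).trans fun X hX => mem_defFrom.1 hX

end Models

end SOST

namespace SOST

set_option linter.unusedSectionVars false

open SM (E)

section Projection

variable {α : Type} [SM α] [ZF0 α] [ZB α ∅] {C : Set α} {p q : α}

theorem Od.suc_mem_suc {x y : α} (hx : Od x) (h : E y x) : E (SOST.suc y) (SOST.suc x) :=
  mem_suc.2 (((hx.mem h).suc.sub_iff hx).1 (hx.suc_sub h))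

/-- The condition `x ↦ p (x + 1)`. -/
noncomputable def prj (p : α) : α :=
  cond (coll fun x => E (suc x) (len p)) fun x => on p (suc x)

instance Tm.prj {t : (ℕ → α) → α} [ht : Tm ∅ t] : Tm ∅ fun s => prj (t s) :=
  .sub1 (by unfold SOST.prj cond; infer_instance) ht

theorem prj_spec (hp : Cd p) : Cd (prj p) ∧ (∀ x, E x (len (prj p)) ↔ E (suc x) (len p)) ∧
    ∀ x, E (suc x) (len p) → (on (prj p) x ↔ on p (suc x)) := by
  have hs : IsSet fun x => E (suc x) (len p) :=
    IsSet.sub (𝓑 := ∅) (isSet_mem (len p)) (P := fun x => E (suc x) (len p)) inferInstance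
      fun x hx => hp.od.trans hx (mem_suc.2 (.inr rfl))
  have ho : Od (coll fun x => E (suc x) (len p)) := by
    refine ⟨fun y hy z hz => ?_, fun y hy => ?_⟩
    · have hy := (mem_coll hs).1 hy
      have h1 : Od (suc y) := hp.od.mem hy
      exact (mem_coll hs).2 (hp.od.trans hy ((h1.mem (mem_suc.2 (.inr rfl))).suc_mem_suc hz))
    · have hy := (mem_coll hs).1 hy
      exact ((hp.od.mem hy).mem (mem_suc.2 (.inr rfl))).1
  obtain ⟨h1, h2, h3⟩ := cond_spec ∅ ho (P := fun x => on p (suc x)) inferInstance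
  refine ⟨h1, fun x => ?_, fun x hx => h3 x ((mem_coll hs).2 hx)⟩
  rw [prj, h2, mem_coll hs]

/-- The class of predecessors of the successors in `C`. -/
def prjClass (C : Set α) : Set α := {x | Od x ∧ suc x ∈ C}

theorem agr_prj (hp : Cd p) (h : Agr C p) : Agr (prjClass C) (prj p) := by
  obtain ⟨-, h2, h3⟩ := prj_spec hp
  intro x hx
  have hx := (h2 x).1 hx
  rw [h3 x hx, ← h _ hx]
  exact and_iff_right ((hp.od.mem hx).mem (mem_suc.2 (.inr rfl)))

theorem Agr.of_sub (hp : Cd p) (hq : Cd q) (h : Sub p q) (ha : Agr C q) : Agr C p :=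
  fun x hx => (ha x (hp.sub_len hq h x hx)).trans (hp.sub_on hq h hx).symm

theorem exists_lift (hp : Cd p) (hq : Cd q) (h : Sub (prj p) q) {l : α} (hl : Od l)
    (hlp : Sub (len p) l) (hs : ∀ z, l ≠ suc z) (b : Prop) :
    ∃ r, Cd r ∧ Sub p r ∧ Sub q (prj r) ∧ E l (len r) ∧ (on r l ↔ b) := by
  have hlp : ¬ E l (len p) := fun h' => mem_irrefl (hlp l h')
  have hb : Dfb ∅ fun _ : ℕ → α => b := by by_cases hb : b <;> simp only [hb] <;> infer_instance
  obtain ⟨r, hr, h1, h2⟩ : ∃ r, Cd r ∧ len r = cup (len p) (cup (suc (len q)) (suc l)) ∧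
      ∀ x, E x (len r) →
        (on r x ↔ on p x ∨ ¬ E x (len p) ∧ (x = l ∧ b ∨ ∃ y, x = suc y ∧ on q y)) := by
    obtain ⟨h1, h2, h3⟩ := cond_spec ∅ (hp.od.cup (hq.od.suc.cup hl.suc))
      (P := fun x => on p x ∨ ¬ E x (len p) ∧ (x = l ∧ b ∨ ∃ y, x = suc y ∧ on q y)) inferInstance
    exact ⟨_, h1, h2, h2.symm ▸ h3⟩
  have hlr : E l (len r) := by rw [h1]; simp [mem_cup, mem_suc]
  obtain ⟨h3, h4, h5⟩ := prj_spec hp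
  obtain ⟨h6, h7, h8⟩ := prj_spec hr
  have hqr : ∀ x, E x (len q) → E (suc x) (len r) := fun x hx => by
    rw [h1, mem_cup, mem_cup]
    exact .inr (.inl (hq.od.suc_mem_suc hx))
  refine ⟨r, hr, ?_, ?_, hlr, ?_⟩
  · have : Sub (len p) (len r) := fun x hx => by rw [h1]; exact mem_cup.2 (.inl hx)
    refine (hp.sub_iff hr).2 ⟨this, fun x hx => ?_⟩
    rw [h2 x (this x hx)]
    simp [hx]
  · refine (hq.sub_iff h6).2 ⟨fun x hx => (h7 x).2 (hqr x hx), fun x hx => ?_⟩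
    rw [h8 x (hqr x hx), h2 _ (hqr x hx)]
    by_cases hxp : E (suc x) (len p)
    · simp only [hxp, not_true, false_and, or_false]
      rw [← h5 x hxp, h3.sub_on hq h ((h4 x).2 hxp)]
    · have h9 : ¬ on p (suc x) := fun h' => hxp (hp.on_lt h')
      simp only [hxp, h9, not_false_iff, true_and, false_or, (hs x).symm, false_and]
      refine ⟨fun h' => ⟨x, rfl, h'⟩, ?_⟩
      rintro ⟨y, hy, h'⟩
      rwa [suc_inj hy]
  · have h9 : ¬ on p l := fun h' => hlp (hp.on_lt h')
    rw [h2 l hlr]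
    simp [h9, hlp, hs]

theorem Gen.prjClass (hC : Gen C) : Gen (prjClass C) where
  od x hx := hx.1
  ext g hg := by
    obtain ⟨p, hp, ha, h⟩ := hC.ext _ hg.suc
    obtain ⟨h1, h2, -⟩ := prj_spec hp
    exact ⟨prj p, h1, agr_prj hp ha, fun x hx => (h2 x).2 (h _ (hg.suc_mem_suc hx))⟩
  dense P hP hd := by
    have : ∀ i, Dfb ∅ fun s => P (s i) := fun i => .sub1 hP (.var i)
    obtain ⟨p, hp, ha, q, hq, h1, h2⟩ := hC.dense (fun p => ∃ q, Cd q ∧ Sub q (prj p) ∧ P q)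
      inferInstance fun p hp => by
        obtain ⟨q, hq, h1, h2⟩ := hd _ (prj_spec hp).1
        obtain ⟨l, hl, h3, h4⟩ := exists_nonsucc_ge hp.od
        obtain ⟨r, hr, h5, h6, -⟩ := exists_lift hp hq h1 hl h3 h4 True
        exact ⟨r, hr, h5, q, hq, h6, h2⟩
    exact ⟨q, hq, .of_sub hq (prj_spec hp).1 h1 (agr_prj hp ha), h2⟩

/-- A generic class is not definable from its projection. -/
theorem Gen.not_dfb_prjClass (hC : Gen C) : ¬ Dfb {SOST.prjClass C} fun s => s 0 ∈ C := by
  intro h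
  obtain ⟨Φ, hΦ⟩ := hC.prjClass.exists_fc h
  obtain ⟨Ψ, hd, hm, ht⟩ : ∃ Ψ : α → α → Prop, (Dfb ∅ fun s => Ψ (s 0) (s 1)) ∧
      (∀ p q x, Sub p q → Ψ p x → Ψ q x) ∧
      ∀ x, x ∈ C ↔ ∃ p, Cd p ∧ Agr (SOST.prjClass C) p ∧ Ψ p x := by
    refine ⟨fun p x => Φ p fun _ => x, ?_, fun p q x => hΦ.mono p q _, fun x => hΦ.truth fun _ => x⟩
    refine (hΦ.dfb.comp fun n => min n 1).congr fun s => ?_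
    refine iff_of_eq (congrArg _ (funext fun n => ?_))
    simp
  have hd' : ∀ {t u : (ℕ → α) → α} [Tm ∅ t] [Tm ∅ u], Dfb ∅ fun s => Ψ (t s) (u s) :=
    fun {t u} ht hu => .sub2 hd ht hu
  obtain ⟨p, hp, ha, l, hl, h⟩ := hC.dense (fun p => ∃ l, E l (len p) ∧
    ((on p l ∧ ∀ r, Cd r → Sub (prj p) r → ¬ Ψ r l) ∨ (¬ on p l ∧ Ψ (prj p) l))) inferInstance
    fun p hp => by
      obtain ⟨l, hl, h1, h2⟩ := exists_nonsucc_ge hp.od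
      by_cases h : ∃ q, Cd q ∧ Sub (prj p) q ∧ Ψ q l
      · obtain ⟨q, hq, h3, h4⟩ := h
        obtain ⟨r, hr, h5, h6, h7, h8⟩ := exists_lift hp hq h3 hl h1 h2 False
        exact ⟨r, hr, h5, l, h7, .inr ⟨h8.1, hm _ _ _ h6 h4⟩⟩
      · obtain ⟨r, hr, h5, h6, h7, h8⟩ :=
          exists_lift hp (prj_spec hp).1 (.refl _) hl h1 h2 True
        exact ⟨r, hr, h5, l, h7, .inl ⟨h8.2 trivial, fun q hq h9 h10 =>
          h ⟨q, hq, h6.trans h9, h10⟩⟩⟩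
  have ha' := agr_prj hp ha
  rcases h with ⟨h1, h2⟩ | ⟨h1, h2⟩
  · obtain ⟨q, hq, hqa, h3⟩ := (ht l).1 ((ha l hl).2 h1)
    obtain ⟨m, hm', -, h4, h5⟩ := agr_upper (prj_spec hp).1 hq ha' hqa
    exact h2 m hm' h4 (hm _ _ _ h5 h3)
  · exact h1 ((ha l hl).1 ((ht l).2 ⟨_, (prj_spec hp).1, ha', h2⟩))

theorem dfb_prjClass : Dfb {C} fun s => s 0 ∈ prjClass C := by
  have : Dfb {C} fun s => suc (s 0) ∈ C := .cls (Set.mem_singleton C) _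
  exact inferInstanceAs (Dfb {C} fun s => Od (s 0) ∧ suc (s 0) ∈ C)

end Projection

end SOST

namespace SOST

set_option linter.unusedSectionVars false

open SM (E)

/-! ### Global choice -/

section GlobalChoice

variable {α : Type} [SM α] [ZF0 α] {A C : Set α}

/-- A definable Cantor–Bernstein argument: a definable injection of the universe into the
ordinals yields global choice. -/
theorem globalChoice_of_injective {f : α → α} (hf : Tm {A} fun s => f (s 0))
    (ho : ∀ x, Od (f x)) (hi : ∀ x y, f x = f y → x = y) :
    GlobalChoice Set.univ E (DefFrom Set.univ E A) := by
  have hf' : ∀ {t : (ℕ → α) → α} [Tm {A} t], Tm {A} fun s => f (t s) := fun {t} ht => .sub1 hf ht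
  obtain ⟨X, hX⟩ : ∃ X : α → Prop, ∀ x, X x ↔
      ∃ u, E x u ∧ ∀ y, E y u → Od y → ∃ z, E z u ∧ f z = y := ⟨_, fun _ => .rfl⟩
  have hXd : ∀ i, Dfb {A} fun s => X (s i) := fun i => by simp only [hX]; infer_instance
  have h1 : ∀ x, ¬ X x → Od x := fun x hx => by
    by_contra h
    refine hx ((hX x).2 ⟨up x x, mem_up.2 (.inl rfl), fun y hy h' => ?_⟩)
    rw [mem_up, or_self_iff] at hy
    exact (h (hy ▸ h')).elim
  have h2 : ∀ x, X x → X (f x) := fun x hx => by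
    obtain ⟨u, hu, h⟩ := (hX x).1 hx
    refine (hX _).2 ⟨cup u (up (f x) (f x)), by simp [mem_cup, mem_up], fun y hy h' => ?_⟩
    simp only [mem_cup, mem_up, or_self_iff] at hy ⊢
    rcases hy with hy | rfl
    · obtain ⟨z, hz, h⟩ := h y hy h'
      exact ⟨z, .inl hz, h⟩
    · exact ⟨x, .inl hu, rfl⟩
  have h3 : ∀ y, X y → Od y → ∃ z, X z ∧ f z = y := fun y hy ho => by
    obtain ⟨u, hu, h⟩ := (hX y).1 hy
    obtain ⟨z, hz, h'⟩ := h y hu ho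
    exact ⟨z, (hX z).2 ⟨u, hz, h⟩, h'⟩
  have hd : Dfb {A} fun s => ∃ x y, (X x ∧ y = f x ∨ ¬ X x ∧ y = x) ∧ s 0 = kp x y := by
    infer_instance
  refine ⟨{z | ∃ x y, (X x ∧ y = f x ∨ ¬ X x ∧ y = x) ∧ z = kp x y}, mem_defFrom.2 hd, ?_⟩
  have key : ∀ a b, PairIn Set.univ E {z | ∃ x y, (X x ∧ y = f x ∨ ¬ X x ∧ y = x) ∧ z = kp x y} a b ↔
      (X a ∧ b = f a ∨ ¬ X a ∧ b = a) := fun a b => by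
    rw [pairIn_iff]
    constructor
    · rintro ⟨x, y, h, h'⟩
      obtain ⟨rfl, rfl⟩ := kp_inj.1 h'
      exact h
    · exact fun h => ⟨a, b, h, rfl⟩
  simp only [key, isOrdIn_iff]
  refine ⟨?_, ?_, ?_, ?_, ?_⟩
  · rintro _ ⟨x, y, -, rfl⟩
    exact ⟨x, y, trivial, trivial, isKPair_iff.2 rfl⟩
  · rintro x y y' (⟨h, rfl⟩ | ⟨h, rfl⟩) (⟨h', rfl⟩ | ⟨h', rfl⟩)
    · rfl
    · exact (h' h).elim
    · exact (h h').elim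
    · rfl
  · rintro x x' y (⟨h, rfl⟩ | ⟨h, rfl⟩) (⟨h', e⟩ | ⟨h', e⟩)
    · exact hi _ _ e
    · exact (h' (e ▸ h2 x h)).elim
    · exact (h (e ▸ h2 x' h')).elim
    · exact e
  · intro x _
    by_cases h : X x
    · exact ⟨f x, .inl ⟨h, rfl⟩, ho x⟩
    · exact ⟨x, .inr ⟨h, rfl⟩, h1 x h⟩
  · intro y hy
    by_cases h : X y
    · obtain ⟨z, h4, h5⟩ := h3 y h hy
      exact ⟨z, trivial, .inl ⟨h4, h5.symm⟩⟩
    · exact ⟨y, trivial, .inr ⟨h, rfl⟩⟩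

variable [ZB α ∅]

/-- The class `P` codes the set of ordinals `a` at `d`: after `d` there is a block of ones of
some length `b`, then a zero, and then the characteristic function of `a` below `b`. -/
def Codes (P : α → Prop) (d b a : α) : Prop :=
  (∀ x, E x b → P (add d x)) ∧ ¬ P (add d b) ∧
    ∀ x, E x a ↔ E x b ∧ P (add (suc (add d b)) x)

theorem Codes.unique {P : α → Prop} {d b b' a a' : α} (hb : Od b) (hb' : Od b')
    (h : Codes P d b a) (h' : Codes P d b' a') : a = a' := by
  rcases hb.trich hb' with h1 | rfl | h1
  · exact (h.2.1 (h'.1 _ h1)).elim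
  · exact sext fun z => (h.2.2 z).trans (h'.2.2 z).symm
  · exact (h'.2.1 (h.1 _ h1)).elim

theorem exists_codes_on {p a b : α} (hp : Cd p) (hb : Od b) (h : Sub a b) :
    ∃ q, Cd q ∧ Sub p q ∧ ∃ d, Od d ∧ E (add d b) (len q) ∧
      Sub (add (suc (add d b)) b) (len q) ∧ Codes (on q) d b a := by
  have hd := hp.od
  obtain ⟨d, rfl⟩ : ∃ d, len p = d := ⟨_, rfl⟩
  have hdb := hd.add hb
  obtain ⟨c, hc⟩ : ∃ c, c = add (suc (add (len p) b)) b := ⟨_, rfl⟩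
  have hco : Od c := hc ▸ hdb.suc.add hb
  have h1 : E (add (len p) b) c := hc ▸ sub_add hb _ (mem_suc.2 (.inr rfl))
  obtain ⟨hq, hl, h2⟩ := cond_spec ∅ hco (P := fun x => on p x ∨ ¬ E x (len p) ∧
    (E x (add (len p) b) ∨ ∃ y, E y a ∧ x = add (suc (add (len p) b)) y)) inferInstance
  refine ⟨_, hq, ?_, len p, hd, hl.symm ▸ h1, ?_, ?_, ?_, ?_⟩
  · have : Sub (len p) c := fun x hx => hco.trans h1 (sub_add hb x hx)
    refine (hp.sub_iff hq).2 ⟨hl.symm ▸ this, fun x hx => ?_⟩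
    rw [h2 x (this x hx)]
    simp [hx]
  · rw [hl, hc]
    exact .refl _
  · intro x hx
    have h3 := add_lt_add (g := len p) hb hx
    refine (h2 _ (hco.trans h1 h3)).2 (.inr ⟨fun h4 => ?_, .inl h3⟩)
    exact mem_irrefl (sub_add (hb.mem hx) _ h4)
  · rw [h2 _ h1]
    rintro (h3 | ⟨-, h3 | ⟨y, hy, h3⟩⟩)
    · exact mem_irrefl (sub_add hb _ (hp.on_lt h3))
    · exact mem_irrefl h3
    · have := sub_add (g := suc (add (len p) b)) (hb.mem (h y hy)) _ (mem_suc.2 (.inr rfl))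
      rw [← h3] at this
      exact mem_irrefl this
  · intro x
    refine ⟨fun hx => ⟨h x hx, ?_⟩, fun ⟨hx, h3⟩ => ?_⟩
    all_goals
      have hxb : E x b := by first | exact hx | exact h x hx
      have h4 : E (add (suc (add (len p) b)) x) c := hc ▸ add_lt_add hb hxb
      have h5 : E (add (len p) b) (add (suc (add (len p) b)) x) :=
        sub_add (hb.mem hxb) _ (mem_suc.2 (.inr rfl))
      have h6 : ¬ E (add (suc (add (len p) b)) x) (add (len p) b) := fun h6 => mem_asymm h5 h6
      have h7 : ¬ E (add (suc (add (len p) b)) x) (len p) := fun h7 => h6 (sub_add hb _ h7)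
    · exact (h2 _ h4).2 (.inr ⟨h7, .inr ⟨x, hx, rfl⟩⟩)
    · rcases (h2 _ h4).1 h3 with h3 | ⟨-, h3 | ⟨y, hy, h3⟩⟩
      · exact (h7 (hp.on_lt h3)).elim
      · exact (h6 h3).elim
      · rwa [add_inj (hb.mem hxb) (hb.mem (h y hy)) h3]

theorem Gen.exists_codes (hC : Gen C) {a : α} (ha : ∀ x, E x a → Od x) :
    ∃ d, Od d ∧ ∃ b, Od b ∧ Codes (fun x => x ∈ C) d b a := by
  obtain ⟨b, hb, h⟩ : ∃ b, Od b ∧ Sub a b := by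
    obtain ⟨b, hb, h⟩ := exists_sup ∅ (f := suc) inferInstance fun x hx => (ha x hx).suc
    exact ⟨b, hb, fun x hx => (h x).2 ⟨x, hx, mem_suc.2 (.inr rfl)⟩⟩
  obtain ⟨q, hq, hqa, d, hd, h1, h2, h3, h4, h5⟩ := hC.dense (fun q => ∃ d, Od d ∧
    E (add d b) (len q) ∧ Sub (add (suc (add d b)) b) (len q) ∧ Codes (on q) d b a)
    (by unfold Codes; infer_instance) fun p hp => exists_codes_on hp hb h
  refine ⟨d, hd, b, hb, fun x hx => ?_, ?_, fun x => ?_⟩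
  · exact (hqa _ (hq.on_lt (h3 x hx))).2 (h3 x hx)
  · exact fun h => h4 ((hqa _ h1).1 h)
  · refine (h5 x).trans (and_congr_right fun hx => (hqa _ (h2 _ (add_lt_add hb hx))).symm)

variable [AC α]

theorem Gen.globalChoice (hC : Gen C) : GlobalChoice Set.univ E (DefFrom Set.univ E C) := by
  have := hC.zb
  have hd : ∀ i j k, Dfb {C} fun s : ℕ → α => Codes (fun x => x ∈ C) (s i) (s j) (s k) := by
    have : ∀ {t : (ℕ → α) → α} [Tm {C} t], Dfb {C} fun s => t s ∈ C :=
      fun {t} _ => .cls (Set.mem_singleton C) t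
    unfold Codes
    infer_instance
  obtain ⟨f, hf, im, him, h⟩ : ∃ f : α → α, Tm {C} (fun s => f (s 0)) ∧ ∃ im : α → α,
      (∀ x z, E z (im x) ↔ ∃ y, E y x ∧ z = f y) ∧
      ∀ x, f x = lst fun d => ∃ b, Od b ∧ Codes (fun x => x ∈ C) d b (im x) := by
    have spec := fun x => recf_spec (𝓑 := {C}) set_closure (G := fun _ _ a => lst fun d =>
      ∃ b, Od b ∧ Codes (fun x => x ∈ C) d b a) inferInstance emp x trivial
    exact ⟨recf _ emp, inferInstance, _, fun x z => mem_coll (spec x).2, fun x => (spec x).1⟩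
  have hf' : ∀ {t : (ℕ → α) → α} [Tm {C} t], Tm {C} fun s => f (t s) := fun {t} ht => .sub1 hf ht
  have key : ∀ x, Od (f x) ∧ ∃ b, Od b ∧ Codes (fun x => x ∈ C) (f x) b (im x) := by
    have step : ∀ x, (∀ y, E y x → Od (f y)) → Od (f x) ∧
        ∃ b, Od b ∧ Codes (fun x => x ∈ C) (f x) b (im x) := fun x ih => by
      obtain ⟨d, hd', hx⟩ := hC.exists_codes (a := im x) fun z hz => by
        obtain ⟨y, hy, rfl⟩ := (him x z).1 hz
        exact ih y hy
      have := lst_spec (𝓑 := {C}) (P := fun d => ∃ b, Od b ∧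
        Codes (fun x => x ∈ C) d b (im x)) ?_ hd' hx
      · rw [h x]
        exact ⟨this.1, this.2.1⟩
      · exact .sub (R := fun a s => ∃ b, Od b ∧ Codes (fun x => x ∈ C) (s 0) b a)
          inferInstance (.const (im x))
    exact fun x => step x fun y _ => tind (𝓑 := {C}) set_closure (P := fun x => Od (f x))
      inferInstance (fun x _ _ ih => (step x ih).1) y trivial
  refine globalChoice_of_injective hf (fun x => (key x).1) fun x => ?_
  refine tind (𝓑 := {C}) set_closure (P := fun x => ∀ y, f x = f y → x = y) inferInstance
    (fun x _ _ ih y e => ?_) x trivial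
  obtain ⟨-, b, hb, h1⟩ := key x
  obtain ⟨-, b', hb', h2⟩ := key y
  rw [← e] at h2
  have e' := h1.unique hb hb' h2
  refine sext fun z => ⟨fun hz => ?_, fun hz => ?_⟩
  · obtain ⟨w, hw, h3⟩ := (him y _).1 (e' ▸ (him x _).2 ⟨z, hz, rfl⟩)
    rwa [ih z hz w h3]
  · obtain ⟨w, hw, h3⟩ := (him x _).1 (e' ▸ (him y _).2 ⟨z, hz, rfl⟩)
    rwa [← ih w hw z h3.symm]

end GlobalChoice

end SOST

namespace SOST

/-- If `C` is a Cohen-generic subclass of `Ord` over a model of `ZFC`,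
then `Def(M; C)` is not a minimal `GBC`-realization; indeed there is a Cohen-generic
`C'` with `Def(M; C')` a `GBC`-realization strictly contained in `Def(M; C)`. -/
theorem cohen_not_minimal {α : Type} (E : α → α → Prop)
    (hzf : ZFModel (Set.univ : Set α) E) (hac : SatAC Set.univ E)
    (C : Set α) (hgen : CohenGeneric Set.univ E C) :
    (∃ 𝒵 : Set (Set α), GBC Set.univ E 𝒵 ∧ 𝒵 ⊂ DefFrom Set.univ E C) ∧
    ∃ C' : Set α, CohenGeneric Set.univ E C' ∧
      GBC Set.univ E (DefFrom Set.univ E C') ∧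
      DefFrom Set.univ E C' ⊂ DefFrom Set.univ E C := by
  let : SM α := ⟨E, hzf.nonempty.choose⟩
  have : ZF0 α := zf0_of_zfModel hzf
  have : ZB α ∅ := zb_of_zfModel hzf
  have : AC α := ac_of_satAC hac
  have hC : Gen C := cohenGeneric_iff.1 hgen
  have hC' := hC.prjClass
  have := hC'.zb
  have hgbc : GBC Set.univ E (DefFrom Set.univ E (prjClass C)) :=
    ⟨gbModel_defFrom hzf, hC'.globalChoice⟩
  have hlt : DefFrom Set.univ E (prjClass C) ⊂ DefFrom Set.univ E C := by
    refine ⟨fun X hX => mem_defFrom.2 ((mem_defFrom.1 hX).trans fun Y hY => ?_), fun h => ?_⟩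
    · obtain rfl := hY
      exact dfb_prjClass
    · exact hC.not_dfb_prjClass
        (mem_defFrom.1 (h (mem_defFrom.2 (Dfb.cls (Set.mem_singleton C) _))))
  exact ⟨⟨_, hgbc, hlt⟩, _, cohenGeneric_iff.2 hC', hgbc, hlt⟩

end SOST
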